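/- There exists an absolute constant ε > 0 with the following property. Let F be a finite field, let n ≥ 2, let G be a subgroup of GL_n(F) with SL_n(F) ≤ G ≤ GL_n(F), and let M be a maximal proper subgroup of G that does not contain SL_n(F). Then the number of conjugacy classes of G that are disjoint from M is at least ε times the total number of conjugacy classes of G. (Equivalently, in the primitive action of G on the coset space G/M, the proportion of conjugacy classes of G consisting entirely of derangements is at least ε.) -/

import Mathlib

namespace BostonShalev

open Matrix

section Embedding

variable {ι κ F : Type*} [Fintype ι] [DecidableEq ι] [Fintype κ] [DecidableEq κ] [Field F]

/-- The linear map that acts as `x` on the image of `B` and trivially on the kernel of `C`,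
for a pair of matrices with `C * B = 1`. -/
def blockHom {B : Matrix ι κ F} {C : Matrix κ ι F} (h : C * B = 1) :
    Matrix κ κ F →* Matrix ι ι F where
  toFun x := 1 + B * (x - 1) * C
  map_one' := by simp
  map_mul' x y := by
    have : B * (x - 1) * C * (B * (y - 1) * C) = B * ((x - 1) * (y - 1)) * C := by
      calc _ = B * (x - 1) * (C * B) * (y - 1) * C := by simp only [Matrix.mul_assoc]
        _ = _ := by rw [h]; simp only [Matrix.mul_assoc, Matrix.mul_one]
    rw [mul_add, add_mul, add_mul, this, one_mul, mul_one, one_mul, add_assoc,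
      ← Matrix.add_mul, ← Matrix.mul_add, ← Matrix.add_mul, ← Matrix.mul_add]
    congr 3
    noncomm_ring

/-- The group homomorphism `GL κ F →* GL ι F` induced by `blockHom`. -/
def blockGL {B : Matrix ι κ F} {C : Matrix κ ι F} (h : C * B = 1) : GL κ F →* GL ι F :=
  Units.map (blockHom h)

variable {B : Matrix ι κ F} {C : Matrix κ ι F} (h : C * B = 1)

theorem blockHom_apply (x : Matrix κ κ F) : blockHom h x = 1 + B * (x - 1) * C := rfl

theorem coe_blockGL (x : GL κ F) : (blockGL h x : Matrix ι ι F) = 1 + B * (x.1 - 1) * C := rfl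

theorem blockHom_mul_left (x : Matrix κ κ F) : blockHom h x * B = B * x := by
  rw [blockHom_apply, Matrix.add_mul, Matrix.mul_assoc _ C, h, Matrix.mul_sub]
  simp

theorem mul_blockHom (x : Matrix κ κ F) : C * blockHom h x = x * C := by
  rw [blockHom_apply, Matrix.mul_add, ← Matrix.mul_assoc, ← Matrix.mul_assoc, h, Matrix.one_mul,
    Matrix.sub_mul]
  simp

theorem det_blockHom (x : Matrix κ κ F) : (blockHom h x).det = x.det := by
  rw [blockHom_apply, Matrix.mul_assoc, Matrix.det_one_add_mul_comm, Matrix.mul_assoc, h]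
  simp

theorem det_blockGL (x : GL κ F) : GeneralLinearGroup.det (blockGL h x) =
    GeneralLinearGroup.det x := by
  ext; exact det_blockHom h _

theorem blockHom_injective : Function.Injective (blockHom h) := fun _ _ hxy => by
  have := congrArg (fun z => C * (z * B)) hxy
  simpa only [blockHom_mul_left, ← Matrix.mul_assoc, h, Matrix.one_mul] using this

theorem blockGL_injective : Function.Injective (blockGL h) := fun _ _ hxy =>
  Units.ext (blockHom_injective h (congrArg Units.val hxy))

theorem conj_mul_eq_one {B : Matrix ι κ F} {C : Matrix κ ι F} (h : C * B = 1) (z : GL ι F) :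
    (C * (z⁻¹ : GL ι F).1) * (z.1 * B) = 1 := by
  rw [Matrix.mul_assoc, ← Matrix.mul_assoc _ z.1, ← Units.val_mul, inv_mul_cancel]
  simpa using h

theorem commute_blockGL {g : GL ι F} {y : Matrix κ κ F} (hB : g.1 * B = B * y)
    (hC : C * g.1 = y * C) {x : GL κ F} (hxy : Commute x.1 y) : Commute (blockGL h x) g := by
  refine Units.ext ?_
  simp only [Units.val_mul, coe_blockGL, Matrix.add_mul, Matrix.mul_add, Matrix.one_mul,
    Matrix.mul_one]
  congr 1
  rw [Matrix.mul_assoc, hC, ← Matrix.mul_assoc g.1, ← Matrix.mul_assoc g.1, hB]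
  simp only [Matrix.mul_sub, Matrix.sub_mul, Matrix.mul_one, Matrix.mul_assoc]
  rw [← Matrix.mul_assoc x.1, hxy.eq]; simp only [Matrix.mul_assoc]

end Embedding

section Generation

variable {ι F : Type*} [Fintype ι] [DecidableEq ι] [Field F]

theorem det_eq_one_iff_mem_range {g : GL ι F} :
    g ∈ (SpecialLinearGroup.toGL (n := ι) (R := F)).range ↔ g.1.det = 1 := by
  constructor
  · rintro ⟨x, rfl⟩; exact x.2
  · intro hg; exact ⟨⟨g.1, hg⟩, Units.ext rfl⟩

/-- The transvection matrix as an element of the general linear group. -/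
def transvectionGL (i j : ι) (hij : i ≠ j) (c : F) : GL ι F :=
  ⟨transvection i j c, transvection i j (-c),
    by rw [transvection_mul_transvection_same _ _ hij]; simp,
    by rw [transvection_mul_transvection_same _ _ hij]; simp⟩

theorem diagonal_two_eq_transvections (d : F) (hd : d ≠ 0) :
    (!![d, 0; 0, d⁻¹] : Matrix (Fin 2) (Fin 2) F) =
      !![1, d; 0, 1] * !![1, 0; -d⁻¹, 1] * !![1, d; 0, 1] *
        (!![1, -1; 0, 1] * !![1, 0; 1, 1] * !![1, -1; 0, 1]) := by
  ext i j
  fin_cases i <;> fin_cases j <;> simp [Matrix.mul_apply, Fin.sum_univ_two] <;> grind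

/-- The coordinate plane spanned by two distinct basis vectors. -/
def planeB (F : Type*) [Field F] (i j : ι) : Matrix ι (Fin 2) F :=
  Matrix.of fun k l => if k = ![i, j] l then 1 else 0

theorem planeB_transpose_mul {i j : ι} (hij : i ≠ j) : (planeB F i j)ᵀ * planeB F i j = 1 := by
  ext a b
  have : ∀ a b, ((planeB F i j)ᵀ * planeB F i j) a b =
      ∑ k, if k = ![i, j] a then (if k = ![i, j] b then (1 : F) else 0) else 0 := fun a b => by
    simp only [planeB, Matrix.mul_apply, transpose_apply, of_apply, mul_boole]
    simp [eq_comm]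
  rw [this, Finset.sum_ite_eq']
  fin_cases a <;> fin_cases b <;> simp [hij, hij.symm]

theorem sl_le_of_transvection_mem (K : Subgroup (GL ι F))
    (hK : ∀ (i j : ι) (hij : i ≠ j) (c : F), transvectionGL i j hij c ∈ K) :
    (SpecialLinearGroup.toGL (n := ι) (R := F)).range ≤ K := by
  intro g hg
  rw [det_eq_one_iff_mem_range] at hg
  have key : ∀ A : Matrix ι ι F, A.det = 1 → ∃ k ∈ K, k.1 = A := by
    intro A hA
    obtain ⟨L, L', D, h⟩ := Matrix.Pivot.exists_list_transvec_mul_diagonal_mul_list_transvec A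
    have hL : ∀ L : List (TransvectionStruct ι F),
        ∃ k ∈ K, k.1 = (L.map TransvectionStruct.toMatrix).prod := by
      intro L
      induction L with
      | nil => exact ⟨1, K.one_mem, by simp⟩
      | cons t L ih =>
        obtain ⟨k, hk, h⟩ := ih
        exact ⟨_, K.mul_mem (hK t.i t.j t.hij t.c) hk, by
          simp [h, transvectionGL, TransvectionStruct.toMatrix]⟩
    have hD : (diagonal D).det = 1 := by simpa [h] using hA
    have hu : ∀ i j (hij : i ≠ j) (x : GL (Fin 2) F),
        (∃ c, x.1 = !![1, c; 0, 1]) ∨ (∃ c, x.1 = !![1, 0; c, 1]) →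
        blockGL (planeB_transpose_mul (F := F) hij) x ∈ K := by
      rintro i j hij x (⟨c, hx⟩ | ⟨c, hx⟩)
      · convert hK i j hij c
        ext a b
        simp [coe_blockGL, hx, transvectionGL, transvection, planeB, Matrix.mul_apply,
          Matrix.single_apply, Fin.sum_univ_two, Matrix.one_apply, Matrix.add_apply]
        grind
      · convert hK j i hij.symm c
        ext a b
        simp [coe_blockGL, hx, transvectionGL, transvection, planeB, Matrix.mul_apply,
          Matrix.single_apply, Fin.sum_univ_two, Matrix.one_apply, Matrix.add_apply]
        grind
    have hh : ∀ i j (hij : i ≠ j) (d : Fˣ), ∃ k ∈ K, k.1 = diagonal fun l =>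
        if l = i then d.1 else if l = j then d.1⁻¹ else 1 := by
      intro i j hij d
      have U : ∀ c : F, ∃ x : GL (Fin 2) F, x.1 = !![1, c; 0, 1] := fun c =>
        ⟨GeneralLinearGroup.mkOfDetNeZero !![1, c; 0, 1] (by simp), rfl⟩
      have V : ∀ c : F, ∃ x : GL (Fin 2) F, x.1 = !![1, 0; c, 1] := fun c =>
        ⟨GeneralLinearGroup.mkOfDetNeZero !![1, 0; c, 1] (by simp), rfl⟩
      obtain ⟨u, hu1⟩ := U d
      obtain ⟨v, hv1⟩ := V (-d.1⁻¹)
      obtain ⟨u', hu2⟩ := U (-1)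
      obtain ⟨v', hv2⟩ := V 1
      refine ⟨_, K.mul_mem (K.mul_mem (K.mul_mem (hu i j hij u (.inl ⟨_, hu1⟩))
        (hu i j hij v (.inr ⟨_, hv1⟩))) (hu i j hij u (.inl ⟨_, hu1⟩)))
        (K.mul_mem (K.mul_mem (hu i j hij u' (.inl ⟨_, hu2⟩)) (hu i j hij v' (.inr ⟨_, hv2⟩)))
          (hu i j hij u' (.inl ⟨_, hu2⟩))), ?_⟩
      rw [← map_mul, ← map_mul, ← map_mul, ← map_mul, ← map_mul, coe_blockGL]
      simp only [Units.val_mul, hu1, hv1, hu2, hv2]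
      rw [← diagonal_two_eq_transvections _ d.ne_zero]
      ext a b
      simp [planeB, Matrix.mul_apply, Fin.sum_univ_two, Matrix.one_apply, Matrix.add_apply,
        diagonal_apply]
      grind
    have hdiag : ∃ k ∈ K, k.1 = diagonal D := by
      rcases isEmpty_or_nonempty ι with hι | ⟨⟨i₀⟩⟩
      · exact ⟨1, K.one_mem, Subsingleton.elim _ _⟩
      rw [det_diagonal] at hD
      let D' : ι → Fˣ := fun i => Units.mk0 (D i) fun h0 => by
        rw [Finset.prod_eq_zero (Finset.mem_univ i) h0] at hD; exact zero_ne_one hD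
      have hD' : ∀ i, (D' i : F) = D i := fun i => rfl
      have : ∀ s : Finset ι, i₀ ∉ s → ∃ k ∈ K, k.1 = diagonal fun l =>
          if l ∈ s then D l else if l = i₀ then (∏ i ∈ s, D i)⁻¹ else 1 := by
        intro s
        induction s using Finset.induction_on with
        | empty => exact fun _ => ⟨1, K.one_mem, by simp⟩
        | insert a s ha ih =>
          intro hs
          rw [Finset.mem_insert, not_or] at hs
          obtain ⟨k, hk, e⟩ := ih hs.2
          obtain ⟨k', hk', e'⟩ := hh a i₀ (Ne.symm hs.1) (D' a)
          refine ⟨_, K.mul_mem hk' hk, ?_⟩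
          rw [Units.val_mul, e, e', diagonal_mul_diagonal, Finset.prod_insert ha]
          congr 1
          ext l
          have := (D' a).ne_zero
          rw [hD'] at this ⊢
          by_cases h1 : l = a
          · subst h1; simp [ha, Ne.symm hs.1]
          · by_cases h2 : l = i₀
            · subst h2; simp [h1, hs.2]; ring
            · simp [h1, h2]
      obtain ⟨k, hk, e⟩ := this (Finset.univ.erase i₀) (by simp)
      refine ⟨k, hk, e.trans ?_⟩
      congr 1
      ext l
      by_cases h2 : l = i₀
      · subst h2
        rw [← Finset.mul_prod_erase _ _ (Finset.mem_univ l)] at hD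
        simpa using (eq_inv_of_mul_eq_one_left hD).symm
      · simp [h2]
    obtain ⟨k, hk, e⟩ := hdiag
    obtain ⟨k₁, hk₁, e₁⟩ := hL L
    obtain ⟨k₂, hk₂, e₂⟩ := hL L'
    exact ⟨_, K.mul_mem (K.mul_mem hk₁ hk) hk₂, by rw [h, ← e, ← e₁, ← e₂]; rfl⟩
  obtain ⟨k, hk, h⟩ := key g.1 hg
  rwa [← Units.ext h]

end Generation

end BostonShalev

namespace BostonShalev

section Counting

variable {α β : Type*}

open scoped Classical in
theorem sum_ncard_comm [Fintype α] [Fintype β] (R : α → β → Prop) :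
    ∑ a, {b | R a b}.ncard = ∑ b, {a | R a b}.ncard := by
  have := Finset.sum_card_bipartiteAbove_eq_sum_card_bipartiteBelow R
    (s := (Finset.univ : Finset α)) (t := (Finset.univ : Finset β))
  simpa only [Finset.bipartiteAbove, Finset.bipartiteBelow, Set.ncard_eq_toFinset_card',
    Set.toFinset_ofPred] using this

open scoped Classical in
theorem ncard_prod_eq_sum [Fintype α] [Finite β] (R : α → β → Prop) :
    {p : α × β | R p.1 p.2}.ncard = ∑ a, {b | R a b}.ncard := by
  have e : {p : α × β | R p.1 p.2} ≃ Σ a : α, {b | R a b} :=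
    { toFun := fun p => ⟨p.1.1, p.1.2, p.2⟩
      invFun := fun q => ⟨(q.1, q.2.1), q.2.2⟩
      left_inv := fun _ => rfl
      right_inv := fun _ => rfl }
  simp only [← Nat.card_coe_set_eq]
  rw [Nat.card_congr e, Nat.card_sigma]

open scoped Classical in
theorem ncard_le_mul_ncard {s : Set α} {t : Set β} (ht : t.Finite) (f : α → β)
    (hf : ∀ a ∈ s, f a ∈ t) (c : ℕ) (hs : s.Finite)
    (hc : ∀ b ∈ t, {a | a ∈ s ∧ f a = b}.ncard ≤ c) : s.ncard ≤ c * t.ncard := by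
  rw [Set.ncard_eq_toFinset_card s hs, Set.ncard_eq_toFinset_card t ht]
  refine Finset.card_le_mul_card_image_of_maps_to (f := f) (by simpa using hf) c ?_
  intro b hb
  refine le_trans (le_of_eq ?_) (hc b (by simpa using hb))
  rw [← Set.ncard_coe_finset]
  congr 1
  ext a; simp

open scoped Classical in
theorem sum_ite_const [Fintype α] (X : Set α) (c : ℕ) :
    ∑ g, (if g ∈ X then c else 0) = c * X.ncard := by
  rw [← Finset.sum_filter, Finset.sum_const, smul_eq_mul, mul_comm, Set.ncard_eq_toFinset_card',
    Set.filter_mem_univ_eq_toFinset]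

end Counting

section Fixed

variable {Γ : Type*} [Group Γ] (G H : Subgroup Γ)

/-- Elements of `H` whose only fixed point on `G ⧸ H` is the base point. -/
def IsGood (m : Γ) : Prop := m ∈ H ∧ ∀ x ∈ G, x⁻¹ * m * x ∈ H → x ∈ H

/-- The elements of `G` that are not conjugate in `G` to an element of `H`. -/
def derangements : Set Γ := {g | g ∈ G ∧ ∀ x ∈ G, x⁻¹ * g * x ∉ H}

variable {G H}

theorem IsGood.mem_of_commute {m h : Γ} (hm : IsGood G H m) (hmG : m ∈ G) (hh : h ∈ G)
    (hc : Commute (h * m * h⁻¹) m) : h ∈ H := by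
  have key : h⁻¹ * m * h ∈ H := by
    have := hm.2 (h⁻¹ * m * h)⁻¹ (G.inv_mem (G.mul_mem (G.mul_mem (G.inv_mem hh) hmG) hh)) (by
      have : (h⁻¹ * m * h)⁻¹⁻¹ * m * (h⁻¹ * m * h)⁻¹ = h⁻¹ * (m * (h * m * h⁻¹)) * m⁻¹ * h := by
        group
      rw [this, ← hc.eq]
      convert hm.1 using 1
      group)
    simpa using H.inv_mem this
  exact hm.2 h hh key

variable (G H) in
/-- `|H|` times the number of fixed points of `g` on `G ⧸ H`. -/
noncomputable def conjCount (g : Γ) : ℕ := {x : Γ | x ∈ G ∧ x⁻¹ * g * x ∈ H}.ncard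

theorem card_dvd_conjCount (hHG : H ≤ G) (g : Γ) : Nat.card H ∣ conjCount G H g := by
  have : {x : Γ | x ∈ G ∧ x⁻¹ * g * x ∈ H} =
      QuotientGroup.mk ⁻¹' ((QuotientGroup.mk : Γ → Γ ⧸ H) '' {x | x ∈ G ∧ x⁻¹ * g * x ∈ H}) := by
    refine Set.Subset.antisymm (Set.subset_preimage_image _ _) ?_
    rintro y ⟨x, ⟨hx, hxg⟩, hxy⟩
    have hxy : x⁻¹ * y ∈ H := QuotientGroup.eq.1 hxy
    refine ⟨by simpa using G.mul_mem hx (hHG hxy), ?_⟩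
    convert H.mul_mem (H.mul_mem (H.inv_mem hxy) hxg) hxy using 1
    group
  rw [conjCount, this, ← Nat.card_coe_set_eq,
    Nat.card_congr (QuotientGroup.preimageMkEquivSubgroupProdSet H _), Nat.card_prod]
  exact dvd_mul_right _ _

open scoped Classical in
theorem sum_conjCount [Fintype Γ] (X : Set Γ)
    (hX : ∀ g ∈ X, ∀ x ∈ G, x * g * x⁻¹ ∈ X) :
    ∑ g, (if g ∈ X then conjCount G H g else 0) = Nat.card G * {g | g ∈ X ∧ g ∈ H}.ncard := by
  have h1 : ∀ g, (if g ∈ X then conjCount G H g else 0) =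
      {x : Γ | g ∈ X ∧ x ∈ G ∧ x⁻¹ * g * x ∈ H}.ncard := by
    intro g
    split_ifs with h <;> simp [h, conjCount]
  have h2 : ∀ x : Γ, {g : Γ | g ∈ X ∧ x ∈ G ∧ x⁻¹ * g * x ∈ H}.ncard =
      if x ∈ G then {g | g ∈ X ∧ g ∈ H}.ncard else 0 := by
    intro x
    split_ifs with h
    · refine Set.ncard_congr (fun g _ => x⁻¹ * g * x) ?_ ?_ ?_
      · rintro g ⟨h1, h2, h3⟩
        exact ⟨by simpa using hX g h1 x⁻¹ (G.inv_mem h), h3⟩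
      · intro a b _ _ hab; simpa using hab
      · rintro g ⟨h1, h2⟩
        exact ⟨x * g * x⁻¹, ⟨hX g h1 x h, h, by simpa [mul_assoc] using h2⟩, by simp [mul_assoc]⟩
    · simp [h]
  simp_rw [h1]
  rw [sum_ncard_comm]
  simp_rw [h2]
  rw [← Finset.sum_filter, Finset.sum_const, smul_eq_mul]
  congr 1
  rw [Nat.card_eq_fintype_card, Fintype.card_subtype]

theorem conjCount_eq_zero_iff [Finite Γ] {g : Γ} (hg : g ∈ G) :
    conjCount G H g = 0 ↔ g ∈ derangements G H := by
  rw [conjCount, Set.ncard_eq_zero (Set.toFinite _), Set.eq_empty_iff_forall_notMem]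
  simp [derangements, hg]

theorem card_mul_le_of_conj_invariant [Finite Γ] (hHG : H ≤ G) (X : Set Γ) (hXG : X ⊆ G)
    (hX : ∀ g ∈ X, ∀ x ∈ G, x * g * x⁻¹ ∈ X) :
    Nat.card H * X.ncard ≤ Nat.card H * (derangements G H).ncard +
      Nat.card G * {g | g ∈ X ∧ g ∈ H}.ncard := by
  classical
  have := Fintype.ofFinite Γ
  rw [← sum_conjCount X hX, ← sum_ite_const, ← sum_ite_const, ← Finset.sum_add_distrib]
  refine Finset.sum_le_sum fun g _ => ?_
  by_cases hg : g ∈ X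
  · by_cases hz : g ∈ derangements G H
    · simp [hg, hz]
    · simp only [hg, hz, if_true, if_false, zero_add]
      exact Nat.le_of_dvd (Nat.pos_of_ne_zero fun h0 => hz ((conjCount_eq_zero_iff (hXG hg)).1 h0))
        (card_dvd_conjCount hHG g)
  · simp [hg]

theorem conjCount_conj (g : Γ) {y : Γ} (hy : y ∈ G) :
    conjCount G H (y * g * y⁻¹) = conjCount G H g := by
  refine Set.ncard_congr (fun x _ => y⁻¹ * x) ?_ ?_ ?_
  · rintro x ⟨h1, h2⟩
    exact ⟨G.mul_mem (G.inv_mem hy) h1, by convert h2 using 1; group⟩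
  · intro a b _ _ hab; simpa using hab
  · rintro x ⟨h1, h2⟩
    exact ⟨y * x, ⟨G.mul_mem hy h1, by convert h2 using 1; group⟩, by simp⟩

theorem card_bad_mul_le [Finite Γ] (hHG : H ≤ G) :
    Nat.card G * {m | m ∈ H ∧ ¬ IsGood G H m}.ncard ≤
      2 * (Nat.card H * (derangements G H).ncard) := by
  classical
  have := Fintype.ofFinite Γ
  set X : Set Γ := {g | g ∈ G ∧ 2 * Nat.card H ≤ conjCount G H g} with hXdef
  have hX : ∀ g ∈ X, ∀ x ∈ G, x * g * x⁻¹ ∈ X := fun g hg x hx =>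
    ⟨G.mul_mem (G.mul_mem hx hg.1) (G.inv_mem hx), by rw [conjCount_conj g hx]; exact hg.2⟩
  have hH : 0 < Nat.card H := Nat.card_pos
  have hbad : {m | m ∈ H ∧ ¬ IsGood G H m} ⊆ {g | g ∈ X ∧ g ∈ H} := by
    rintro m ⟨hm, hb⟩
    refine ⟨⟨hHG hm, ?_⟩, hm⟩
    simp only [IsGood, hm, true_and, not_forall] at hb
    obtain ⟨x, hx, hxm, hxH⟩ := hb
    have hlt : Nat.card H < conjCount G H m := by
      rw [show Nat.card H = (H : Set Γ).ncard from Nat.card_coe_set_eq _]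
      refine Set.ncard_lt_ncard ⟨fun y hy => ⟨hHG hy, ?_⟩, fun h => hxH (h ⟨hx, hxm⟩)⟩
        (Set.toFinite _)
      exact H.mul_mem (H.mul_mem (H.inv_mem hy) hm) hy
    obtain ⟨k, hk⟩ := card_dvd_conjCount hHG m
    rw [hk] at hlt ⊢
    have : 2 ≤ k := by by_contra hk2; interval_cases k <;> omega
    nlinarith
  refine (Nat.mul_le_mul_left _ (Set.ncard_le_ncard hbad (Set.toFinite _))).trans ?_
  have hall := sum_conjCount (H := H) (G : Set Γ) (fun g hg x hx =>
    G.mul_mem (G.mul_mem hx hg) (G.inv_mem hx))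
  have e : {g | g ∈ (G : Set Γ) ∧ g ∈ H}.ncard = Nat.card H := by
    rw [← SetLike.coe_sort_coe, Nat.card_coe_set_eq]
    congr 1; ext g; exact ⟨fun h => h.2, fun h => ⟨hHG h, h⟩⟩
  rw [e] at hall
  have hG : Nat.card G = (G : Set Γ).ncard := Nat.card_coe_set_eq _
  have main : ∑ g, ((if g ∈ (G : Set Γ) then 2 * Nat.card H else 0) +
      (if g ∈ X then conjCount G H g else 0)) ≤
      ∑ g, (2 * (if g ∈ (G : Set Γ) then conjCount G H g else 0) +
        (if g ∈ derangements G H then 2 * Nat.card H else 0)) := by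
    refine Finset.sum_le_sum fun g _ => ?_
    by_cases hg : g ∈ (G : Set Γ)
    · by_cases hz : g ∈ derangements G H
      · have := (conjCount_eq_zero_iff (H := H) hg).2 hz
        simp [hg, hz, this]
      · have h0 : conjCount G H g ≠ 0 := fun h0 => hz ((conjCount_eq_zero_iff hg).1 h0)
        have := Nat.le_of_dvd (Nat.pos_of_ne_zero h0) (card_dvd_conjCount hHG g)
        by_cases hgX : g ∈ X
        · have := hgX.2
          simp only [hg, hz, hgX, if_true, if_false]; omega
        · simp only [hg, hz, hgX, if_true, if_false]; omega
    · have h1 : g ∉ X := fun h => hg h.1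
      simp [hg, h1]
  have hs : ∑ g, (if g ∈ X then conjCount G H g else 0) =
      Nat.card G * {g | g ∈ X ∧ g ∈ H}.ncard := by
    convert sum_conjCount X hX
  rw [Finset.sum_add_distrib, Finset.sum_add_distrib, ← Finset.mul_sum, hall, hs,
    sum_ite_const, sum_ite_const, ← hG] at main
  nlinarith

theorem exists_good_of_lt [Finite Γ] (hHG : H ≤ G) (X : Set Γ) (hXG : X ⊆ G)
    (hX : ∀ g ∈ X, ∀ x ∈ G, x * g * x⁻¹ ∈ X) (h : 3 * (derangements G H).ncard < X.ncard) :
    ∃ m ∈ X, IsGood G H m := by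
  by_contra! hcon
  have h1 := card_mul_le_of_conj_invariant hHG X hXG hX
  have h2 := card_bad_mul_le hHG
  have h3 : {g | g ∈ X ∧ g ∈ H}.ncard ≤ {m | m ∈ H ∧ ¬ IsGood G H m}.ncard :=
    Set.ncard_le_ncard (fun g hg => ⟨hg.2, hcon g hg.1⟩) (Set.toFinite _)
  have h4 : 0 < Nat.card H := Nat.card_pos
  nlinarith [Nat.mul_le_mul_left (Nat.card G) h3]

theorem derangements_nonempty [Finite Γ] (hHG : H < G) : (derangements G H).Nonempty := by
  by_contra hcon
  rw [Set.not_nonempty_iff_eq_empty] at hcon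
  have h2 := card_bad_mul_le hHG.le
  rw [hcon, Set.ncard_empty, mul_zero, mul_zero, Nat.le_zero, mul_eq_zero,
    Set.ncard_eq_zero (Set.toFinite _)] at h2
  obtain h2 | h2 := h2
  · exact Nat.card_pos.ne' h2
  · obtain ⟨x, hx, hxH⟩ := Set.exists_of_ssubset hHG
    have : (1 : Γ) ∈ {m | m ∈ H ∧ ¬ IsGood G H m} :=
      ⟨H.one_mem, fun h => hxH (h.2 x hx (by simp [H.one_mem]))⟩
    rw [h2] at this; exact this

end Fixed

end BostonShalev

namespace BostonShalev

open Polynomial Matrix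

section Monics

variable (F : Type*) [Field F]

/-- Monic polynomials of degree `n`. -/
def monics (n : ℕ) : Set F[X] := {f | f.Monic ∧ f.natDegree = n}

/-- Monic polynomials of degree `n` with constant coefficient `δ`. -/
def monicsC (n : ℕ) (δ : F) : Set F[X] := {f | f ∈ monics F n ∧ f.coeff 0 = δ}

variable {F}

theorem mem_monicsC_succ_iff {n : ℕ} {δ : F} {f : F[X]} :
    f ∈ monicsC F (n + 1) δ ↔ ∃ g ∈ monics F n, f = X * g + C δ := by
  constructor
  · rintro ⟨⟨h1, h2⟩, h3⟩
    refine ⟨f.divX, ⟨?_, by simp [natDegree_divX_eq_natDegree_tsub_one, h2]⟩, ?_⟩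
    · rw [Monic, leadingCoeff, natDegree_divX_eq_natDegree_tsub_one, h2, coeff_divX]
      simpa [Monic, leadingCoeff, h2] using h1
    · rw [← h3]; exact (X_mul_divX_add f).symm
  · rintro ⟨g, ⟨h1, h2⟩, rfl⟩
    have hm : (X * g).Monic := monic_X.mul h1
    have hd : (X * g).natDegree = n + 1 := by
      rw [monic_X.natDegree_mul h1, natDegree_X, h2, add_comm]
    refine ⟨⟨hm.add_of_left ?_, ?_⟩, by simp⟩
    · refine lt_of_le_of_lt degree_C_le ?_
      rw [degree_eq_natDegree hm.ne_zero, hd]; exact_mod_cast Nat.succ_pos n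
    · rw [natDegree_add_C, hd]

theorem monic_mul_mem {m n : ℕ} {f g : F[X]} (hf : f ∈ monics F m) (hg : g ∈ monics F n) :
    f * g ∈ monics F (m + n) :=
  ⟨hf.1.mul hg.1, by rw [hf.1.natDegree_mul hg.1, hf.2, hg.2]⟩

theorem X_sub_C_mem (a : F) : X - C a ∈ monics F 1 := ⟨monic_X_sub_C a, natDegree_X_sub_C a⟩

section Finite

variable (F)

variable [Fintype F]

theorem finite_monics (n : ℕ) : (monics F n).Finite :=
  have : Finite (degreeLT F n) := Finite.of_equiv _ (degreeLTEquiv F n).symm.toEquiv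
  Finite.of_equiv _ (monicEquivDegreeLT (R := F) n).symm

theorem ncard_monics (n : ℕ) : (monics F n).ncard = Fintype.card F ^ n := by
  rw [← Nat.card_coe_set_eq]
  refine (Nat.card_congr ((monicEquivDegreeLT (R := F) n).trans
    (degreeLTEquiv F n).toEquiv)).trans ?_
  simp [Nat.card_eq_fintype_card]

variable {F}

theorem finite_monicsC (n : ℕ) (δ : F) : (monicsC F n δ).Finite :=
  (finite_monics F n).subset fun _ h => h.1

theorem ncard_monicsC (n : ℕ) (δ : F) :
    (monicsC F (n + 1) δ).ncard = Fintype.card F ^ n := by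
  rw [← ncard_monics F n]
  have : monicsC F (n + 1) δ = (fun g => X * g + C δ) '' monics F n := by
    ext f; rw [mem_monicsC_succ_iff]; simp [eq_comm]
  rw [this]
  refine Set.ncard_image_of_injective _ fun a b hab => ?_
  simpa using hab

end Finite

end Monics

section Companion

variable {F : Type*} [Field F]

theorem exists_companion {n : ℕ} {f : F[X]} (hf : f ∈ monics F n) :
    ∃ (A : Matrix (Fin n) (Fin n) F) (v : Fin n → F), A.charpoly = f ∧
      ∀ X Y : Matrix (Fin n) (Fin n) F, Commute X A → Commute Y A → X *ᵥ v = Y *ᵥ v → X = Y := by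
  obtain ⟨hm, rfl⟩ := hf
  let pb := AdjoinRoot.powerBasis hm.ne_zero
  have hdim : pb.dim = f.natDegree := AdjoinRoot.powerBasis_dim hm.ne_zero
  have key : ∃ (A : Matrix (Fin pb.dim) (Fin pb.dim) F) (v : Fin pb.dim → F), A.charpoly = f ∧
      ∀ X Y : Matrix (Fin pb.dim) (Fin pb.dim) F, Commute X A → Commute Y A →
        X *ᵥ v = Y *ᵥ v → X = Y := by
    refine ⟨Algebra.leftMulMatrix pb.basis pb.gen, pb.basis.repr 1, ?_, ?_⟩
    · rw [charpoly_leftMulMatrix, AdjoinRoot.powerBasis_gen, AdjoinRoot.minpoly_root hm.ne_zero,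
        hm.leadingCoeff]
      simp
    · intro X Y hX hY hXY
      have hv : ∀ k : ℕ, (Algebra.leftMulMatrix pb.basis pb.gen ^ k) *ᵥ pb.basis.repr 1 =
          pb.basis.repr (pb.gen ^ k) := by
        intro k
        rw [← map_pow, Algebra.leftMulMatrix_mulVec_repr, mul_one]
      have hcol : ∀ i : Fin pb.dim, X *ᵥ Pi.single i 1 = Y *ᵥ Pi.single i 1 := by
        intro i
        have : Pi.single i (1 : F) = pb.basis.repr (pb.gen ^ (i : ℕ)) := by
          rw [← pb.basis_eq_pow, Module.Basis.repr_self, Finsupp.single_eq_pi_single]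
        rw [this, ← hv, Matrix.mulVec_mulVec, Matrix.mulVec_mulVec, (hX.pow_right _).eq,
          (hY.pow_right _).eq, ← Matrix.mulVec_mulVec, ← Matrix.mulVec_mulVec, hXY]
      ext i j
      simpa using congrFun (hcol j) i
  rw [← hdim]; exact key

theorem det_eq_of_charpoly {n : ℕ} (A : Matrix (Fin n) (Fin n) F) :
    A.charpoly.coeff 0 = (-1) ^ n * A.det := by
  rw [det_eq_sign_charpoly_coeff, Fintype.card_fin, ← mul_assoc, ← mul_pow]; simp

theorem charpoly_mem_monics {n : ℕ} (A : Matrix (Fin n) (Fin n) F) : A.charpoly ∈ monics F n :=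
  ⟨A.charpoly_monic, by simp⟩

theorem charpoly_conj {n : ℕ} (x g : GL (Fin n) F) : (x * g * x⁻¹).1.charpoly = g.1.charpoly := by
  rw [Units.val_mul, Units.val_mul, coe_units_inv]; exact charpoly_units_conj x g.1

end Companion

section Classes

variable {F : Type*} [Field F] {n : ℕ} (G H : Subgroup (GL (Fin n) F))

/-- The number of conjugacy classes of `G` that do not meet `H`. -/
noncomputable def missed : ℕ :=
  {c : ConjClasses G | ∀ g ∈ c.carrier, (g : GL (Fin n) F) ∉ H}.ncard

/-- Constant coefficients of the characteristic polynomials of elements of `G`. -/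
def constants : Set F := {δ | ∃ g ∈ G, (-1) ^ n * g.1.det = δ}

/-- `G` contains the special linear group. -/
def ContainsSL : Prop := (SpecialLinearGroup.toGL (n := Fin n) (R := F)).range ≤ G

variable {G H}

theorem ContainsSL.mem_of_det_eq (hG : ContainsSL G) {g h : GL (Fin n) F} (hg : g ∈ G)
    (h1 : h.1.det = g.1.det) : h ∈ G := by
  have : h * g⁻¹ ∈ G := hG (det_eq_one_iff_mem_range.2 (by
    have hu : g.1.det * (g⁻¹).1.det = 1 := by rw [← det_mul, ← Units.val_mul]; simp
    rw [Units.val_mul, det_mul, h1, hu]))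
  simpa using G.mul_mem this hg

theorem ContainsSL.mem_iff (hG : ContainsSL G) {g : GL (Fin n) F} :
    g ∈ G ↔ g.1.charpoly.coeff 0 ∈ constants G := by
  rw [det_eq_of_charpoly]
  constructor
  · intro h; exact ⟨g, h, rfl⟩
  · rintro ⟨h, hh, e⟩
    exact hG.mem_of_det_eq hh (by simpa using e.symm)

theorem constants_ne_zero {δ : F} (h : δ ∈ constants G) : δ ≠ 0 := by
  obtain ⟨g, _, rfl⟩ := h
  have : g.1.det ≠ 0 := (g.isUnit.map Matrix.detMonoidHom).ne_zero
  simp [this]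

theorem constants_nonempty : (constants G).Nonempty := ⟨_, 1, G.one_mem, rfl⟩

/-- The possible characteristic polynomials of elements of `G`. -/
def classPolys (G : Subgroup (GL (Fin n) F)) : Set F[X] :=
  {f | f ∈ monics F n ∧ f.coeff 0 ∈ constants G}

theorem charpoly_mem_classPolys {g : GL (Fin n) F} (hg : g ∈ G) : g.1.charpoly ∈ classPolys G :=
  ⟨charpoly_mem_monics _, g, hg, (det_eq_of_charpoly _).symm⟩

theorem isUnit_of_charpoly_coeff_ne {A : Matrix (Fin n) (Fin n) F} (h : A.charpoly.coeff 0 ≠ 0) :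
    IsUnit A := by
  rw [Matrix.isUnit_iff_isUnit_det, isUnit_iff_ne_zero]
  rw [det_eq_of_charpoly] at h
  exact right_ne_zero_of_mul h

theorem exists_mem_charpoly_eq (hG : ContainsSL G) {f : F[X]} (hf : f ∈ classPolys G) :
    ∃ g ∈ G, g.1.charpoly = f ∧ ∃ v : Fin n → F, ∀ X Y : Matrix (Fin n) (Fin n) F,
      Commute X g.1 → Commute Y g.1 → X *ᵥ v = Y *ᵥ v → X = Y := by
  obtain ⟨A, v, hA, hv⟩ := exists_companion hf.1
  obtain ⟨u, rfl⟩ := isUnit_of_charpoly_coeff_ne (A := A) (by rw [hA]; exact constants_ne_zero hf.2)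
  exact ⟨u, hG.mem_iff.2 (by rw [hA]; exact hf.2), hA, v, hv⟩

variable [Fintype F]

theorem ncard_charpoly_derangements_le :
    {f : F[X] | ∃ g ∈ derangements G H, g.1.charpoly = f}.ncard ≤ missed G H := by
  classical
  have hex : ∀ f : F[X], ∃ c : ConjClasses G, f ∈ {f : F[X] | ∃ g ∈ derangements G H,
      g.1.charpoly = f} → c ∈ {c : ConjClasses G | ∀ g ∈ c.carrier, (g : GL (Fin n) F) ∉ H} ∧
        ∃ g : G, g ∈ c.carrier ∧ g.1.1.charpoly = f := by
    intro f
    by_cases hf : f ∈ {f : F[X] | ∃ g ∈ derangements G H, g.1.charpoly = f}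
    · obtain ⟨g, hg, rfl⟩ := hf
      refine ⟨ConjClasses.mk ⟨g, hg.1⟩, fun _ => ⟨?_, ⟨g, hg.1⟩, ConjClasses.mem_carrier_mk, rfl⟩⟩
      intro k hk hkH
      rw [ConjClasses.mem_carrier_iff_mk_eq, ConjClasses.mk_eq_mk_iff_isConj, isConj_iff] at hk
      obtain ⟨x, hx⟩ := hk
      have := congrArg Subtype.val hx
      refine hg.2 x x.2 ?_
      have e : g = x.1 * k.1 * x.1⁻¹ := this.symm
      rw [e]; simpa [mul_assoc] using hkH
    · exact ⟨1, fun h => absurd h hf⟩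
  choose c hc using hex
  refine Set.ncard_le_ncard_of_injOn c (fun f hf => (hc f hf).1) ?_ (Set.toFinite _)
  intro f hf f' hf' h
  obtain ⟨g, hg, rfl⟩ := (hc f hf).2
  obtain ⟨g', hg', rfl⟩ := (hc f' hf').2
  rw [h, ConjClasses.mem_carrier_iff_mk_eq] at hg
  rw [ConjClasses.mem_carrier_iff_mk_eq, ← hg, ConjClasses.mk_eq_mk_iff_isConj, isConj_iff] at hg'
  obtain ⟨x, hx⟩ := hg'
  have : g.1 = x.1 * g'.1 * x.1⁻¹ := (congrArg Subtype.val hx).symm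
  rw [this, charpoly_conj]

theorem ncard_classPolys (G : Subgroup (GL (Fin (n + 1)) F)) :
    (classPolys G).ncard = (constants G).ncard * Fintype.card F ^ n := by
  classical
  have e : classPolys G =
      (fun p : F × F[X] => X * p.2 + C p.1) '' (constants G ×ˢ monics F n) := by
    ext f
    constructor
    · rintro ⟨h1, h2⟩
      obtain ⟨g, hg, e⟩ := mem_monicsC_succ_iff.1 (⟨h1, rfl⟩ : f ∈ monicsC F (n + 1) (f.coeff 0))
      exact ⟨(_, g), ⟨h2, hg⟩, e.symm⟩
    · rintro ⟨⟨δ, g⟩, ⟨h1, h2⟩, rfl⟩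
      have := mem_monicsC_succ_iff.2 ⟨g, h2, (rfl : X * g + C δ = _)⟩
      exact ⟨this.1, by rw [this.2]; exact h1⟩
  rw [e, Set.ncard_image_of_injective, Set.ncard_prod, ncard_monics]
  rintro ⟨a, g⟩ ⟨b, h⟩ hab
  have h0 := congrArg (fun f => coeff f 0) hab
  simp only [coeff_add, mul_coeff_zero, coeff_X_zero, zero_mul, zero_add, coeff_C_zero] at h0
  subst h0
  simpa using hab

theorem finite_classPolys (G : Subgroup (GL (Fin n) F)) : (classPolys G).Finite :=
  (finite_monics F n).subset fun _ h => h.1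

/-- Class polynomials avoided by the characteristic polynomials of `H` produce missed classes. -/
theorem ncard_le_missed (hG : ContainsSL G) {S : Set F[X]} (hS : S ⊆ classPolys G)
    (hH : ∀ h ∈ H, h.1.charpoly ∉ S) : S.ncard ≤ missed G H := by
  refine le_trans (Set.ncard_le_ncard ?_ ?_) (ncard_charpoly_derangements_le (G := G) (H := H))
  · intro f hf
    obtain ⟨g, hg, rfl, _⟩ := exists_mem_charpoly_eq hG (hS hf)
    refine ⟨g, ⟨hg, fun x _ hxH => hH _ hxH ?_⟩, rfl⟩
    have := charpoly_conj x⁻¹ g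
    rw [inv_inv] at this
    rwa [this]
  · refine (finite_classPolys G).subset ?_
    rintro f ⟨g, hg, rfl⟩
    exact charpoly_mem_classPolys hg.1

theorem card_mul_constants (hG : ContainsSL G) :
    Nat.card G = (constants G).ncard * Nat.card (SpecialLinearGroup (Fin n) F) := by
  classical
  let φ : G →* Fˣ := GeneralLinearGroup.det.comp G.subtype
  rw [← φ.ker.index_mul_card, Subgroup.index_ker]
  congr 1
  · rw [← Nat.card_coe_set_eq]
    refine Nat.card_congr (Equiv.ofBijective (fun d => ⟨(-1) ^ n * d.1.1, ?_⟩) ⟨?_, ?_⟩)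
    · obtain ⟨_, g, rfl⟩ := d
      exact ⟨g, g.2, rfl⟩
    · intro d d' h
      have h := congrArg Subtype.val h
      exact Subtype.ext (Units.ext (mul_left_cancel₀ (by simp) h))
    · rintro ⟨_, g, hg, rfl⟩
      exact ⟨⟨φ ⟨g, hg⟩, ⟨g, hg⟩, rfl⟩, rfl⟩
  · refine Nat.card_congr (Equiv.ofBijective (fun x => ⟨x.1.1.1, ?_⟩) ⟨?_, ?_⟩)
    · have := x.2
      rw [MonoidHom.mem_ker] at this
      exact congrArg Units.val this
    · intro x y h
      have h : x.1.1.1 = y.1.1.1 := congrArg Subtype.val h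
      exact Subtype.ext (Subtype.ext (Units.ext h))
    · intro s
      refine ⟨⟨⟨SpecialLinearGroup.toGL s, hG ⟨s, rfl⟩⟩, ?_⟩, rfl⟩
      rw [MonoidHom.mem_ker]
      exact Units.ext s.2

end Classes

end BostonShalev

namespace BostonShalev

open Polynomial Finset

section Roots

variable {F : Type*} [Field F] [Fintype F]

/-- `monics F n` as a `Finset`. -/
noncomputable def mon (F : Type*) [Field F] [Fintype F] (n : ℕ) : Finset F[X] :=
  (finite_monics F n).toFinset

/-- `monicsC F n δ` as a `Finset`. -/
noncomputable def monC (n : ℕ) (δ : F) : Finset F[X] := (finite_monicsC n δ).toFinset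

theorem mem_mon {n : ℕ} {f : F[X]} : f ∈ mon F n ↔ f ∈ monics F n := by simp [mon]

theorem mem_monC {n : ℕ} {δ : F} {f : F[X]} : f ∈ monC n δ ↔ f ∈ monics F n ∧ f.coeff 0 = δ := by
  simp [monC, monicsC]

theorem card_mon (n : ℕ) : (mon F n).card = Fintype.card F ^ n := by
  rw [mon, ← Set.ncard_eq_toFinset_card _ (finite_monics F n), ncard_monics]

theorem card_monC (n : ℕ) (δ : F) : (monC (n + 1) δ).card = Fintype.card F ^ n := by
  rw [monC, ← Set.ncard_eq_toFinset_card _ (finite_monicsC _ δ), ncard_monicsC]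

theorem exists_eq_mul_of_dvd {m n : ℕ} {f g : F[X]} (hf : f ∈ monics F (m + n))
    (hg : g ∈ monics F m) (h : g ∣ f) : ∃ k ∈ monics F n, f = g * k := by
  obtain ⟨k, rfl⟩ := h
  have hk : k.Monic := hg.1.of_mul_monic_left hf.1
  refine ⟨k, ⟨hk, ?_⟩, rfl⟩
  have := hf.2
  rw [hg.1.natDegree_mul hk, hg.2] at this
  omega

open scoped Classical in
theorem card_filter_dvd_le {m n : ℕ} {g : F[X]} (hg : g ∈ monics F m) :
    ((mon F (m + n)).filter (g ∣ ·)).card ≤ Fintype.card F ^ n := by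
  rw [← card_mon (F := F) n]
  refine (card_le_card (t := (mon F n).image (g * ·)) ?_).trans card_image_le
  intro f hf
  rw [mem_filter, mem_mon] at hf
  obtain ⟨k, hk, rfl⟩ := exists_eq_mul_of_dvd hf.1 hg hf.2
  exact mem_image_of_mem _ (mem_mon.2 hk)

open scoped Classical in
theorem card_filter_dvd_monC_le {m n : ℕ} {g : F[X]} {δ : F} (hδ : δ ≠ 0) (hg : g ∈ monics F m) :
    ((monC (m + (n + 1)) δ).filter (g ∣ ·)).card ≤
      if g.coeff 0 = 0 then 0 else Fintype.card F ^ n := by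
  split_ifs with h0
  · rw [Nat.le_zero, card_eq_zero, filter_eq_empty_iff]
    intro f hf ⟨k, hk⟩
    rw [mem_monC, hk, mul_coeff_zero, h0, zero_mul] at hf
    exact hδ hf.2.symm
  · rw [← card_monC n (δ / g.coeff 0)]
    refine (card_le_card (t := (monC (n + 1) (δ / g.coeff 0)).image (g * ·)) ?_).trans card_image_le
    intro f hf
    rw [mem_filter, mem_monC] at hf
    obtain ⟨k, hk, rfl⟩ := exists_eq_mul_of_dvd hf.1.1 hg hf.2
    refine mem_image_of_mem _ (mem_monC.2 ⟨hk, ?_⟩)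
    rw [← hf.1.2, mul_coeff_zero, mul_div_cancel_left₀ _ h0]

/-- The number of distinct roots in `F`. -/
noncomputable def numRoots (f : F[X]) : ℕ := {a | f.IsRoot a}.ncard

open scoped Classical in
theorem numRoots_eq (f : F[X]) : numRoots f = (univ.filter f.IsRoot).card := by
  rw [numRoots, Set.ncard_eq_toFinset_card']; simp

theorem numRoots_mul_le (f g : F[X]) : numRoots (f * g) ≤ numRoots f + numRoots g := by
  refine le_trans (Set.ncard_le_ncard ?_ (Set.toFinite _)) (Set.ncard_union_le _ _)
  intro a ha
  simpa [IsRoot, mul_eq_zero] using ha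

theorem numRoots_X_sub_C (a : F) : numRoots (X - C a) = 1 := by
  rw [numRoots, Set.ncard_eq_one]
  exact ⟨a, by ext b; simp [sub_eq_zero]⟩

open scoped Classical in
theorem sum_numRoots_le (n : ℕ) : ∑ f ∈ mon F n, numRoots f ≤ Fintype.card F ^ n := by
  have h : ∑ f ∈ mon F n, numRoots f = ∑ a : F, ((mon F n).filter fun f => f.IsRoot a).card := by
    simp_rw [numRoots_eq]
    exact sum_card_bipartiteAbove_eq_sum_card_bipartiteBelow (fun (f : F[X]) (a : F) => f.IsRoot a)
  rw [h]
  rcases n with _ | n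
  · refine le_trans (le_of_eq (sum_eq_zero fun a _ => ?_)) (Nat.zero_le _)
    rw [card_eq_zero, filter_eq_empty_iff]
    intro f hf
    rw [mem_mon] at hf
    rw [eq_one_of_monic_natDegree_zero hf.1 hf.2]
    simp
  · refine (sum_le_card_nsmul _ _ (Fintype.card F ^ n) fun a _ => ?_).trans
      (by rw [card_univ, smul_eq_mul, pow_succ, mul_comm])
    have := card_filter_dvd_le (n := n) (X_sub_C_mem a)
    simp only [dvd_iff_isRoot, add_comm 1 n] at this
    exact this

open scoped Classical in
theorem card_mon_coeff_ne_zero (n : ℕ) :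
    ((mon F (n + 1)).filter fun g => g.coeff 0 ≠ 0).card + Fintype.card F ^ n =
      Fintype.card F ^ (n + 1) := by
  rw [← card_mon (F := F) (n + 1), ← card_monC n (0 : F),
    ← card_filter_add_card_filter_not (s := mon F (n + 1)) (fun g => g.coeff 0 ≠ 0)]
  congr 2
  ext f; simp [mem_monC, mem_mon]

open scoped Classical in
theorem le_card_mon_coeff_ne_zero (n : ℕ) : Fintype.card F ^ n * (1 - 1 / (Fintype.card F : ℝ)) ≤
    ((mon F n).filter fun g => g.coeff 0 ≠ 0).card := by
  have hq : (0 : ℝ) < Fintype.card F := by exact_mod_cast Fintype.card_pos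
  rcases n with _ | n
  · have : 1 ≤ ((mon F 0).filter fun g => g.coeff 0 ≠ 0).card := by
      rw [Nat.one_le_iff_ne_zero, card_ne_zero]
      exact ⟨1, by simp [mem_mon, monics]⟩
    have h1 : (1 : ℝ) ≤ ((mon F 0).filter fun g => g.coeff 0 ≠ 0).card := by exact_mod_cast this
    have h2 : 0 ≤ 1 / (Fintype.card F : ℝ) := by positivity
    linarith
  · have h : (((mon F (n + 1)).filter fun g => g.coeff 0 ≠ 0).card : ℝ) + Fintype.card F ^ n =
      Fintype.card F ^ (n + 1) := by exact_mod_cast card_mon_coeff_ne_zero n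
    have e : (Fintype.card F : ℝ) ^ (n + 1) * (1 - 1 / (Fintype.card F : ℝ)) =
        Fintype.card F ^ (n + 1) - Fintype.card F ^ n := by field_simp; ring
    rw [e]; linarith

end Roots

section Divisors

variable {F : Type*} [Field F] [Fintype F] (k l : ℕ) (δ : F)

open scoped Classical in
/-- The number of monic divisors of degree `k`. -/
noncomputable def numDiv (k : ℕ) (f : F[X]) : ℕ := ((mon F k).filter (· ∣ f)).card

open scoped Classical in
theorem sum_numDiv_le (hδ : δ ≠ 0) : ∑ f ∈ monC (k + 1 + (l + 1)) δ, numDiv (k + 1) f ≤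
    Fintype.card F ^ l * ((mon F (k + 1)).filter fun g => g.coeff 0 ≠ 0).card := by
  unfold numDiv
  have h := sum_card_bipartiteAbove_eq_sum_card_bipartiteBelow
    (s := monC (k + 1 + (l + 1)) δ) (t := mon F (k + 1)) (fun f g => g ∣ f)
  simp only [bipartiteAbove, bipartiteBelow] at h
  rw [h]
  refine (sum_le_sum fun g hg => card_filter_dvd_monC_le hδ (mem_mon.1 hg)).trans ?_
  simp_rw [← ite_not (_ = (0 : F))]
  rw [← sum_filter, sum_const, smul_eq_mul, mul_comm]

open scoped Classical in
/-- Factorisations `(X - α) (X - β) g h` with `α ≠ β` of polynomials with constant term `δ`. -/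
noncomputable def splitData : Finset ((F[X] × F[X]) × (F × F)) :=
  ((mon F k ×ˢ mon F l) ×ˢ univ).filter fun s =>
    s.2.1 ≠ s.2.2 ∧ s.2.1 * s.2.2 * (s.1.1.coeff 0 * s.1.2.coeff 0) = δ

/-- The polynomial attached to an element of `splitData`. -/
noncomputable def splitPoly (s : (F[X] × F[X]) × (F × F)) : F[X] :=
  ((X - C s.2.1) * s.1.1) * ((X - C s.2.2) * s.1.2)

variable {k l δ}

theorem splitPoly_mem {s : (F[X] × F[X]) × (F × F)} (hs : s ∈ splitData k l δ) :
    splitPoly s ∈ monC (k + 1 + (l + 1)) δ := by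
  simp only [splitData, mem_filter, mem_product, mem_mon, mem_univ, and_true] at hs
  rw [mem_monC, add_comm k, add_comm l]
  refine ⟨monic_mul_mem (monic_mul_mem (X_sub_C_mem _) hs.1.1)
    (monic_mul_mem (X_sub_C_mem _) hs.1.2), ?_⟩
  rw [← hs.2.2]
  simp [splitPoly]; ring

open scoped Classical in
theorem card_splitData_fiber_le (hδ : δ ≠ 0) (p : F[X] × F[X]) :
    ((univ : Finset (F × F)).filter fun s =>
      s.1 ≠ s.2 ∧ s.1 * s.2 * (p.1.coeff 0 * p.2.coeff 0) = δ).card ≤ Fintype.card F := by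
  rw [← card_univ (α := F)]
  refine card_le_card_of_injOn Prod.fst (fun _ _ => mem_univ _) ?_
  rintro ⟨a, b⟩ h ⟨a', b'⟩ h' (rfl : a = a')
  simp only [coe_filter, mem_univ, true_and, Set.mem_ofPred_eq] at h h'
  have h1 : a * (p.1.coeff 0 * p.2.coeff 0) ≠ 0 := fun h0 =>
      hδ (by rw [← h.2]; linear_combination b * h0)
  have : a * (p.1.coeff 0 * p.2.coeff 0) * b = a * (p.1.coeff 0 * p.2.coeff 0) * b' := by
    linear_combination h.2 - h'.2
  rw [mul_left_cancel₀ h1 this]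

open scoped Classical in
theorem le_card_splitData_fiber (hδ : δ ≠ 0) (p : F[X] × F[X]) (h1 : p.1.coeff 0 ≠ 0)
    (h2 : p.2.coeff 0 ≠ 0) : Fintype.card F ≤ ((univ : Finset (F × F)).filter fun s =>
      s.1 ≠ s.2 ∧ s.1 * s.2 * (p.1.coeff 0 * p.2.coeff 0) = δ).card + 3 := by
  set e := δ / (p.1.coeff 0 * p.2.coeff 0) with he
  have he0 : e ≠ 0 := div_ne_zero hδ (mul_ne_zero h1 h2)
  have hbad : ((univ : Finset F).filter fun a => a = 0 ∨ a ^ 2 = e).card ≤ 3 := by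
    have : (univ : Finset F).filter (fun a => a = 0 ∨ a ^ 2 = e) ⊆
        insert 0 (nthRoots 2 e).toFinset := by
      intro a ha
      simpa [mem_nthRoots] using ha
    refine (card_le_card this).trans ((card_insert_le _ _).trans ?_)
    have := (Multiset.toFinset_card_le _).trans (card_nthRoots 2 e)
    omega
  rw [← card_univ (α := F), ← card_filter_add_card_filter_not (fun a => a = 0 ∨ a ^ 2 = e),
    add_comm]
  refine add_le_add ?_ hbad
  refine card_le_card_of_injOn (fun a => (a, e / a)) ?_ ?_
  · intro a ha
    simp only [coe_filter, mem_univ, true_and, Set.mem_ofPred_eq, not_or] at ha ⊢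
    refine ⟨fun h => ha.2 ?_, ?_⟩
    · rw [eq_div_iff ha.1] at h; rw [← h]; ring
    · rw [mul_div_cancel₀ _ ha.1, he, div_mul_cancel₀ _ (mul_ne_zero h1 h2)]
  · intro a _ b _ hab
    exact congrArg Prod.fst hab

open scoped Classical in
theorem card_splitData : (splitData k l δ).card = ∑ p ∈ mon F k ×ˢ mon F l,
    ((univ : Finset (F × F)).filter fun s =>
      s.1 ≠ s.2 ∧ s.1 * s.2 * (p.1.coeff 0 * p.2.coeff 0) = δ).card := by
  simp only [splitData, card_filter, sum_product]

open scoped Classical in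
theorem le_card_splitData (hδ : δ ≠ 0) (hq : 20 ≤ Fintype.card F) :
    3 / 4 * (Fintype.card F : ℝ) ^ (k + l + 1) ≤ (splitData k l δ).card := by
  obtain ⟨q, hqF⟩ : ∃ q : ℝ, (Fintype.card F : ℝ) = q := ⟨_, rfl⟩
  have hq' : (20 : ℝ) ≤ q := by rw [← hqF]; exact_mod_cast hq
  have h1 : (((mon F k).filter fun g => g.coeff 0 ≠ 0).card : ℝ) *
      ((mon F l).filter fun g => g.coeff 0 ≠ 0).card * (q - 3) ≤ (splitData k l δ).card := by
    have h2 : ∀ p ∈ (mon F k).filter (fun g => g.coeff 0 ≠ 0) ×ˢ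
        (mon F l).filter (fun g => g.coeff 0 ≠ 0), Fintype.card F - 3 ≤
        ((univ : Finset (F × F)).filter fun s =>
          s.1 ≠ s.2 ∧ s.1 * s.2 * (p.1.coeff 0 * p.2.coeff 0) = δ).card := by
      intro p hp
      simp only [mem_product, mem_filter] at hp
      have := le_card_splitData_fiber hδ p hp.1.2 hp.2.2
      omega
    have h3 : ((mon F k).filter fun g => g.coeff 0 ≠ 0).card *
        ((mon F l).filter fun g => g.coeff 0 ≠ 0).card * (Fintype.card F - 3) ≤
        (splitData k l δ).card := by
      rw [← card_product, card_splitData, ← smul_eq_mul]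
      refine (card_nsmul_le_sum _ _ _ h2).trans (sum_le_sum_of_subset ?_)
      exact product_subset_product (filter_subset _ _) (filter_subset _ _)
    have h4 : (q - 3 : ℝ) = ((Fintype.card F - 3 : ℕ) : ℝ) := by
      rw [Nat.cast_sub (by omega), hqF]; norm_num
    rw [h4]
    exact_mod_cast h3
  refine le_trans ?_ h1
  rw [hqF]
  have e : (19 / 20 : ℝ) ≤ 1 - 1 / q := by
    have : 1 / q ≤ 1 / 20 := one_div_le_one_div_of_le (by norm_num) hq'
    linarith
  have a1 := le_card_mon_coeff_ne_zero (F := F) k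
  have a2 := le_card_mon_coeff_ne_zero (F := F) l
  rw [hqF] at a1 a2
  have b1 : q ^ k * (19 / 20) ≤ ((mon F k).filter fun g => g.coeff 0 ≠ 0).card :=
    le_trans (by gcongr) a1
  have b2 : q ^ l * (19 / 20) ≤ ((mon F l).filter fun g => g.coeff 0 ≠ 0).card :=
    le_trans (by gcongr) a2
  calc 3 / 4 * q ^ (k + l + 1) ≤ (q ^ k * (19 / 20)) * (q ^ l * (19 / 20)) * (17 / 20 * q) := by
        have : 0 < q ^ (k + l + 1) := by positivity
        rw [show (q ^ k * (19 / 20)) * (q ^ l * (19 / 20)) * (17 / 20 * q) =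
          (19 / 20 * (19 / 20) * (17 / 20)) * q ^ (k + l + 1) by ring]
        nlinarith
    _ ≤ _ := by gcongr; linarith

open scoped Classical in
theorem sum_splitData_numRoots_le (hδ : δ ≠ 0) :
    ∑ s ∈ splitData k l δ, numRoots (splitPoly s) ≤ 4 * Fintype.card F ^ (k + l + 1) := by
  have h1 : ∀ s ∈ splitData k l δ, numRoots (splitPoly s) ≤
      2 + numRoots s.1.1 + numRoots s.1.2 := by
    intro s _
    refine (numRoots_mul_le _ _).trans ((add_le_add (numRoots_mul_le _ _)
      (numRoots_mul_le _ _)).trans ?_)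
    rw [numRoots_X_sub_C, numRoots_X_sub_C]; omega
  refine (sum_le_sum h1).trans ?_
  have h2 : ∑ s ∈ splitData k l δ, (2 + numRoots s.1.1 + numRoots s.1.2) =
      ∑ p ∈ mon F k ×ˢ mon F l, ((univ : Finset (F × F)).filter fun s =>
      s.1 ≠ s.2 ∧ s.1 * s.2 * (p.1.coeff 0 * p.2.coeff 0) = δ).card *
        (2 + numRoots p.1 + numRoots p.2) := by
    simp only [splitData, sum_filter, sum_product, card_filter, sum_mul, ite_mul, one_mul, zero_mul]
  rw [h2]
  refine (sum_le_sum fun p _ => Nat.mul_le_mul_right _ (card_splitData_fiber_le hδ p)).trans ?_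
  rw [← mul_sum, sum_product]
  simp only [sum_add_distrib, sum_const, smul_eq_mul, card_mon, ← mul_sum]
  have a1 := Nat.mul_le_mul_left (Fintype.card F ^ k) (sum_numRoots_le (F := F) l)
  have a2 := Nat.mul_le_mul_left (Fintype.card F ^ l) (sum_numRoots_le (F := F) k)
  calc _ ≤ Fintype.card F * (Fintype.card F ^ k * (Fintype.card F ^ l * 2) +
      Fintype.card F ^ l * Fintype.card F ^ k + Fintype.card F ^ k * Fintype.card F ^ l) := by gcongr
    _ = _ := by ring

open scoped Classical in
theorem card_splitData_fiber_poly_le {f : F[X]} (hf : f ∈ monC (k + 1 + (l + 1)) δ) :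
    ((splitData k l δ).filter (splitPoly · = f)).card ≤ numRoots f ^ 2 * numDiv (k + 1) f := by
  rw [numRoots_eq, sq, numDiv, ← card_product, ← card_product]
  refine card_le_card_of_injOn (fun s => ((s.2.1, s.2.2), (X - C s.2.1) * s.1.1)) ?_ ?_
  · rintro ⟨⟨g, h⟩, a, b⟩ hs
    rw [coe_filter, Set.mem_ofPred_eq] at hs
    obtain ⟨hs, rfl⟩ := hs
    simp only [splitData, mem_filter, mem_product, mem_mon, mem_univ, and_true] at hs
    refine mem_coe.2 (mem_product.2 ⟨mem_product.2 ⟨?_, ?_⟩, ?_⟩)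
    · rw [mem_filter]; exact ⟨mem_univ _, by simp [splitPoly]⟩
    · rw [mem_filter]; exact ⟨mem_univ _, by simp [splitPoly]⟩
    · rw [mem_filter, mem_mon, add_comm k]
      exact ⟨monic_mul_mem (X_sub_C_mem a) hs.1.1, dvd_mul_right _ _⟩
  · rintro ⟨⟨g, h⟩, a, b⟩ hs ⟨⟨g', h'⟩, a', b'⟩ hs' heq
    simp only [Prod.mk.injEq] at heq
    obtain ⟨⟨rfl, rfl⟩, h3⟩ := heq
    have hg := mul_left_cancel₀ (X_sub_C_ne_zero a) h3
    subst hg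
    rw [coe_filter, Set.mem_ofPred_eq] at hs hs'
    have e := hs.2.trans hs'.2.symm
    have hm := mem_product.1 (mem_product.1 (mem_filter.1 hs.1).1).1
    rw [mem_mon, mem_mon] at hm
    have e2 := mul_left_cancel₀ (mul_ne_zero (X_sub_C_ne_zero a) hm.1.1.ne_zero) e
    have e3 := mul_left_cancel₀ (X_sub_C_ne_zero b) e2
    subst e3
    rfl

open scoped Classical in
theorem two_le_numDiv {s : (F[X] × F[X]) × (F × F)} (hs : s ∈ splitData k l δ) :
    2 ≤ numDiv (k + 1) (splitPoly s) := by
  obtain ⟨⟨g, h⟩, a, b⟩ := s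
  simp only [splitData, mem_filter, mem_product, mem_mon, mem_univ, and_true] at hs
  have hne : (X - C a) * g ≠ (X - C b) * g := fun h => by
    have := mul_right_cancel₀ hs.1.1.1.ne_zero h
    exact hs.2.1 (by simpa using this)
  rw [← card_pair hne]
  refine card_le_card ?_
  intro f hf
  rw [mem_insert, mem_singleton] at hf
  rw [mem_filter, mem_mon, add_comm k]
  rcases hf with rfl | rfl
  · exact ⟨monic_mul_mem (X_sub_C_mem _) hs.1.1, dvd_mul_right _ _⟩
  · exact ⟨monic_mul_mem (X_sub_C_mem _) hs.1.1, (X - C a) * h, by simp only [splitPoly]; ring⟩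

open scoped Classical in
theorem sum_numDiv_real_le (hδ : δ ≠ 0) :
    ((∑ f ∈ monC (k + 1 + (l + 1)) δ, numDiv (k + 1) f : ℕ) : ℝ) ≤
    (1 - 1 / Fintype.card F) * (Fintype.card F : ℝ) ^ (k + l + 1) := by
  have hq : (0 : ℝ) < Fintype.card F := by exact_mod_cast Fintype.card_pos
  have h : ((∑ f ∈ monC (k + 1 + (l + 1)) δ, numDiv (k + 1) f : ℕ) : ℝ) ≤
    (Fintype.card F : ℝ) ^ l * ((mon F (k + 1)).filter fun g => g.coeff 0 ≠ 0).card := by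
    exact_mod_cast sum_numDiv_le k l δ hδ
  have e : (((mon F (k + 1)).filter fun g => g.coeff 0 ≠ 0).card : ℝ) =
    (Fintype.card F : ℝ) ^ (k + 1) - (Fintype.card F : ℝ) ^ k := by
    rw [eq_sub_iff_add_eq]; exact_mod_cast card_mon_coeff_ne_zero k
  refine h.trans (le_of_eq ?_)
  rw [e]; field_simp; ring

open scoped Classical in
theorem card_dvd_le_sum :
    ((monC (k + 1 + (l + 1)) δ).filter fun f => ∃ g ∈ monics F (k + 1), g ∣ f).card ≤
      ∑ f ∈ monC (k + 1 + (l + 1)) δ, numDiv (k + 1) f := by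
  rw [card_filter]
  refine sum_le_sum fun f _ => ?_
  split_ifs with h
  · obtain ⟨g, hg, hgf⟩ := h
    exact card_pos.2 ⟨g, mem_filter.2 ⟨mem_mon.2 hg, hgf⟩⟩
  · exact Nat.zero_le _

open scoped Classical in
theorem card_dvd_monC_le_of_large (hδ : δ ≠ 0) (hq : 20 ≤ Fintype.card F) :
    (((monC (k + 1 + (l + 1)) δ).filter fun f => ∃ g ∈ monics F (k + 1), g ∣ f).card : ℝ) ≤
      (1 - 1 / 512) * (Fintype.card F : ℝ) ^ (k + l + 1) := by
  have h1 := le_card_splitData (k := k) (l := l) hδ hq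
  have h7 := sum_numDiv_real_le (k := k) (l := l) hδ
  have h2 : ((∑ s ∈ splitData k l δ, numRoots (splitPoly s) : ℕ) : ℝ) ≤
      4 * (Fintype.card F : ℝ) ^ (k + l + 1) := by
    exact_mod_cast sum_splitData_numRoots_le (k := k) (l := l) hδ
  obtain ⟨Q, hQ⟩ : ∃ Q : ℝ, (Fintype.card F : ℝ) ^ (k + l + 1) = Q := ⟨_, rfl⟩
  have hQ0 : 0 ≤ Q := by rw [← hQ]; positivity
  rw [hQ] at h1 h2 h7 ⊢
  set E := (monC (k + 1 + (l + 1)) δ).filter fun f => 2 ≤ numDiv (k + 1) f with hE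
  have h3 : 9 * (((splitData k l δ).filter fun s => ¬ numRoots (splitPoly s) ≤ 8).card : ℝ) ≤
      4 * Q := by
    refine le_trans ?_ h2
    have : ((splitData k l δ).filter fun s => ¬ numRoots (splitPoly s) ≤ 8).card * 9 ≤
        ∑ s ∈ splitData k l δ, numRoots (splitPoly s) := by
      rw [← smul_eq_mul]
      refine (card_nsmul_le_sum _ (fun s => numRoots (splitPoly s)) _ ?_).trans
        (sum_le_sum_of_subset (filter_subset _ _))
      intro s hs
      rw [mem_filter] at hs
      omega
    rw [mul_comm]; exact_mod_cast this
  have h4 : (((splitData k l δ).filter fun s => numRoots (splitPoly s) ≤ 8).card : ℝ) +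
      ((splitData k l δ).filter fun s => ¬ numRoots (splitPoly s) ≤ 8).card =
      (splitData k l δ).card := by
    exact_mod_cast card_filter_add_card_filter_not _
  have h5 : ((splitData k l δ).filter fun s => numRoots (splitPoly s) ≤ 8).card ≤
      ∑ f ∈ E, 64 * numDiv (k + 1) f := by
    rw [card_eq_sum_card_fiberwise (f := splitPoly) (t := E)]
    · refine sum_le_sum fun f hf => ?_
      rw [filter_filter]
      by_cases h8 : numRoots f ≤ 8
      · refine (card_le_card (t := (splitData k l δ).filter (splitPoly · = f)) ?_).trans
          ((card_splitData_fiber_poly_le (mem_filter.1 hf).1).trans ?_)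
        · intro s hs
          rw [mem_filter] at hs ⊢
          exact ⟨hs.1, hs.2.2⟩
        · refine Nat.mul_le_mul_right _ ?_
          nlinarith
      · rw [card_eq_zero.2]
        · exact Nat.zero_le _
        · rw [filter_eq_empty_iff]
          rintro s _ ⟨h, rfl⟩
          exact h8 h
    · intro s hs
      have hs := (mem_filter.1 (mem_coe.1 hs)).1
      exact mem_coe.2 (mem_filter.2 ⟨splitPoly_mem hs, two_le_numDiv hs⟩)
  rw [← mul_sum] at h5
  have h5' : (((splitData k l δ).filter fun s => numRoots (splitPoly s) ≤ 8).card : ℝ) ≤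
      64 * ((∑ f ∈ E, numDiv (k + 1) f : ℕ) : ℝ) := by exact_mod_cast h5
  have h6 : 2 * ((monC (k + 1 + (l + 1)) δ).filter fun f => ∃ g ∈ monics F (k + 1), g ∣ f).card +
      ∑ f ∈ E, numDiv (k + 1) f ≤ 2 * ∑ f ∈ monC (k + 1 + (l + 1)) δ, numDiv (k + 1) f := by
    rw [card_filter, hE, sum_filter, mul_sum, mul_sum, ← sum_add_distrib]
    refine sum_le_sum fun f _ => ?_
    have : (if ∃ g ∈ monics F (k + 1), g ∣ f then 1 else 0) ≤ numDiv (k + 1) f := by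
      split_ifs with h
      · obtain ⟨g, hg, hgf⟩ := h
        exact card_pos.2 ⟨g, mem_filter.2 ⟨mem_mon.2 hg, hgf⟩⟩
      · exact Nat.zero_le _
    have h1 : (if ∃ g ∈ monics F (k + 1), g ∣ f then 1 else 0) ≤ 1 := by split_ifs <;> simp
    split_ifs at * <;> omega
  have h6' : 2 * (((monC (k + 1 + (l + 1)) δ).filter fun f =>
      ∃ g ∈ monics F (k + 1), g ∣ f).card : ℝ) + ((∑ f ∈ E, numDiv (k + 1) f : ℕ) : ℝ) ≤
      2 * ((∑ f ∈ monC (k + 1 + (l + 1)) δ, numDiv (k + 1) f : ℕ) : ℝ) := by exact_mod_cast h6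
  have h8 : (1 - 1 / (Fintype.card F : ℝ)) * Q ≤ Q := by
    have : 0 ≤ 1 / (Fintype.card F : ℝ) := by positivity
    nlinarith
  linarith

open scoped Classical in
/-- A positive proportion of the monic polynomials of given degree and given nonzero constant term
have no divisor of a given intermediate degree. -/
theorem card_dvd_monC_le (hδ : δ ≠ 0) :
    (((monC (k + 1 + (l + 1)) δ).filter fun f => ∃ g ∈ monics F (k + 1), g ∣ f).card : ℝ) ≤
      (1 - 1 / 512) * (Fintype.card F : ℝ) ^ (k + l + 1) := by
  rcases le_or_gt 20 (Fintype.card F) with hq | hq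
  · exact card_dvd_monC_le_of_large hδ hq
  · have h1 : (((monC (k + 1 + (l + 1)) δ).filter fun f =>
        ∃ g ∈ monics F (k + 1), g ∣ f).card : ℝ) ≤
        ((∑ f ∈ monC (k + 1 + (l + 1)) δ, numDiv (k + 1) f : ℕ) : ℝ) := by
      exact_mod_cast card_dvd_le_sum (F := F) (k := k) (l := l) (δ := δ)
    refine h1.trans ((sum_numDiv_real_le hδ).trans ?_)
    have hq' : (Fintype.card F : ℝ) ≤ 20 := by exact_mod_cast hq.le
    have hq0 : (0 : ℝ) < Fintype.card F := by exact_mod_cast Fintype.card_pos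
    have : (1 : ℝ) / 20 ≤ 1 / Fintype.card F := one_div_le_one_div_of_le hq0 hq'
    gcongr
    linarith

end Divisors

end BostonShalev

namespace BostonShalev

open Polynomial Matrix

section CharpolyDvd

variable {ι κ F : Type*} [Fintype ι] [Fintype κ] [DecidableEq ι] [DecidableEq κ] [Field F]

/-- The characteristic polynomial of the restriction to an invariant subspace divides. -/
theorem charpoly_dvd_of_mul_eq {g : Matrix ι ι F} {J : Matrix ι κ F} {L : Matrix κ ι F}
    {β : Matrix κ κ F} (hL : L * J = 1) (hg : g * J = J * β) : β.charpoly ∣ g.charpoly := by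
  set J' : Matrix ι κ F[X] := J.map C
  set L' : Matrix κ ι F[X] := L.map C
  have hL' : L' * J' = 1 := by
    rw [← Matrix.map_mul, hL]; exact Matrix.map_one _ (map_zero _) (map_one _)
  have hg' : g.charmatrix * J' = J' * β.charmatrix := by
    simp only [charmatrix, Matrix.sub_mul, Matrix.mul_sub, RingHom.mapMatrix_apply, J',
      ← Matrix.map_mul, hg]
    congr 1
    simp [scalar_apply, ← smul_one_eq_diagonal]
  have key : g.charmatrix = (J' * L' + g.charmatrix * (1 - J' * L')) *
      (1 + J' * ((β.charmatrix - 1) * L')) := by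
    have h1 : J' * L' * J' = J' := by rw [Matrix.mul_assoc, hL', Matrix.mul_one]
    have h2 : (J' * L' + g.charmatrix * (1 - J' * L')) * J' = J' := by
      rw [Matrix.add_mul, h1, Matrix.mul_assoc, Matrix.sub_mul, h1]; simp
    have h3 : g.charmatrix * (J' * L') = J' * (β.charmatrix * L') := by
      rw [← Matrix.mul_assoc, hg', Matrix.mul_assoc]
    rw [Matrix.mul_add, ← Matrix.mul_assoc _ J', h2, Matrix.mul_one, Matrix.mul_sub,
      Matrix.mul_one, h3, Matrix.sub_mul, Matrix.mul_sub, Matrix.one_mul]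
    abel
  rw [charpoly, charpoly]
  conv_rhs => rw [key]
  rw [det_mul, det_one_add_mul_comm, Matrix.mul_assoc, hL']
  simp

end CharpolyDvd

section Reducible

variable {F : Type*} [Field F] [Fintype F] {n : ℕ} {G H : Subgroup (GL (Fin n) F)}

theorem ncard_classPolys_dvd_le {k : ℕ} (hk : 0 < k) (hkn : k < n) :
    ({f | f ∈ classPolys G ∧ ∃ g ∈ monics F k, g ∣ f}.ncard : ℝ) ≤
      (1 - 1 / 512) * (classPolys G).ncard := by
  classical
  obtain ⟨k, rfl⟩ : ∃ k', k = k' + 1 := ⟨k - 1, by omega⟩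
  obtain ⟨l, rfl⟩ : ∃ l, n = k + 1 + (l + 1) := ⟨n - k - 2, by omega⟩
  have hfin : {f | f ∈ classPolys G ∧ ∃ g ∈ monics F (k + 1), g ∣ f}.Finite :=
    (finite_classPolys G).subset fun _ h => h.1
  have hc : (constants G).Finite := Set.toFinite _
  have e := ncard_classPolys (n := k + 1 + l) (F := F) G
  rw [e, Set.ncard_eq_toFinset_card _ hfin, Set.ncard_eq_toFinset_card _ hc,
    Finset.card_eq_sum_card_fiberwise (f := fun f => f.coeff 0) (t := hc.toFinset)]
  · rw [Nat.cast_sum, Nat.cast_mul, mul_left_comm, ← nsmul_eq_mul]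
    refine Finset.sum_le_card_nsmul _ _ _ fun δ hδ => ?_
    rw [Set.Finite.mem_toFinset] at hδ
    have := card_dvd_monC_le (k := k) (l := l) (constants_ne_zero hδ)
    rw [Nat.cast_pow, show k + 1 + l = k + l + 1 by ring]
    refine le_trans (Nat.cast_le.2 (Finset.card_le_card ?_)) this
    intro f hf
    simp only [Finset.mem_filter, Set.Finite.mem_toFinset, Set.mem_ofPred_eq] at hf
    rw [Finset.mem_filter, mem_monC]
    exact ⟨⟨hf.1.1.1, hf.2⟩, hf.1.2⟩
  · intro f hf
    have hf : f ∈ {f | f ∈ classPolys G ∧ ∃ g ∈ monics F (k + 1), g ∣ f} := by simpa using hf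
    simpa using hf.1.2

/-- If, up to few exceptions, the characteristic polynomials of elements of `H` have a divisor of
degree `k`, then many classes miss `H`. -/
theorem ncard_classPolys_le_missed_add (hG : ContainsSL G) {k : ℕ} (hk : 0 < k) (hkn : k < n)
    {E : Set F[X]} (hE : E.Finite)
    (h : ∀ x ∈ H, (∃ g ∈ monics F k, g ∣ x.1.charpoly) ∨ x.1.charpoly ∈ E) :
    ((classPolys G).ncard : ℝ) ≤ 512 * (missed G H + E.ncard) := by
  set D := {f | f ∈ classPolys G ∧ ∃ g ∈ monics F k, g ∣ f}
  have h1 := ncard_classPolys_dvd_le (G := G) hk hkn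
  have h2 : (classPolys G \ (D ∪ E)).ncard ≤ missed G H := by
    refine ncard_le_missed hG Set.sdiff_subset fun x hx hxS => hxS.2 ?_
    exact (h x hx).imp (fun h => ⟨hxS.1, h⟩) id
  have h3 : (classPolys G).ncard ≤ (classPolys G \ (D ∪ E)).ncard + (D ∪ E).ncard := by
    refine Set.ncard_le_ncard_sdiff_add_ncard _ _ ?_
    exact ((finite_classPolys G).subset fun _ h => h.1).union hE
  have h4 := Set.ncard_union_le D E
  have h5 : ((classPolys G).ncard : ℝ) ≤ missed G H + (D.ncard + E.ncard) := by
    exact_mod_cast h3.trans (add_le_add h2 h4)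
  change (D.ncard : ℝ) ≤ _ at h1
  have : (0 : ℝ) ≤ E.ncard := by positivity
  linarith

end Reducible

end BostonShalev

open Matrix Polynomial
namespace BostonShalev

theorem det_pi_dep {F : Type*} [Field F] {k : ℕ} {M : Fin k → Type*} [∀ i, AddCommGroup (M i)]
    [∀ i, Module F (M i)] [∀ i, Module.Finite F (M i)] (f : ∀ i, M i →ₗ[F] M i) :
    LinearMap.det (LinearMap.pi fun i => (f i).comp (LinearMap.proj i)) =
      ∏ i, LinearMap.det (f i) := by
  classical
  let b := fun i => Module.finBasis F (M i)
  have hA : ∀ x y, LinearMap.toMatrix (Pi.basis b) (Pi.basis b)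
      (LinearMap.pi fun i => (f i).comp (LinearMap.proj i)) x y =
      if h : y.1 = x.1 then LinearMap.toMatrix (b x.1) (b x.1) (f x.1) x.2 (h ▸ y.2) else 0 := by
    rintro ⟨i, a⟩ ⟨j, c⟩
    rw [LinearMap.toMatrix_apply, Pi.basis_repr]
    simp only [LinearMap.pi_apply, LinearMap.comp_apply, LinearMap.proj_apply, Pi.basis_apply]
    split_ifs with h
    · subst h; simp [LinearMap.toMatrix_apply]
    · rw [Pi.single_eq_of_ne (Ne.symm h)]; simp
  rw [← LinearMap.det_toMatrix (Pi.basis b), BlockTriangular.det_fintype (b := Sigma.fst)]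
  · refine Finset.prod_congr rfl fun i _ => ?_
    rw [← LinearMap.det_toMatrix (b i)]
    let e : Fin (Module.finrank F (M i)) ≃ {x : Σ j, Fin (Module.finrank F (M j)) // x.1 = i} :=
      { toFun := fun a => ⟨⟨i, a⟩, rfl⟩
        invFun := fun x => x.2 ▸ x.1.2
        left_inv := fun a => rfl
        right_inv := by rintro ⟨⟨j, a⟩, rfl⟩; rfl }
    rw [← Matrix.det_submatrix_equiv_self e]
    congr 1
    ext a c
    rw [submatrix_apply, toSquareBlock_def, of_apply, hA]
    simp [e]
  · rintro ⟨i, a⟩ ⟨j, c⟩ hij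
    rw [hA, dif_neg (ne_of_lt hij)]

theorem exists_decomp_poly {F V : Type*} [Field F] [AddCommGroup V] [Module F V]
    [Module.Finite F V] (T : V →ₗ[F] V) :
    ∃ (k : ℕ) (φ : Fin k → F[X] × ℕ), (∀ i, (φ i).1.Monic ∧ Irreducible (φ i).1 ∧ (φ i).2 ≠ 0) ∧
      Nonempty (Module.AEval' T ≃ₗ[F[X]]
        ∀ i, F[X] ⧸ Submodule.span F[X] {(φ i).1 ^ (φ i).2}) := by
  classical
  obtain ⟨ι, _, p, hp, e, ⟨E⟩⟩ := Module.equiv_directSum_of_isTorsion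
    (Module.AEval.isTorsion_of_finiteDimensional F V T)
  let E1 := E.trans (DirectSum.linearEquivFunOnFintype F[X] ι
    (fun i => F[X] ⧸ Submodule.span F[X] {p i ^ e i}))
  let r : (∀ i, F[X] ⧸ Submodule.span F[X] {p i ^ e i}) →ₗ[F[X]]
      ∀ i : {i // e i ≠ 0}, F[X] ⧸ Submodule.span F[X] {p i.1 ^ e i.1} :=
    LinearMap.pi fun i => LinearMap.proj i.1
  have hr : Function.Bijective r := by
    constructor
    · intro x y hxy
      funext i
      by_cases h : e i = 0
      · have : Subsingleton (F[X] ⧸ Submodule.span F[X] {p i ^ e i}) := by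
          rw [Submodule.Quotient.subsingleton_iff, h, pow_zero]
          exact Ideal.span_singleton_one
        exact Subsingleton.elim _ _
      · exact congrFun hxy ⟨i, h⟩
    · intro y
      refine ⟨fun i => if h : e i = 0 then 0 else y ⟨i, h⟩, ?_⟩
      funext i
      simp [r, i.2]
  let E2 := E1.trans (LinearEquiv.ofBijective r hr)
  let c := (Fintype.equivFin {i // e i ≠ 0}).symm
  let E3 := E2.trans (LinearEquiv.piCongrLeft F[X]
    (fun i : {i // e i ≠ 0} => F[X] ⧸ Submodule.span F[X] {p i.1 ^ e i.1}) c).symm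
  refine ⟨_, fun i => (normalize (p (c i)), e (c i)), fun i => ⟨?_, ?_, (c i).2⟩, ⟨E3.trans
    (LinearEquiv.piCongrRight fun i => Submodule.quotEquivOfEq _ _ ?_)⟩⟩
  · exact monic_normalize (hp _).ne_zero
  · exact (normalize_associated _).irreducible_iff.2 (hp _)
  · change Ideal.span _ = Ideal.span _
    rw [Ideal.span_singleton_eq_span_singleton]
    exact (associated_normalize _).pow_pow

theorem exists_decomp {F V : Type*} [Field F] [AddCommGroup V] [Module F V]
    [Module.Finite F V] (T : V →ₗ[F] V) :
    ∃ (k : ℕ) (φ : Fin k → F[X] × ℕ), (∀ i, (φ i).1.Monic ∧ Irreducible (φ i).1 ∧ (φ i).2 ≠ 0) ∧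
      ∃ Ψ : V ≃ₗ[F] ∀ i, AdjoinRoot ((φ i).1 ^ (φ i).2),
        ∀ v i, Ψ (T v) i = AdjoinRoot.root _ * Ψ v i := by
  obtain ⟨k, φ, hφ, ⟨E⟩⟩ := exists_decomp_poly T
  have key : ∀ (f : F[X]) (v : Module.AEval' T) i, (show AdjoinRoot ((φ i).1 ^ (φ i).2) from E (f • v) i) =
      AdjoinRoot.mk _ f * (show AdjoinRoot ((φ i).1 ^ (φ i).2) from E v i) := by
    intro f v i
    rw [map_smul, Pi.smul_apply]
    obtain ⟨y, hy⟩ := Submodule.mkQ_surjective _ (E v i)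
    rw [← hy]
    rfl
  refine ⟨k, φ, hφ, ⟨⟨⟨fun v i => E (Module.AEval'.of T v) i, fun v w => ?_⟩, fun c v => ?_⟩,
    fun x => (Module.AEval'.of T).symm (E.symm fun i => x i), fun v => ?_, fun x => ?_⟩,
    fun v i => ?_⟩
  · rw [map_add, map_add]; rfl
  · funext i
    have := key (C c) (Module.AEval'.of T v) i
    rw [Module.AEval.C_smul, ← map_smul] at this
    rw [RingHom.id_apply, Pi.smul_apply, Algebra.smul_def]
    exact this
  · simp
  · funext i
    exact congrFun (E.apply_symm_apply fun i => x i) i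
  · have := key X (Module.AEval'.of T v) i
    rw [Module.AEval'.X_smul_of] at this
    exact this

/-- `φ` lists the monic elementary divisors (base and exponent) of `g`. -/
def IsDecomp {F : Type*} [Field F] {n k : ℕ} (g : Matrix (Fin n) (Fin n) F)
    (φ : Fin k → F[X] × ℕ) : Prop :=
  (∀ i, (φ i).1.Monic ∧ Irreducible (φ i).1 ∧ (φ i).2 ≠ 0) ∧
    ∃ Ψ : (Fin n → F) ≃ₗ[F] ∀ i, AdjoinRoot ((φ i).1 ^ (φ i).2),
      ∀ v i, Ψ (g *ᵥ v) i = AdjoinRoot.root _ * Ψ v i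

/-- The product of the irreducible polynomials occurring with exponent `e`. -/
noncomputable def expPart {F : Type*} [Field F] {k : ℕ} (φ : Fin k → F[X] × ℕ) (e : ℕ) : F[X] :=
  ∏ i with (φ i).2 = e, (φ i).1

section
variable {F : Type*} [Field F] {n k k' : ℕ}

theorem exists_isDecomp (g : Matrix (Fin n) (Fin n) F) :
    ∃ (k : ℕ) (φ : Fin k → F[X] × ℕ), IsDecomp g φ := by
  obtain ⟨k, φ, hφ, Ψ, hΨ⟩ := exists_decomp (Matrix.mulVecLin g)
  exact ⟨k, φ, hφ, Ψ, hΨ⟩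

theorem expPart_monic {φ : Fin k → F[X] × ℕ} (h : ∀ i, (φ i).1.Monic) (e : ℕ) :
    (expPart φ e).Monic :=
  monic_prod_of_monic _ _ fun i _ => h i

theorem normalizedFactors_expPart [DecidableEq F] {φ : Fin k → F[X] × ℕ}
    (h : ∀ i, (φ i).1.Monic ∧ Irreducible (φ i).1 ∧ (φ i).2 ≠ 0) (e : ℕ) :
    UniqueFactorizationMonoid.normalizedFactors (expPart φ e) =
      (Finset.univ.filter fun i => (φ i).2 = e).val.map fun i => (φ i).1 := by
  rw [expPart, Finset.prod, UniqueFactorizationMonoid.normalizedFactors_prod_eq]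
  · rw [Multiset.map_map]
    exact Multiset.map_congr rfl fun i _ => (h i).1.normalize_eq_self
  · intro a ha
    obtain ⟨i, _, rfl⟩ := Multiset.mem_map.1 ha
    exact (h i).2.1

theorem card_fiber_eq_count [DecidableEq F] {φ : Fin k → F[X] × ℕ}
    (h : ∀ i, (φ i).1.Monic ∧ Irreducible (φ i).1 ∧ (φ i).2 ≠ 0) (p : F[X]) (e : ℕ) :
    Fintype.card {i // φ i = (p, e)} =
      (UniqueFactorizationMonoid.normalizedFactors (expPart φ e)).count p := by
  rw [normalizedFactors_expPart h, Multiset.count_map, Fintype.card_subtype,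
    ← Finset.filter_val, Finset.filter_filter]
  change _ = Finset.card _
  congr 1
  ext i
  simp [Prod.ext_iff, and_comm, eq_comm]

theorem exists_equiv_of_expPart_eq {φ : Fin k → F[X] × ℕ} {ψ : Fin k' → F[X] × ℕ}
    (hφ : ∀ i, (φ i).1.Monic ∧ Irreducible (φ i).1 ∧ (φ i).2 ≠ 0)
    (hψ : ∀ i, (ψ i).1.Monic ∧ Irreducible (ψ i).1 ∧ (ψ i).2 ≠ 0)
    (h : ∀ e, expPart φ e = expPart ψ e) : ∃ σ : Fin k ≃ Fin k', φ = ψ ∘ σ := by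
  classical
  have hc : ∀ x : F[X] × ℕ, Nonempty ({i // φ i = x} ≃ {i // ψ i = x}) := by
    rintro ⟨p, e⟩
    rw [← Fintype.card_eq, card_fiber_eq_count hφ, card_fiber_eq_count hψ, h]
  have c := fun x => (hc x).some
  refine ⟨(Equiv.sigmaFiberEquiv φ).symm.trans ((Equiv.sigmaCongrRight fun x => c x).trans
    (Equiv.sigmaFiberEquiv ψ)), ?_⟩
  funext i
  exact ((c (φ i)) ⟨i, rfl⟩).2.symm

/-- The invertible matrix of a linear automorphism of `F ^ n`. -/
noncomputable def glOfEquiv (L : (Fin n → F) ≃ₗ[F] (Fin n → F)) : GL (Fin n) F where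
  val := LinearMap.toMatrix' L
  inv := LinearMap.toMatrix' L.symm
  val_inv := by rw [← LinearMap.toMatrix'_comp]; simp
  inv_val := by rw [← LinearMap.toMatrix'_comp]; simp

theorem glOfEquiv_mulVec (L : (Fin n → F) ≃ₗ[F] (Fin n → F)) (v : Fin n → F) :
    (glOfEquiv L).1 *ᵥ v = L v := by
  rw [glOfEquiv, LinearMap.toMatrix'_mulVec]; rfl

theorem IsDecomp.exists_conj {g h : Matrix (Fin n) (Fin n) F} {φ : Fin k → F[X] × ℕ}
    {ψ : Fin k' → F[X] × ℕ} (hg : IsDecomp g φ) (hh : IsDecomp h ψ)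
    (H : ∀ e, expPart φ e = expPart ψ e) : ∃ x : GL (Fin n) F, x.1 * g = h * x.1 := by
  obtain ⟨σ, rfl⟩ := exists_equiv_of_expPart_eq hg.1 hh.1 H
  obtain ⟨_, Ψ, hΨ⟩ := hg
  obtain ⟨_, Θ, hΘ⟩ := hh
  let P := LinearEquiv.piCongrLeft F (fun i => AdjoinRoot ((ψ i).1 ^ (ψ i).2)) σ
  refine ⟨glOfEquiv (Ψ.trans (P.trans Θ.symm)), Matrix.ext_of_mulVec_single fun j => ?_⟩
  rw [← mulVec_mulVec, ← mulVec_mulVec, glOfEquiv_mulVec, glOfEquiv_mulVec]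
  apply Θ.injective
  funext i
  rw [hΘ]
  obtain ⟨i, rfl⟩ := σ.surjective i
  simp only [LinearEquiv.trans_apply, LinearEquiv.apply_symm_apply]
  have key : ∀ f, P f (σ i) = f i := fun f =>
    Equiv.piCongrLeft_apply_apply (fun i => AdjoinRoot ((ψ i).1 ^ (ψ i).2)) σ f i
  rw [key, key, hΨ]
  rfl

theorem IsDecomp.sum_eq {g : Matrix (Fin n) (Fin n) F} {φ : Fin k → F[X] × ℕ} (hg : IsDecomp g φ) :
    ∑ i, (φ i).2 * (φ i).1.natDegree = n := by
  obtain ⟨hφ, Ψ, hΨ⟩ := hg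
  have hne : ∀ i, (φ i).1 ^ (φ i).2 ≠ 0 := fun i => pow_ne_zero _ (hφ i).1.ne_zero
  have : ∀ i, Module.Finite F (AdjoinRoot ((φ i).1 ^ (φ i).2)) := fun i =>
    (AdjoinRoot.powerBasis (hne i)).finite
  have h1 := Ψ.finrank_eq
  rw [Module.finrank_fin_fun, Module.finrank_pi_fintype] at h1
  rw [h1]
  refine Finset.sum_congr rfl fun i _ => ?_
  rw [(AdjoinRoot.powerBasis (hne i)).finrank, AdjoinRoot.powerBasis_dim, natDegree_pow]

theorem natDegree_expPart {φ : Fin k → F[X] × ℕ} (h : ∀ i, (φ i).1.Monic) (e : ℕ) :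
    (expPart φ e).natDegree = ∑ i with (φ i).2 = e, (φ i).1.natDegree :=
  natDegree_prod_of_monic _ _ fun i _ => h i

theorem IsDecomp.mem_Icc {g : Matrix (Fin n) (Fin n) F} {φ : Fin k → F[X] × ℕ}
    (hg : IsDecomp g φ) (i : Fin k) : (φ i).2 ∈ Finset.Icc 1 n := by
  refine Finset.mem_Icc.2 ⟨Nat.one_le_iff_ne_zero.2 (hg.1 i).2.2, ?_⟩
  calc (φ i).2 ≤ (φ i).2 * (φ i).1.natDegree :=
        Nat.le_mul_of_pos_right _ (hg.1 i).2.1.natDegree_pos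
    _ ≤ ∑ i, (φ i).2 * (φ i).1.natDegree :=
        Finset.single_le_sum (f := fun i => (φ i).2 * (φ i).1.natDegree)
          (fun _ _ => Nat.zero_le _) (Finset.mem_univ i)
    _ = n := hg.sum_eq

theorem IsDecomp.sum_expPart {g : Matrix (Fin n) (Fin n) F} {φ : Fin k → F[X] × ℕ}
    (hg : IsDecomp g φ) : ∑ e ∈ Finset.Icc 1 n, e * (expPart φ e).natDegree = n := by
  conv_rhs => rw [← hg.sum_eq]
  rw [← Finset.sum_fiberwise_of_maps_to (fun i _ => hg.mem_Icc i)]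
  refine Finset.sum_congr rfl fun e _ => ?_
  rw [natDegree_expPart fun i => (hg.1 i).1, Finset.mul_sum]
  exact Finset.sum_congr rfl fun i hi => by rw [(Finset.mem_filter.1 hi).2]

theorem IsDecomp.det_eq {g : Matrix (Fin n) (Fin n) F} {φ : Fin k → F[X] × ℕ}
    (hg : IsDecomp g φ) :
    (-1) ^ n * g.det = ∏ e ∈ Finset.Icc 1 n, (expPart φ e).coeff 0 ^ e := by
  have hsum := hg.sum_eq
  have hI := hg.mem_Icc
  obtain ⟨hφ, Ψ, hΨ⟩ := hg
  have hne : ∀ i, (φ i).1 ^ (φ i).2 ≠ 0 := fun i => pow_ne_zero _ (hφ i).1.ne_zero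
  have : ∀ i, Module.Finite F (AdjoinRoot ((φ i).1 ^ (φ i).2)) := fun i =>
    (AdjoinRoot.powerBasis (hne i)).finite
  have h1 : LinearMap.det (LinearMap.pi fun i => (Algebra.lmul F
      (AdjoinRoot ((φ i).1 ^ (φ i).2)) (AdjoinRoot.root _)).comp (LinearMap.proj i)) = g.det := by
    rw [← LinearMap.det_conj _ Ψ.symm, ← LinearMap.det_toLin']
    congr 1
    refine LinearMap.ext fun v => Ψ.injective (funext fun i => ?_)
    simp [hΨ]
  rw [← h1, det_pi_dep]
  conv_lhs => rw [← hsum]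
  rw [← Finset.prod_pow_eq_pow_sum, ← Finset.prod_mul_distrib,
    ← Finset.prod_fiberwise_of_maps_to (fun i _ => hI i)]
  refine Finset.prod_congr rfl fun e _ => ?_
  rw [expPart, ← constantCoeff_apply, map_prod, ← Finset.prod_pow]
  refine Finset.prod_congr rfl fun i hi => ?_
  rw [← (Finset.mem_filter.1 hi).2]
  change _ * Algebra.norm F _ = _
  have h2 := Algebra.PowerBasis.norm_gen_eq_coeff_zero_minpoly (AdjoinRoot.powerBasis (hne i))
  rw [AdjoinRoot.powerBasis_gen, AdjoinRoot.powerBasis_dim, 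
    ← AdjoinRoot.powerBasis_gen (hne i),
      AdjoinRoot.minpoly_powerBasis_gen_of_monic ((hφ i).1.pow _)] at h2
  rw [AdjoinRoot.powerBasis_gen] at h2
  rw [h2, natDegree_pow, ← mul_assoc, ← mul_pow, neg_one_mul, neg_neg, one_pow, one_mul,
    ← map_pow, constantCoeff_apply]

theorem IsDecomp.exists_commute_det [Finite F] {g : Matrix (Fin n) (Fin n) F}
    {φ : Fin k → F[X] × ℕ} (hg : IsDecomp g φ) (h1 : expPart φ 1 ≠ 1) (d : Fˣ) :
    ∃ z : GL (Fin n) F, z.1 * g = g * z.1 ∧ GeneralLinearGroup.det z = d := by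
  classical
  have : ∃ i, (φ i).2 = 1 := by
    by_contra! h
    exact h1 (Finset.prod_eq_one fun i hi => absurd (Finset.mem_filter.1 hi).2 (h i))
  obtain ⟨j, hj⟩ := this
  obtain ⟨hφ, Ψ, hΨ⟩ := hg
  have hne : ∀ i, (φ i).1 ^ (φ i).2 ≠ 0 := fun i => pow_ne_zero _ (hφ i).1.ne_zero
  have : ∀ i, Module.Finite F (AdjoinRoot ((φ i).1 ^ (φ i).2)) := fun i =>
    (AdjoinRoot.powerBasis (hne i)).finite
  have hu : ∃ u : AdjoinRoot ((φ j).1 ^ (φ j).2), Algebra.norm F u = d := by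
    have : Fact (Irreducible ((φ j).1 ^ (φ j).2)) := ⟨by rw [hj, pow_one]; exact (hφ j).2.1⟩
    have : Finite (AdjoinRoot ((φ j).1 ^ (φ j).2)) := Module.finite_of_finite F
    obtain ⟨u, hu⟩ := FiniteField.unitsMap_norm_surjective F (AdjoinRoot ((φ j).1 ^ (φ j).2)) d
    exact ⟨u, congrArg Units.val hu⟩
  obtain ⟨u, hu⟩ := hu
  let U : ∀ i, AdjoinRoot ((φ i).1 ^ (φ i).2) := Function.update 1 j u
  let D : (∀ i, AdjoinRoot ((φ i).1 ^ (φ i).2)) →ₗ[F] ∀ i, AdjoinRoot ((φ i).1 ^ (φ i).2) :=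
    LinearMap.pi fun i => (Algebra.lmul F (AdjoinRoot ((φ i).1 ^ (φ i).2)) (U i)).comp
      (LinearMap.proj i)
  let E : (Fin n → F) →ₗ[F] (Fin n → F) := Ψ.symm.toLinearMap ∘ₗ D ∘ₗ Ψ.toLinearMap
  have hE : LinearMap.det E = d := by
    rw [show E = Ψ.symm.toLinearMap ∘ₗ D ∘ₗ Ψ.symm.symm.toLinearMap from rfl,
      LinearMap.det_conj, det_pi_dep, Finset.prod_eq_single j]
    · change Algebra.norm F (U j) = d
      simp [U, hu]
    · intro i _ hij
      change Algebra.norm F (U i) = 1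
      simp [U, hij]
    · simp
  let Z : GL (Fin n) F := GeneralLinearGroup.mkOfDetNeZero (LinearMap.toMatrix' E)
    (by rw [LinearMap.det_toMatrix', hE]; exact d.ne_zero)
  have hZ : Z.1 = LinearMap.toMatrix' E := rfl
  refine ⟨Z, Matrix.ext_of_mulVec_single fun i => ?_, Units.ext ?_⟩
  · rw [← mulVec_mulVec, ← mulVec_mulVec, hZ, LinearMap.toMatrix'_mulVec,
      LinearMap.toMatrix'_mulVec]
    refine Ψ.injective (funext fun i => ?_)
    simp only [E, D, LinearMap.comp_apply, LinearEquiv.coe_coe, LinearEquiv.apply_symm_apply, hΨ,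
      LinearMap.pi_apply, LinearMap.proj_apply]
    change U i * (_ * _) = _ * (U i * _)
    ring
  · change Z.1.det = d
    rw [hZ, LinearMap.det_toMatrix', hE]
end
end BostonShalev

open Matrix Polynomial
namespace BostonShalev

theorem sum_biUnion_mon_pow_le {F : Type*} [Field F] [Fintype F] [DecidableEq F] (D e : ℕ) {r : ℝ}
    (hr : 0 ≤ r) (h : Fintype.card F * r ^ (e + 2) ≤ (3 / 4) ^ (e + 2)) :
    ∑ f ∈ (Finset.range D).biUnion (mon F), r ^ ((e + 2) * f.natDegree) ≤
      Real.exp (9 / 7 * (3 / 4) ^ e) := by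
  have hx0 : (0 : ℝ) ≤ Fintype.card F * r ^ (e + 2) := by positivity
  have hc : ((3 : ℝ) / 4) ^ (e + 2) ≤ 9 / 16 := by
    rw [pow_add]
    have : ((3 : ℝ) / 4) ^ e ≤ 1 := pow_le_one₀ (by norm_num) (by norm_num)
    norm_num; linarith
  rw [Finset.sum_biUnion]
  · have h1 : ∀ d ∈ Finset.range D, ∑ f ∈ mon F d, r ^ ((e + 2) * f.natDegree) =
        (Fintype.card F * r ^ (e + 2)) ^ d := by
      intro d _
      rw [Finset.sum_congr rfl (g := fun _ => r ^ ((e + 2) * d)) fun f hf => by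
        rw [(mem_mon.1 hf).2], Finset.sum_const, card_mon, nsmul_eq_mul, mul_pow, ← pow_mul,
        Nat.cast_pow]
    rw [Finset.sum_congr rfl h1]
    have h2 := geom_sum_eq (x := (Fintype.card F * r ^ (e + 2) : ℝ)) (by linarith) D
    set x := (Fintype.card F * r ^ (e + 2) : ℝ)
    have h3 : ∑ i ∈ Finset.range D, x ^ i ≤ 1 + x / (1 - x) := by
      have h4 : (∑ i ∈ Finset.range D, x ^ i) = (1 - x ^ D) / (1 - x) := by
        rw [h2, ← neg_div_neg_eq]; ring_nf
      rw [h4, show 1 + x / (1 - x) = 1 / (1 - x) by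
        have : (1 - x) ≠ 0 := by linarith
        field_simp; ring]
      gcongr
      · linarith
      · linarith [pow_nonneg hx0 D]
    have h5 : x / (1 - x) ≤ 9 / 7 * (3 / 4) ^ e := by
      rw [div_le_iff₀ (by linarith)]
      have : x ≤ 9 / 16 * (3 / 4) ^ e := by rw [pow_add] at h; linarith
      have h6 : (0 : ℝ) ≤ (3 / 4) ^ e := by positivity
      have h7 : (7 : ℝ) / 16 ≤ 1 - x := by linarith
      nlinarith
    linarith [Real.add_one_le_exp (x / (1 - x)), Real.exp_le_exp.2 h5]
  · intro d _ d' _ hdd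
    refine Finset.disjoint_left.2 fun f hf hf' => hdd ?_
    rw [← (mem_mon.1 hf).2, ← (mem_mon.1 hf').2]

theorem sum_prod_pow_natDegree_le {F : Type*} [Field F] [Fintype F] [DecidableEq F] (N D : ℕ)
    {r : ℝ} (hr : 0 ≤ r) (h : ∀ e : ℕ, Fintype.card F * r ^ (e + 2) ≤ (3 / 4) ^ (e + 2)) :
    ∑ t ∈ Fintype.piFinset fun _ : Fin N => (Finset.range D).biUnion (mon F),
      ∏ e, r ^ ((e.1 + 2) * (t e).natDegree) ≤ Real.exp 6 := by
  rw [← Finset.prod_univ_sum (fun _ : Fin N => (Finset.range D).biUnion (mon F))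
    fun e f => r ^ ((e.1 + 2) * f.natDegree)]
  refine (Finset.prod_le_prod (fun e _ => Finset.sum_nonneg fun f _ => by positivity)
    fun e _ => sum_biUnion_mon_pow_le D e.1 hr (h e.1)).trans ?_
  rw [← Real.exp_sum, Real.exp_le_exp, ← Finset.mul_sum,
    Fin.sum_univ_eq_sum_range (fun i => ((3 : ℝ) / 4) ^ i), geom_sum_eq (by norm_num)]
  have : (0 : ℝ) ≤ (3 / 4) ^ N := by positivity
  rw [show (((3 : ℝ) / 4) ^ N - 1) / (3 / 4 - 1) = 4 * (1 - (3 / 4) ^ N) by ring]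
  linarith

theorem exists_type (F : Type*) [Field F] [Finite F] (N : ℕ) :
    ∃ τ : Matrix (Fin (N + 1)) (Fin (N + 1)) F → Fin (N + 1) → F[X],
      (∀ g e, (τ g e).Monic) ∧ (∀ g, ∑ e, (e.1 + 1) * (τ g e).natDegree = N + 1) ∧
      (∀ g, (-1) ^ (N + 1) * g.det = ∏ e, (τ g e).coeff 0 ^ (e.1 + 1)) ∧
      (∀ g h, τ g = τ h → ∃ x : GL (Fin (N + 1)) F, x.1 * g = h * x.1) ∧
      ∀ g, τ g 0 ≠ 1 → ∀ d : Fˣ, ∃ z : GL (Fin (N + 1)) F, z.1 * g = g * z.1 ∧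
        GeneralLinearGroup.det z = d := by
  have H := fun g : Matrix (Fin (N + 1)) (Fin (N + 1)) F => exists_isDecomp g
  choose k φ hφ using H
  refine ⟨fun g e => expPart (φ g) (e.1 + 1), fun g e => expPart_monic (fun i => ((hφ g).1 i).1) _,
    fun g => ?_, fun g => ?_, fun g h hgh => (hφ g).exists_conj (hφ h) fun e => ?_,
    fun g hg => (hφ g).exists_commute_det hg⟩
  · conv_rhs => rw [← (hφ g).sum_expPart]
    rw [Fin.sum_univ_eq_sum_range (fun i => (i + 1) * (expPart (φ g) (i + 1)).natDegree),
      ← Finset.Ico_add_one_right_eq_Icc, Finset.sum_Ico_eq_sum_range]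
    exact Finset.sum_congr rfl fun i _ => by rw [add_comm]
  · rw [(hφ g).det_eq,
      Fin.prod_univ_eq_prod_range (fun i => (expPart (φ g) (i + 1)).coeff 0 ^ (i + 1)),
      ← Finset.Ico_add_one_right_eq_Icc, Finset.prod_Ico_eq_prod_range]
    exact Finset.prod_congr rfl fun i _ => by rw [add_comm]
  · by_cases he : e ∈ Finset.Icc 1 (N + 1)
    · obtain ⟨h1, h2⟩ := Finset.mem_Icc.1 he
      have := congrFun hgh ⟨e - 1, by omega⟩
      simpa [Nat.sub_add_cancel h1] using this
    · have : ∀ g, expPart (φ g) e = 1 := fun g =>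
        Finset.prod_eq_one fun i hi => absurd ((hφ g).mem_Icc i)
          (by rw [(Finset.mem_filter.1 hi).2]; exact he)
      rw [this, this]

section
variable {F : Type*} [Field F] [Fintype F] {N : ℕ} {G : Subgroup (GL (Fin (N + 1)) F)}

theorem ContainsSL.isConj (hG : ContainsSL G) {g h : G} {x : GL (Fin (N + 1)) F}
    (hx : x * g.1 = h.1 * x) (hd : GeneralLinearGroup.det x = 1) : IsConj g h := by
  have hxG : x ∈ G := hG (det_eq_one_iff_mem_range.2 (congrArg Units.val hd))
  refine isConj_iff.2 ⟨⟨x, hxG⟩, Subtype.ext ?_⟩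
  change x * g.1 * x⁻¹ = h.1
  rw [hx, mul_inv_cancel_right]

theorem card_units_quotient_pow_le (F : Type*) [Field F] [Finite F] (n : ℕ) (hn : 0 < n) :
    Nat.card (Fˣ ⧸ (powMonoidHom n : Fˣ →* Fˣ).range) ≤ n := by
  change (powMonoidHom n : Fˣ →* Fˣ).range.index ≤ n
  rw [IsCyclic.index_powMonoidHom_range]
  exact Nat.gcd_le_right _ hn

/-- The number of conjugacy classes is controlled by the elementary divisor types. -/
theorem card_conjClasses_le_types (hG : ContainsSL G)
    {τ : Matrix (Fin (N + 1)) (Fin (N + 1)) F → Fin (N + 1) → F[X]}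
    (h1 : ∀ g h, τ g = τ h → ∃ x : GL (Fin (N + 1)) F, x.1 * g = h * x.1)
    (h2 : ∀ g, τ g 0 ≠ 1 → ∀ d : Fˣ, ∃ z : GL (Fin (N + 1)) F, z.1 * g = g * z.1 ∧
        GeneralLinearGroup.det z = d) {T₁ T₀ : Set (Fin (N + 1) → F[X])}
    (hT₁ : T₁.Finite) (hT₀ : T₀.Finite) (hm₁ : ∀ g ∈ G, τ g.1 0 ≠ 1 → τ g.1 ∈ T₁)
    (hm₀ : ∀ g ∈ G, τ g.1 0 = 1 → τ g.1 ∈ T₀) :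
    Nat.card (ConjClasses G) ≤ T₁.ncard + T₀.ncard * (N + 1) := by
  classical
  let Q := Fˣ ⧸ (powMonoidHom (N + 1) : Fˣ →* Fˣ).range
  have hr : ∀ g : Matrix (Fin (N + 1)) (Fin (N + 1)) F,
      ∃ x : GL (Fin (N + 1)) F, x.1 * g = Function.invFun τ (τ g) * x.1 := fun g =>
    h1 _ _ (Function.invFun_eq ⟨g, rfl⟩).symm
  choose x hx using hr
  let P : G → (Fin (N + 1) → F[X]) × Q := fun g =>
    (τ g.1.1, if τ g.1.1 0 ≠ 1 then 1 else QuotientGroup.mk (GeneralLinearGroup.det (x g.1.1)))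
  have hP : ∀ g h : G, P g = P h → IsConj g h := by
    intro g h hgh
    obtain ⟨ht, hq⟩ := Prod.ext_iff.1 hgh
    simp only [P] at ht hq
    have hy : (x h.1.1)⁻¹ * x g.1.1 * g.1 = h.1 * ((x h.1.1)⁻¹ * x g.1.1) := by
      rw [mul_assoc, inv_mul_eq_iff_eq_mul]
      refine Units.ext ?_
      have e1 := hx g.1.1
      have e2 := hx h.1.1
      rw [← ht] at e2
      simp only [Units.val_mul, ← Matrix.mul_assoc]
      rw [e1, e2]
      simp [Matrix.mul_assoc]
    by_cases hc : τ g.1.1 0 ≠ 1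
    · obtain ⟨z, hz, hzd⟩ := h2 _ hc (GeneralLinearGroup.det ((x h.1.1)⁻¹ * x g.1.1))⁻¹
      refine hG.isConj (x := (x h.1.1)⁻¹ * x g.1.1 * z) ?_ (by rw [map_mul, hzd, mul_inv_cancel])
      have hz' : z * g.1 = g.1 * z := Units.ext hz
      rw [mul_assoc, hz', ← mul_assoc, hy, mul_assoc]
    · have hc' : ¬ τ h.1.1 0 ≠ 1 := by rwa [← ht]
      rw [if_neg hc, if_neg hc', QuotientGroup.eq] at hq
      obtain ⟨d, hd⟩ := hq
      have hs : ∀ y : GL (Fin (N + 1)) F, GeneralLinearGroup.scalar (Fin (N + 1)) d * y =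
          y * GeneralLinearGroup.scalar (Fin (N + 1)) d := fun y => by
        refine Units.ext ?_
        ext i j
        simp [GeneralLinearGroup.scalar, diagonal_mul, mul_diagonal, mul_comm]
      refine hG.isConj (x := GeneralLinearGroup.scalar (Fin (N + 1)) d *
        ((x h.1.1)⁻¹ * x g.1.1)) ?_ ?_
      · rw [mul_assoc, hy, ← mul_assoc, hs, mul_assoc]
      · have : GeneralLinearGroup.det (GeneralLinearGroup.scalar (Fin (N + 1)) d) =
            d ^ (N + 1) := by
          refine Units.ext ?_
          simp [GeneralLinearGroup.scalar]
        rw [map_mul, this, map_mul, map_inv]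
        rw [powMonoidHom_apply] at hd
        rw [hd]
        group
  let f : ConjClasses G → (Fin (N + 1) → F[X]) × Q := fun c => P (Quotient.out c)
  have hf : Function.Injective f := by
    intro c d hcd
    have := hP _ _ hcd
    rw [← ConjClasses.mk_eq_mk_iff_isConj] at this
    have e : ∀ c : ConjClasses G, ConjClasses.mk (Quotient.out c) = c := fun c => Quotient.out_eq c
    rwa [e, e] at this
  have hsub : Set.range f ⊆ T₁ ×ˢ {1} ∪ T₀ ×ˢ Set.univ := by
    rintro _ ⟨c, rfl⟩
    by_cases hc : τ (Quotient.out c).1.1 0 ≠ 1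
    · exact Or.inl ⟨hm₁ _ (Quotient.out c).2 hc, by simp only [f, P]; rw [if_pos hc]; rfl⟩
    · exact Or.inr ⟨hm₀ _ (Quotient.out c).2 (not_not.1 hc), trivial⟩
  rw [← Nat.card_range_of_injective hf, Nat.card_coe_set_eq]
  refine (Set.ncard_le_ncard hsub ((hT₁.prod (Set.finite_singleton _)).union
    (hT₀.prod Set.finite_univ))).trans ((Set.ncard_union_le _ _).trans ?_)
  rw [Set.ncard_prod, Set.ncard_prod, Set.ncard_singleton, mul_one, Set.ncard_univ]
  gcongr
  exact card_units_quotient_pow_le F (N + 1) N.succ_pos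
end
end BostonShalev

open Matrix Polynomial
namespace BostonShalev
section
variable {F : Type*} [Field F] [Fintype F]

theorem mul_pow_le_sqrt_pow (N : ℕ) {s : ℝ} (hs : 7 / 5 ≤ s) :
    ((N + 2 : ℕ) : ℝ) * ((4 / 3) * s) ^ (N + 2) ≤ 40 * (s ^ 2) ^ (N + 1) := by
  have h1 := one_add_mul_le_pow (a := (1 / 20 : ℝ)) (by norm_num) (N + 2)
  have h2 : ((4 : ℝ) / 3) ^ (N + 2) * (1 + 1 / 20) ^ (N + 2) = (49 / 25) * (7 / 5) ^ N := by
    rw [← mul_pow, pow_add]; norm_num; ring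
  have h3 : (7 / 5 : ℝ) ^ N ≤ s ^ N := pow_le_pow_left₀ (by norm_num) hs N
  have h4 : ((N + 2 : ℕ) : ℝ) * (4 / 3) ^ (N + 2) ≤ 40 * s ^ N := by
    have h5 : ((N + 2 : ℕ) : ℝ) ≤ 20 * (1 + 1 / 20) ^ (N + 2) := by linarith
    have h6 : (0 : ℝ) ≤ (4 / 3) ^ (N + 2) := by positivity
    nlinarith
  calc ((N + 2 : ℕ) : ℝ) * ((4 / 3) * s) ^ (N + 2)
      = ((N + 2 : ℕ) : ℝ) * (4 / 3) ^ (N + 2) * s ^ (N + 2) := by rw [mul_pow]; ring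
    _ ≤ 40 * s ^ N * s ^ (N + 2) := by
        have : 0 ≤ s := by linarith
        gcongr
    _ = 40 * (s ^ 2) ^ (N + 1) := by ring

variable [DecidableEq F] {N : ℕ}

open scoped Classical in
theorem card_types_of_zero_eq_one_le (T : Finset (Fin (N + 1) → F[X]))
    (hT : ∀ t ∈ T, (∀ e, (t e).Monic) ∧ ∑ e, (e.1 + 1) * (t e).natDegree = N + 1 ∧ t 0 = 1)
    {r : ℝ} (hr : 0 < r) (h : ∀ e : ℕ, Fintype.card F * r ^ (e + 2) ≤ (3 / 4) ^ (e + 2)) :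
    T.card ≤ (r⁻¹) ^ (N + 1) * Real.exp 6 := by
  have h1 := sum_prod_pow_natDegree_le (F := F) N (N + 2) hr.le h
  rw [← div_le_iff₀' (by positivity), div_eq_mul_inv, inv_pow, inv_inv, ← nsmul_eq_mul]
  refine le_trans ?_ h1
  rw [← Finset.sum_const]
  have hinj : Set.InjOn Fin.tail (T : Set (Fin (N + 1) → F[X])) := by
    intro t ht t' ht' e
    rw [← Fin.cons_self_tail t, ← Fin.cons_self_tail t', e, (hT t ht).2.2, (hT t' ht').2.2]
  have hsum : ∀ t ∈ T, ∑ e : Fin N, (e.1 + 2) * (t e.succ).natDegree = N + 1 := by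
    intro t ht
    have := (hT t ht).2.1
    rw [Fin.sum_univ_succ, (hT t ht).2.2] at this
    simpa [add_assoc] using this
  calc ∑ _ ∈ T, r ^ (N + 1)
      = ∑ t ∈ T.image Fin.tail, ∏ e, r ^ ((e.1 + 2) * (t e).natDegree) := by
        rw [Finset.sum_image hinj]
        refine Finset.sum_congr rfl fun t ht => ?_
        rw [Finset.prod_pow_eq_pow_sum]
        exact congrArg _ (hsum t ht).symm
    _ ≤ _ := by
        refine Finset.sum_le_sum_of_subset_of_nonneg ?_ fun _ _ _ =>
          Finset.prod_nonneg fun _ _ => by positivity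
        intro t' ht'
        obtain ⟨t, ht, rfl⟩ := Finset.mem_image.1 ht'
        refine Fintype.mem_piFinset.2 fun e => Finset.mem_biUnion.2 ⟨(t e.succ).natDegree, ?_,
          mem_mon.2 ⟨(hT t ht).1 _, rfl⟩⟩
        have h2 := Finset.single_le_sum (f := fun e : Fin N => (e.1 + 2) * (t e.succ).natDegree)
          (fun _ _ => Nat.zero_le _) (Finset.mem_univ e)
        rw [hsum t ht] at h2
        have h3 : (t e.succ).natDegree ≤ (e.1 + 2) * (t e.succ).natDegree :=
          Nat.le_mul_of_pos_left _ (by omega)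
        exact Finset.mem_range.2 (by omega)

open scoped Classical in
theorem card_types_of_zero_ne_one_le (A : Finset F) (hA : ∀ δ ∈ A, δ ≠ 0)
    (T : Finset (Fin (N + 1) → F[X]))
    (hT : ∀ t ∈ T, (∀ e, (t e).Monic) ∧ ∑ e, (e.1 + 1) * (t e).natDegree = N + 1 ∧
      ∏ e, (t e).coeff 0 ^ (e.1 + 1) ∈ A ∧ t 0 ≠ 1) :
    T.card ≤ A.card * (Fintype.card F : ℝ) ^ N * Real.exp 6 := by
  have hq : (2 : ℝ) ≤ Fintype.card F := by exact_mod_cast Fintype.one_lt_card (α := F)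
  obtain ⟨q, hqF⟩ : ∃ q : ℝ, (Fintype.card F : ℝ) = q := ⟨_, rfl⟩
  have h1 := sum_prod_pow_natDegree_le (F := F) N (N + 2) (r := q⁻¹) (by rw [← hqF]; positivity)
    (fun e => by
      rw [hqF] at hq ⊢
      have hq0 : 0 < q := by linarith
      have h0 : q⁻¹ ≤ 1 / 2 := by
        rw [inv_le_comm₀ hq0 (by norm_num)]; norm_num; exact hq
      have h00 : 0 ≤ q⁻¹ := by positivity
      rw [pow_succ', ← mul_assoc, mul_inv_cancel₀ (by positivity), one_mul]
      calc q⁻¹ ^ (e + 1) ≤ (1 / 2) ^ (e + 1) := pow_le_pow_left₀ h00 h0 _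
        _ = 1 / 2 * (1 / 2) ^ e := by ring
        _ ≤ 9 / 16 * (3 / 4) ^ e := 
          mul_le_mul (by norm_num) (pow_le_pow_left₀ (by norm_num) (by norm_num) _)
            (by positivity) (by norm_num)
        _ = _ := by ring)
  refine le_trans ?_ (mul_le_mul_of_nonneg_left h1 (by positivity))
  have hsum : ∀ t ∈ T, (t 0).natDegree + ∑ e : Fin N, (e.1 + 2) * (t e.succ).natDegree = N + 1 := by
    intro t ht
    have := (hT t ht).2.1
    rw [Fin.sum_univ_succ] at this
    simpa [add_assoc] using this
  have hmaps : ∀ t ∈ T, Fin.tail t ∈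
      Fintype.piFinset fun _ : Fin N => (Finset.range (N + 2)).biUnion (mon F) := by
    intro t ht
    refine Fintype.mem_piFinset.2 fun e => Finset.mem_biUnion.2 ⟨(t e.succ).natDegree, ?_,
      mem_mon.2 ⟨(hT t ht).1 _, rfl⟩⟩
    have h2 := Finset.single_le_sum (f := fun e : Fin N => (e.1 + 2) * (t e.succ).natDegree)
      (fun _ _ => Nat.zero_le _) (Finset.mem_univ e)
    have h4 := hsum t ht
    have h3 : (t e.succ).natDegree ≤ (e.1 + 2) * (t e.succ).natDegree :=
      Nat.le_mul_of_pos_left _ (by omega)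
    exact Finset.mem_range.2 (by omega)
  rw [Finset.card_eq_sum_card_fiberwise hmaps, Nat.cast_sum, Finset.mul_sum]
  refine Finset.sum_le_sum fun t' _ => ?_
  rw [Finset.prod_pow_eq_pow_sum]
  obtain ⟨m, hm⟩ : ∃ m, ∑ e : Fin N, (e.1 + 2) * (t' e).natDegree = m := ⟨_, rfl⟩
  rw [hm, hqF]
  have hdeg : ∀ t ∈ T.filter fun t => Fin.tail t = t', (t 0).natDegree + m = N + 1 := by
    intro t ht
    obtain ⟨ht', rfl⟩ := Finset.mem_filter.1 ht
    rw [← hm]; exact hsum t ht'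
  by_cases hmN : m ≤ N
  · obtain ⟨d, rfl⟩ := Nat.exists_eq_add_of_le' hmN
    obtain ⟨c, hc⟩ : ∃ c, ∏ e : Fin (d + m), (t' e).coeff 0 ^ (e.1 + 2) = c := ⟨_, rfl⟩
    have key : (T.filter fun t => Fin.tail t = t').card ≤ A.card * Fintype.card F ^ d := by
      rw [← Finset.card_image_of_injOn (f := fun t => t 0)]
      · refine (Finset.card_le_card (t := A.biUnion fun δ => monC (d + 1) (δ / c)) ?_).trans
          (Finset.card_biUnion_le_card_mul _ _ _ fun δ _ => (card_monC d _).le)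
        intro f hf
        obtain ⟨t, ht, rfl⟩ := Finset.mem_image.1 hf
        have hd := hdeg t ht
        obtain ⟨ht', rfl⟩ := Finset.mem_filter.1 ht
        obtain ⟨hmon, _, hcon, _⟩ := hT t ht'
        refine Finset.mem_biUnion.2 ⟨_, hcon, mem_monC.2 ⟨⟨hmon 0, by omega⟩, ?_⟩⟩
        have h0 := hA _ hcon
        rw [Fin.prod_univ_succ] at h0 ⊢
        have e1 : ∏ i : Fin (d + m), (t i.succ).coeff 0 ^ (i.succ.1 + 1) = c := by
          rw [← hc]; rfl
        rw [e1] at h0 ⊢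
        have hc0 : c ≠ 0 := right_ne_zero_of_mul h0
        simp [hc0]
      · intro t ht s hs e
        have ht := (Finset.mem_filter.1 ht).2
        have hs := (Finset.mem_filter.1 hs).2
        simp only at e
        rw [← Fin.cons_self_tail t, ← Fin.cons_self_tail s, ht, hs, e]
    calc ((T.filter fun t => Fin.tail t = t').card : ℝ) ≤ A.card * q ^ d := by
          rw [← hqF]; exact_mod_cast key
      _ = A.card * q ^ (d + m) * q⁻¹ ^ m := by
          have : q ≠ 0 := by rw [← hqF]; positivity
          rw [pow_add, inv_pow]; field_simp
  · have : (T.filter fun t => Fin.tail t = t') = ∅ := by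
      refine Finset.eq_empty_of_forall_notMem fun t ht => ?_
      have h2 := hdeg t ht
      have h3 := hT t (Finset.mem_filter.1 ht).1
      exact h3.2.2.2 (eq_one_of_monic_natDegree_zero (h3.1 0) (by omega))
    rw [this, Finset.card_empty, Nat.cast_zero, ← hqF]
    positivity

/-- The number of conjugacy classes is at most a constant times the number of characteristic
polynomials. -/
theorem card_conjClasses_le {G : Subgroup (GL (Fin (N + 2)) F)} (hG : ContainsSL G) :
    (Nat.card (ConjClasses G) : ℝ) ≤ 41 * Real.exp 6 * (classPolys G).ncard := by
  classical
  obtain ⟨τ, h1, h2, h3, h4, h5⟩ := exists_type F (N + 1)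
  have hfin : (constants G).Finite := Set.toFinite _
  let U := Fintype.piFinset fun _ : Fin (N + 2) => (Finset.range (N + 3)).biUnion (mon F)
  have hU : ∀ g, τ g ∈ U := fun g => by
    refine Fintype.mem_piFinset.2 fun e => Finset.mem_biUnion.2 ⟨_, ?_, mem_mon.2 ⟨h1 g e, rfl⟩⟩
    have h6 := Finset.single_le_sum (f := fun e : Fin (N + 2) => (e.1 + 1) * (τ g e).natDegree)
      (fun _ _ => Nat.zero_le _) (Finset.mem_univ e)
    rw [h2] at h6
    have h7 : (τ g e).natDegree ≤ (e.1 + 1) * (τ g e).natDegree :=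
      Nat.le_mul_of_pos_left _ (by omega)
    exact Finset.mem_range.2 (by omega)
  let T₁ := U.filter fun t => (∀ e, (t e).Monic) ∧ ∑ e, (e.1 + 1) * (t e).natDegree = N + 1 + 1 ∧
      ∏ e, (t e).coeff 0 ^ (e.1 + 1) ∈ hfin.toFinset ∧ t 0 ≠ 1
  let T₀ := U.filter fun t => (∀ e, (t e).Monic) ∧ ∑ e, (e.1 + 1) * (t e).natDegree = N + 1 + 1 ∧
      t 0 = 1
  have hk := card_conjClasses_le_types hG h4 h5 T₁.finite_toSet T₀.finite_toSet
    (fun g hg h => Finset.mem_coe.2 (Finset.mem_filter.2 ⟨hU _, h1 _, h2 _, hfin.mem_toFinset.2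
      ⟨g, hg, h3 _⟩, h⟩))
    (fun g hg h => Finset.mem_coe.2 (Finset.mem_filter.2 ⟨hU _, h1 _, h2 _, h⟩))
  rw [Set.ncard_coe_finset, Set.ncard_coe_finset] at hk
  have hT₁ := card_types_of_zero_ne_one_le hfin.toFinset
    (fun δ hδ => constants_ne_zero (hfin.mem_toFinset.1 hδ)) T₁
    fun t ht => (Finset.mem_filter.1 ht).2
  have hq : (2 : ℝ) ≤ Fintype.card F := by exact_mod_cast Fintype.one_lt_card (α := F)
  rw [ncard_classPolys]
  have ha : 1 ≤ (constants G).ncard := (Set.ncard_pos hfin).2 constants_nonempty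
  rw [← Set.ncard_eq_toFinset_card _ hfin] at hT₁
  obtain ⟨q, hqF⟩ : ∃ q : ℝ, (Fintype.card F : ℝ) = q := ⟨_, rfl⟩
  rw [Nat.cast_mul, Nat.cast_pow]
  rw [hqF] at hq hT₁ ⊢
  obtain ⟨s, hs0, hsq⟩ : ∃ s : ℝ, 7 / 5 ≤ s ∧ s ^ 2 = q :=
    ⟨√q, Real.le_sqrt_of_sq_le (by norm_num; linarith), Real.sq_sqrt (by linarith)⟩
  have hs1 : 0 < s := by linarith
  have hT₀ := card_types_of_zero_eq_one_le T₀ (fun t ht => (Finset.mem_filter.1 ht).2)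
    (r := 3 / 4 * s⁻¹) (by positivity) (fun e => by
      rw [hqF, ← hsq, mul_pow, ← mul_assoc, mul_comm (s ^ 2), mul_assoc]
      refine mul_le_of_le_one_right (by positivity) ?_
      rw [pow_add, inv_pow, inv_pow, mul_left_comm, mul_inv_cancel₀ (by positivity), mul_one]
      exact inv_le_one_of_one_le₀ (one_le_pow₀ (by linarith)))
  have hb := mul_pow_le_sqrt_pow N hs0
  rw [show (3 / 4 * s⁻¹)⁻¹ = 4 / 3 * s by field_simp] at hT₀
  have hE := Real.exp_pos 6
  have hk' : (Nat.card (ConjClasses G) : ℝ) ≤ T₁.card + T₀.card * ((N + 2 : ℕ) : ℝ) := by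
    exact_mod_cast hk
  have ha' : (1 : ℝ) ≤ (constants G).ncard := by exact_mod_cast ha
  rw [hsq] at hb
  have hqN : 0 < q ^ (N + 1) := by positivity
  calc (Nat.card (ConjClasses G) : ℝ) ≤ T₁.card + T₀.card * ((N + 2 : ℕ) : ℝ) := hk'
    _ ≤ (constants G).ncard * q ^ (N + 1) * Real.exp 6 +
        (4 / 3 * s) ^ (N + 2) * Real.exp 6 * ((N + 2 : ℕ) : ℝ) := by gcongr
    _ = (constants G).ncard * q ^ (N + 1) * Real.exp 6 +
        ((N + 2 : ℕ) : ℝ) * (4 / 3 * s) ^ (N + 2) * Real.exp 6 := by ring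
    _ ≤ (constants G).ncard * q ^ (N + 1) * Real.exp 6 +
        40 * ((constants G).ncard * q ^ (N + 1)) * Real.exp 6 := by
        refine add_le_add_right (mul_le_mul_of_nonneg_right (hb.trans ?_) hE.le) _
        nlinarith
    _ = _ := by ring
end
end BostonShalev

open Matrix
namespace BostonShalev
section Transvections
variable {ι κ F : Type*} [Fintype ι] [DecidableEq ι] [Fintype κ] [DecidableEq κ] [Field F]

/-- All transvections with center spanned by `a` and axis `ker φ` lie in `M`. -/
def IsTV (M : Subgroup (GL ι F)) (a φ : ι → F) : Prop :=
  φ ⬝ᵥ a = 0 ∧ ∀ c : F, ∃ m ∈ M, m.1 = 1 + c • vecMulVec a φ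

/-- The transpose of an invertible matrix. -/
def transposeGL (g : GL ι F) : GL ι F where
  val := g.1ᵀ
  inv := (g⁻¹).1ᵀ
  val_inv := by rw [← transpose_mul]; simp
  inv_val := by rw [← transpose_mul]; simp

/-- The subgroup of transposes of elements of `M`. -/
def transposeSubgroup (M : Subgroup (GL ι F)) : Subgroup (GL ι F) where
  carrier := {g | transposeGL g ∈ M}
  mul_mem' {a b} ha hb := by
    have : transposeGL (a * b) = transposeGL b * transposeGL a :=
      Units.ext (transpose_mul a.1 b.1)
    change transposeGL (a * b) ∈ M
    rw [this]; exact M.mul_mem hb ha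
  one_mem' := by
    have : transposeGL (1 : GL ι F) = 1 := Units.ext transpose_one
    change transposeGL 1 ∈ M
    rw [this]; exact M.one_mem
  inv_mem' {a} ha := by
    have : transposeGL a⁻¹ = (transposeGL a)⁻¹ := rfl
    change transposeGL a⁻¹ ∈ M
    rw [this]; exact M.inv_mem ha

theorem transposeGL_transposeGL (g : GL ι F) : transposeGL (transposeGL g) = g := Units.ext rfl

theorem mem_transposeSubgroup {M : Subgroup (GL ι F)} {g : GL ι F} :
    g ∈ transposeSubgroup M ↔ transposeGL g ∈ M := Iff.rfl

theorem transposeSubgroup_transposeSubgroup (M : Subgroup (GL ι F)) :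
    transposeSubgroup (transposeSubgroup M) = M := by
  ext g; rw [mem_transposeSubgroup, mem_transposeSubgroup, transposeGL_transposeGL]

variable {M : Subgroup (GL ι F)} {a b φ ψ : ι → F}

theorem IsTV.transpose (h : IsTV M a φ) : IsTV (transposeSubgroup M) φ a := by
  refine ⟨by rw [dotProduct_comm]; exact h.1, fun c => ?_⟩
  obtain ⟨m, hm, e⟩ := h.2 c
  refine ⟨transposeGL m, by rwa [mem_transposeSubgroup, transposeGL_transposeGL], ?_⟩
  change m.1ᵀ = _
  rw [e, transpose_add, transpose_one, transpose_smul, transpose_vecMulVec]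

theorem IsTV.smul_left (h : IsTV M a φ) (c : F) : IsTV M (c • a) φ := by
  refine ⟨by rw [dotProduct_smul, h.1, smul_zero], fun d => ?_⟩
  obtain ⟨m, hm, e⟩ := h.2 (d * c)
  exact ⟨m, hm, by rw [e, smul_vecMulVec, smul_smul]⟩

theorem isTV_zero_left (M : Subgroup (GL ι F)) (φ : ι → F) : IsTV M 0 φ :=
  ⟨by simp, fun _ => ⟨1, M.one_mem, by simp⟩⟩

theorem IsTV.add_left (h : IsTV M a φ) (h' : IsTV M b φ) : IsTV M (a + b) φ := by
  refine ⟨by rw [dotProduct_add, h.1, h'.1, add_zero], fun d => ?_⟩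
  obtain ⟨m, hm, e⟩ := h.2 d
  obtain ⟨m', hm', e'⟩ := h'.2 d
  refine ⟨m * m', M.mul_mem hm hm', ?_⟩
  rw [Units.val_mul, e, e', add_vecMulVec, smul_add, Matrix.mul_add, Matrix.mul_one,
    Matrix.mul_smul, Matrix.add_mul, Matrix.smul_mul, vecMulVec_mul_vecMulVec, h'.1]
  simp [add_assoc]

theorem IsTV.sub_left (h : IsTV M a φ) (h' : IsTV M b φ) : IsTV M (a - b) φ := by
  rw [sub_eq_add_neg, ← neg_one_smul F b]
  exact h.add_left (h'.smul_left _)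

theorem isTV_transpose_iff : IsTV (transposeSubgroup M) φ a ↔ IsTV M a φ :=
  ⟨fun h => by simpa only [transposeSubgroup_transposeSubgroup] using h.transpose, IsTV.transpose⟩

theorem IsTV.smul_right (h : IsTV M a φ) (c : F) : IsTV M a (c • φ) :=
  isTV_transpose_iff.1 (h.transpose.smul_left c)

theorem IsTV.add_right (h : IsTV M a φ) (h' : IsTV M a ψ) : IsTV M a (φ + ψ) :=
  isTV_transpose_iff.1 (h.transpose.add_left h'.transpose)

theorem IsTV.conj (h : IsTV M a φ) {g : GL ι F} (hg : g ∈ M) :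
    IsTV M (g.1 *ᵥ a) (φ ᵥ* (g⁻¹).1) := by
  refine ⟨?_, fun c => ?_⟩
  · rw [← dotProduct_mulVec, mulVec_mulVec, ← Units.val_mul, inv_mul_cancel]
    simpa using h.1
  · obtain ⟨m, hm, e⟩ := h.2 c
    refine ⟨g * m * g⁻¹, M.mul_mem (M.mul_mem hg hm) (M.inv_mem hg), ?_⟩
    rw [Units.val_mul, Units.val_mul, e, Matrix.mul_add, Matrix.add_mul, Matrix.mul_smul,
      Matrix.smul_mul, mul_vecMulVec, vecMulVec_mul, Matrix.mul_one, ← Units.val_mul]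
    simp

/-- Conjugating one transvection by another. -/
theorem IsTV.conj_tv (h : IsTV M b ψ) (ha : IsTV M a φ) (c : F) :
    IsTV M (b + (c * φ ⬝ᵥ b) • a) (ψ - (c * ψ ⬝ᵥ a) • φ) := by
  obtain ⟨m, hm, e⟩ := ha.2 c
  have h2 : m.1 * (1 - c • vecMulVec a φ) = 1 := by
    rw [e, Matrix.mul_sub, Matrix.mul_one, Matrix.mul_smul, Matrix.add_mul, Matrix.smul_mul,
      vecMulVec_mul_vecMulVec, ha.1]
    simp
  have hinv : (m⁻¹).1 = 1 - c • vecMulVec a φ := by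
    have h3 := Units.inv_mul_cancel_left m (1 - c • vecMulVec a φ)
    rwa [h2, Matrix.mul_one] at h3
  have := h.conj hm
  rw [e, hinv, Matrix.add_mulVec, Matrix.vecMul_sub, one_mulVec, vecMul_one, smul_mulVec,
    vecMulVec_mulVec, Matrix.vecMul_smul, vecMul_vecMulVec, smul_smul] at this
  simpa [smul_smul] using this

theorem IsTV.commutator (ha : IsTV M a φ) (h : IsTV M b ψ) (h0 : ψ ⬝ᵥ a = 0)
    (h1 : φ ⬝ᵥ b ≠ 0) : IsTV M a ψ := by
  have h2 := h.conj_tv ha 1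
  rw [h0, mul_zero, zero_smul, sub_zero, one_mul] at h2
  have h3 := (h2.sub_left h).smul_left (φ ⬝ᵥ b)⁻¹
  rwa [add_sub_cancel_left, smul_smul, inv_mul_cancel₀ h1, one_smul] at h3

theorem exists_dotProduct_eq_zero_ne {t s : κ → F} (h : ∀ c : F, s ≠ c • t) :
    ∃ u, t ⬝ᵥ u = 0 ∧ s ⬝ᵥ u ≠ 0 := by
  by_contra! H
  by_cases ht : t = 0
  · refine h 0 ?_
    rw [zero_smul]
    exact dotProduct_eq_zero s fun u => H u (by rw [ht, zero_dotProduct])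
  · obtain ⟨u, hu⟩ : ∃ u, t ⬝ᵥ u ≠ 0 := by
      by_contra! H'
      exact ht (dotProduct_eq_zero t H')
    refine h ((s ⬝ᵥ u) / (t ⬝ᵥ u)) (dotProduct_eq _ _ fun v => ?_)
    have := H (v - ((t ⬝ᵥ v) / (t ⬝ᵥ u)) • u) (by
      rw [dotProduct_sub, dotProduct_smul, smul_eq_mul, div_mul_cancel₀ _ hu, sub_self])
    rw [dotProduct_sub, dotProduct_smul, smul_eq_mul, sub_eq_zero] at this
    rw [this, smul_dotProduct, smul_eq_mul]
    ring

/-- `M` contains every transvection supported on the image of `B` along the kernel of `C`. -/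
def TPair (M : Subgroup (GL ι F)) (B : Matrix ι κ F) (C : Matrix κ ι F) : Prop :=
  C * B = 1 ∧ ∀ u w : κ → F, w ⬝ᵥ u = 0 → IsTV M (B *ᵥ u) (w ᵥ* C)

theorem tPair_of_blockGL_mem {B : Matrix ι κ F} {C : Matrix κ ι F} (h : C * B = 1)
    (hM : ∀ x : GL κ F, x.1.det = 1 → blockGL h x ∈ M) : TPair M B C := by
  refine ⟨h, fun u w hwu => ⟨?_, fun c => ?_⟩⟩
  · rw [← dotProduct_mulVec, mulVec_mulVec, h, one_mulVec, hwu]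
  · have hdet : (1 + c • vecMulVec u w).det = 1 := by
      rw [← vecMulVec_smul, vecMulVec_eq Unit, det_one_add_replicateCol_mul_replicateRow]
      rw [smul_dotProduct, hwu]; simp
    let x : GL κ F := GeneralLinearGroup.mkOfDetNeZero _ (by rw [hdet]; exact one_ne_zero)
    refine ⟨blockGL h x, hM x hdet, ?_⟩
    rw [coe_blockGL]
    change 1 + B * (1 + c • vecMulVec u w - 1) * C = _
    rw [add_sub_cancel_left, Matrix.mul_smul, Matrix.smul_mul, mul_vecMulVec, vecMulVec_mul]

variable {B : Matrix ι κ F} {C : Matrix κ ι F}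

theorem TPair.transpose (h : TPair M B C) : TPair (transposeSubgroup M) Cᵀ Bᵀ := by
  refine ⟨by rw [← transpose_mul, h.1, transpose_one], fun u w hwu => ?_⟩
  rw [mulVec_transpose, vecMul_transpose]
  exact (h.2 w u (by rw [dotProduct_comm, hwu])).transpose

theorem TPair.dot (h : TPair M B C) (u w : κ → F) : (w ᵥ* C) ⬝ᵥ (B *ᵥ u) = w ⬝ᵥ u := by
  rw [← dotProduct_mulVec, mulVec_mulVec, h.1, one_mulVec]

/-- Vectors of `ker C` that are centers of transvections in `M` for all rows of `C`. -/
def tpY (M : Subgroup (GL ι F)) (C : Matrix κ ι F) : Submodule F (ι → F) where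
  carrier := {y | C *ᵥ y = 0 ∧ ∀ t : κ → F, IsTV M y (t ᵥ* C)}
  add_mem' h h' := ⟨by rw [mulVec_add, h.1, h'.1, add_zero], fun t => (h.2 t).add_left (h'.2 t)⟩
  zero_mem' := ⟨mulVec_zero _, fun _ => isTV_zero_left _ _⟩
  smul_mem' c _ h := ⟨by rw [mulVec_smul, h.1, smul_zero], fun t => (h.2 t).smul_left c⟩

theorem mem_tpY {y : ι → F} : y ∈ tpY M C ↔ C *ᵥ y = 0 ∧ ∀ t : κ → F, IsTV M y (t ᵥ* C) := Iff.rfl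

theorem TPair.mem_tpY_of_exists (h : TPair M B C) {y : ι → F} (hy : C *ᵥ y = 0) {t₀ : κ → F}
    (ht₀ : t₀ ≠ 0) (hT : IsTV M y (t₀ ᵥ* C)) : y ∈ tpY M C := by
  refine ⟨hy, fun t => ?_⟩
  by_cases H : ∀ c : F, t₀ ≠ c • t
  · obtain ⟨u, hu, hu'⟩ := exists_dotProduct_eq_zero_ne H
    exact hT.commutator (h.2 u t hu) (by rw [← dotProduct_mulVec, hy, dotProduct_zero])
      (by rwa [h.dot])
  · push Not at H
    obtain ⟨c, rfl⟩ := H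
    have hc : c ≠ 0 := by rintro rfl; exact ht₀ (zero_smul _ _)
    have := hT.smul_right c⁻¹
    rwa [← smul_vecMul, smul_smul, inv_mul_cancel₀ hc, one_smul] at this

theorem exists_dot_zero_not_smul (hκ : 3 ≤ Fintype.card κ) (x w : κ → F) :
    ∃ t : κ → F, t ⬝ᵥ x = 0 ∧ ∀ c : F, t ≠ c • w := by
  by_contra! H
  let f : (κ → F) →ₗ[F] F := (dotProductBilin F F).flip x
  have h1 : LinearMap.ker f ≤ Submodule.span F {w} := by
    intro t ht
    obtain ⟨c, hc⟩ := H t ht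
    exact Submodule.mem_span_singleton.2 ⟨c, hc.symm⟩
  have h2 := Submodule.finrank_mono h1
  have h3 := f.finrank_range_add_finrank_ker
  have h4 : Module.finrank F (LinearMap.range f) ≤ 1 := (Submodule.finrank_le _).trans (by simp)
  have h5 := finrank_span_le_card (R := F) ({w} : Set (κ → F))
  simp only [Module.finrank_fintype_fun_eq_card, Set.toFinset_singleton, Finset.card_singleton] at *
  omega

/-- If a transvection of `M` has an axis not containing `im B`, the `ker C`-component of its
center lies in `tpY`. -/
theorem TPair.sub_mem_tpY (h : TPair M B C) (hκ : 3 ≤ Fintype.card κ) (hb : IsTV M b ψ)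
    (hψ : ψ ᵥ* B ≠ 0) : b - B *ᵥ (C *ᵥ b) ∈ tpY M C := by
  obtain ⟨t, ht, htw⟩ := exists_dot_zero_not_smul hκ (C *ᵥ b) (ψ ᵥ* B)
  have ht0 : t ≠ 0 := fun h0 => htw 0 (by rw [h0, zero_smul])
  have hw : ∀ c : F, ψ ᵥ* B ≠ c • t := by
    intro c hc
    have hc0 : c ≠ 0 := by rintro rfl; exact hψ (by rw [hc, zero_smul])
    exact htw c⁻¹ (by rw [hc, smul_smul, inv_mul_cancel₀ hc0, one_smul])
  obtain ⟨u, hu, hu'⟩ := exists_dotProduct_eq_zero_ne hw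
  have h1 : IsTV M b (t ᵥ* C) := hb.commutator (h.2 u t hu)
    (by rw [← dotProduct_mulVec]; exact ht) (by rwa [dotProduct_mulVec])
  exact h.mem_tpY_of_exists (by rw [mulVec_sub, mulVec_mulVec, h.1, one_mulVec, sub_self]) ht0
    (h1.sub_left (h.2 _ t ht))

theorem TPair.sub_mem_tpZ (h : TPair M B C) (hκ : 3 ≤ Fintype.card κ) (hb : IsTV M b ψ)
    (hb0 : C *ᵥ b ≠ 0) : ψ - (ψ ᵥ* B) ᵥ* C ∈ tpY (transposeSubgroup M) Bᵀ := by
  have := h.transpose.sub_mem_tpY hκ hb.transpose (by rwa [vecMul_transpose])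
  rwa [mulVec_transpose, mulVec_transpose] at this
end Transvections
end BostonShalev

open Matrix
namespace BostonShalev
section Structure
variable {ι F : Type*} [Fintype ι] [DecidableEq ι] [Field F] {m : ℕ}
  {M : Subgroup (GL ι F)} {B : Matrix ι (Fin m) F} {C : Matrix (Fin m) ι F} {a b φ ψ : ι → F}

theorem mem_tpZ {θ : ι → F} : θ ∈ tpY (transposeSubgroup M) Bᵀ ↔
    θ ᵥ* B = 0 ∧ ∀ t : Fin m → F, IsTV M (B *ᵥ t) θ := by
  rw [mem_tpY, mulVec_transpose]
  refine and_congr_right fun _ => forall_congr' fun t => ?_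
  rw [vecMul_transpose, isTV_transpose_iff]

/-- `m` is the largest size of a `TPair`. -/
def TPMax (M : Subgroup (GL ι F)) (m : ℕ) : Prop :=
  ∀ (B : Matrix ι (Fin (m + 1)) F) (C : Matrix (Fin (m + 1)) ι F), ¬ TPair M B C

theorem TPMax.transpose (h : TPMax M m) : TPMax (transposeSubgroup M) m := fun B C hBC =>
  h Cᵀ Bᵀ (by
    have := hBC.transpose
    rwa [transposeSubgroup_transposeSubgroup] at this)

theorem TPair.dot_eq_zero (h : TPair M B C) (hmax : TPMax M m) {y θ : ι → F} (hy : y ∈ tpY M C)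
    (hθ : θ ∈ tpY (transposeSubgroup M) Bᵀ) : θ ⬝ᵥ y = 0 := by
  by_contra hd
  obtain ⟨θ', hθ', hd'⟩ : ∃ θ' ∈ tpY (transposeSubgroup M) Bᵀ, θ' ⬝ᵥ y = 1 :=
    ⟨(θ ⬝ᵥ y)⁻¹ • θ, Submodule.smul_mem _ _ hθ, by
      rw [smul_dotProduct, smul_eq_mul, inv_mul_cancel₀ hd]⟩
  rw [mem_tpZ] at hθ'
  refine hmax (Matrix.of fun i => Fin.cons (y i) (B i))
    (Matrix.of fun i j => Fin.cases (θ' j) (fun i => C i j) i) ⟨?_, ?_⟩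
  · ext i j
    refine Fin.cases ?_ (fun i => ?_) i <;> refine Fin.cases ?_ (fun j => ?_) j
    · simpa [mul_apply, dotProduct] using hd'
    · simpa [mul_apply, (Fin.succ_ne_zero j).symm] using! congrFun hθ'.1 j
    · simpa [mul_apply] using! congrFun hy.1 i
    · have := congrFun (congrFun h.1 i) j
      simpa [mul_apply, one_apply] using this
  · intro u w huw
    have e1 : (Matrix.of fun i => Fin.cons (y i) (B i) : Matrix ι (Fin (m + 1)) F) *ᵥ u =
        B *ᵥ (Fin.tail u) + u 0 • y := by
      ext i
      simp [mulVec, dotProduct, Fin.sum_univ_succ, Fin.tail, add_comm, mul_comm]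
    have e2 : w ᵥ* (Matrix.of fun i j => Fin.cases (θ' j) (fun i => C i j) i : Matrix (Fin (m + 1)) ι F) =
        (Fin.tail w) ᵥ* C + w 0 • θ' := by
      ext i
      simp [vecMul, dotProduct, Fin.sum_univ_succ, Fin.tail, add_comm]
    rw [e1, e2]
    have huw' : w 0 * u 0 + Fin.tail w ⬝ᵥ Fin.tail u = 0 := by
      rw [← huw]; exact (Fin.sum_univ_succ fun i => w i * u i).symm
    by_cases hu : Fin.tail u = 0
    · rw [hu, dotProduct_zero, add_zero, mul_eq_zero] at huw'
      rw [hu, mulVec_zero, zero_add]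
      rcases huw' with h0 | h0
      · rw [h0, zero_smul, add_zero]
        exact (hy.2 _).smul_left _
      · rw [h0, zero_smul]
        exact isTV_zero_left _ _
    · obtain ⟨v, hv⟩ : ∃ v, v ⬝ᵥ Fin.tail u = 1 := by
        by_contra! H
        refine hu (dotProduct_eq_zero _ fun v => ?_)
        by_contra h0
        refine H ((Fin.tail u ⬝ᵥ v)⁻¹ • v) ?_
        rw [smul_dotProduct, dotProduct_comm v, smul_eq_mul, inv_mul_cancel₀ h0]
      have h1 : IsTV M (B *ᵥ Fin.tail u)
          ((Fin.tail w + (w 0 * u 0) • v) ᵥ* C + w 0 • θ') := by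
        refine (h.2 _ _ ?_).add_right ((hθ'.2 _).smul_right _)
        rw [add_dotProduct, smul_dotProduct, hv, smul_eq_mul, mul_one, add_comm, huw']
      have h2 := h1.conj_tv (hy.2 v) (u 0)
      have e3 : ((Fin.tail w + (w 0 * u 0) • v) ᵥ* C + w 0 • θ') ⬝ᵥ y = w 0 := by
        rw [add_dotProduct, smul_dotProduct, hd', ← dotProduct_mulVec, hy.1, dotProduct_zero,
          zero_add, smul_eq_mul, mul_one]
      rw [h.dot, hv, mul_one, e3] at h2
      convert h2 using 1
      rw [add_vecMul, smul_vecMul, mul_comm (w 0)]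
      abel

theorem TPair.center_mem_tpY (h : TPair M B C) (hmax : TPMax M m) (hm : 3 ≤ m)
    (hb : IsTV M b ψ) {y : ι → F} (hy : y ∈ tpY M C) (hψ : ψ ⬝ᵥ y ≠ 0) : b ∈ tpY M C := by
  have hκ : 3 ≤ Fintype.card (Fin m) := by simpa using hm
  by_cases hb0 : C *ᵥ b = 0
  · by_cases hψB : ψ ᵥ* B = 0
    · exact ⟨hb0, fun t => hb.commutator (hy.2 t)
        (by rw [← dotProduct_mulVec, hb0, dotProduct_zero]) hψ⟩
    · simpa [hb0] using h.sub_mem_tpY hκ hb hψB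
  · exfalso
    have := h.dot_eq_zero hmax hy (h.sub_mem_tpZ hκ hb hb0)
    rw [sub_dotProduct, ← dotProduct_mulVec, hy.1, dotProduct_zero, sub_zero] at this
    exact hψ this

/-- No proper nonzero subspace is invariant under `M`. -/
def IsIrr (M : Subgroup (GL ι F)) : Prop :=
  ∀ W : Submodule F (ι → F), (∀ g ∈ M, ∀ v ∈ W, g.1 *ᵥ v ∈ W) → W = ⊥ ∨ W = ⊤

theorem TPair.tpY_eq_bot (h : TPair M B C) (hmax : TPMax M m) (hm : 3 ≤ m) (hM : IsIrr M) :
    tpY M C = ⊥ := by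
  by_contra hY
  let S : M → Submodule F (ι → F) := fun g => (tpY M C).map (mulVecLin g.1.1)
  have hS : ∀ (g : M) v, v ∈ S g ↔ (g⁻¹).1.1 *ᵥ v ∈ tpY M C := by
    intro g v
    constructor
    · rintro ⟨y, hy, rfl⟩
      simpa using hy
    · intro hv
      exact ⟨_, hv, by simp⟩
  have hinv : ∀ (g : M) {b ψ y}, IsTV M b ψ → y ∈ S g → ψ ⬝ᵥ y ≠ 0 → b ∈ S g := by
    intro g b ψ y hb hy hψ
    rw [hS] at hy ⊢
    refine h.center_mem_tpY hmax hm (hb.conj (g⁻¹).2) hy ?_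
    rw [← dotProduct_mulVec, mulVec_mulVec]
    simpa using hψ
  have htop : ⨆ g, S g = ⊤ := by
    refine (hM _ fun g hg v hv => ?_).resolve_left fun hbot => hY ?_
    · refine Submodule.iSup_induction S (motive := fun v => g.1 *ᵥ v ∈ ⨆ g, S g) hv
        (fun i x hx => ?_) ?_ fun x y hx hy => ?_
      · refine Submodule.mem_iSup_of_mem (⟨g, hg⟩ * i) ?_
        rw [hS] at hx ⊢
        rw [mulVec_mulVec]
        have e : ((⟨g, hg⟩ * i)⁻¹ : M).1.1 * g.1 = (i⁻¹).1.1 := by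
          rw [← Units.val_mul]
          congr 1
          simp
        rwa [e]
      · rw [mulVec_zero]; exact Submodule.zero_mem _
      · rw [mulVec_add]; exact Submodule.add_mem _ hx hy
    · rw [eq_bot_iff, ← hbot]
      refine le_trans (fun y hy => ?_) (le_iSup S 1)
      rw [hS]; simpa using hy
  have hC : ∃ g, ∃ y ∈ S g, C *ᵥ y ≠ 0 := by
    by_contra! H
    have h1 : (⊤ : Submodule F (ι → F)) ≤ LinearMap.ker (mulVecLin C) := by
      rw [← htop]; exact iSup_le fun g y hy => H g y hy
    have h2 : C = 0 := Matrix.ext_of_mulVec_single fun i => by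
      have : Pi.single i 1 ∈ LinearMap.ker (mulVecLin C) := h1 trivial
      rw [zero_mulVec]; exact this
    have h3 := congrFun (congrFun h.1 ⟨0, by omega⟩) ⟨0, by omega⟩
    rw [h2] at h3
    simp at h3
  obtain ⟨g, y, hy, hCy⟩ := hC
  have hU1 : ∀ u, (∀ c : F, C *ᵥ y ≠ c • u) → B *ᵥ u ∈ S g := by
    intro u hu
    obtain ⟨t, ht, ht'⟩ := exists_dotProduct_eq_zero_ne hu
    refine hinv g (h.2 u t (by rw [dotProduct_comm, ht])) hy ?_
    rwa [← dotProduct_mulVec, dotProduct_comm]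
  have hU : ∀ u, B *ᵥ u ∈ S g := by
    intro u
    by_cases hu : ∀ c : F, C *ᵥ y ≠ c • u
    · exact hU1 u hu
    push Not at hu
    obtain ⟨c, hc⟩ := hu
    have hc0 : c ≠ 0 := by rintro rfl; exact hCy (by rw [hc, zero_smul])
    obtain ⟨v, -, hv⟩ := exists_dot_zero_not_smul (F := F) (κ := Fin m) (by simpa using hm) 0 u
    have hv0 : v ≠ 0 := fun h0 => hv 0 (by rw [h0, zero_smul])
    have key : ∀ v, (∀ d : F, v ≠ d • u) → B *ᵥ v ∈ S g := fun v hv => hU1 v fun d hd => by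
      have hd0 : d ≠ 0 := by rintro rfl; exact hCy (by rw [hd, zero_smul])
      exact hv (d⁻¹ * c) (by rw [← smul_smul, ← hc, hd, smul_smul, inv_mul_cancel₀ hd0, one_smul])
    have h1 := key v hv
    have h2 := key (u - v) fun d hd => hv (1 - d) (by rw [sub_smul, one_smul, ← hd, sub_sub_cancel])
    rw [show u = v + (u - v) by abel, mulVec_add]
    exact Submodule.add_mem _ h1 h2
  have hle : tpY M C ≤ S g := by
    intro z hz
    let e : Fin m → F := Pi.single ⟨0, by omega⟩ 1
    refine hinv g (hz.2 e) (hU e) ?_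
    rw [h.dot]
    simp [e]
  have heq : tpY M C = S g := by
    refine Submodule.eq_of_le_of_finrank_le hle ?_
    exact Submodule.finrank_map_le _ _
  have h1 := hU (Pi.single ⟨0, by omega⟩ 1)
  rw [← heq] at h1
  have h2 := h1.1
  rw [mulVec_mulVec, h.1, one_mulVec] at h2
  simpa using congrFun h2 ⟨0, by omega⟩

theorem TPair.center_mem (h : TPair M B C) (hmax : TPMax M m) (hm : 3 ≤ m) (hM : IsIrr M)
    (hM' : IsIrr (transposeSubgroup M)) (hb : IsTV M b ψ) (hψ : ψ ≠ 0) :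
    b = B *ᵥ (C *ᵥ b) ∨ C *ᵥ b = 0 := by
  have hκ : 3 ≤ Fintype.card (Fin m) := by simpa using hm
  have hY := h.tpY_eq_bot hmax hm hM
  have hZ := h.transpose.tpY_eq_bot hmax.transpose hm hM'
  by_contra! H
  have h1 := h.sub_mem_tpZ hκ hb H.2
  rw [hZ, Submodule.mem_bot, sub_eq_zero] at h1
  have h2 := h.sub_mem_tpY hκ hb (fun h0 => hψ (by rw [h1, h0, zero_vecMul]))
  rw [hY, Submodule.mem_bot, sub_eq_zero] at h2
  exact H.1 h2

theorem TPair.mul_eq_or (h : TPair M B C) (hmax : TPMax M m) (hm : 3 ≤ m) (hM : IsIrr M)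
    (hM' : IsIrr (transposeSubgroup M)) {g : GL ι F} (hg : g ∈ M) :
    g.1 * B = B * (C * g.1 * B) ∨ C * g.1 * B = 0 := by
  have key : ∀ u, g.1 *ᵥ (B *ᵥ u) = B *ᵥ (C *ᵥ (g.1 *ᵥ (B *ᵥ u))) ∨
      C *ᵥ (g.1 *ᵥ (B *ᵥ u)) = 0 := by
    intro u
    obtain ⟨w, hw, hw0⟩ := exists_dot_zero_not_smul (F := F) (by simpa using hm) u 0
    have hw0 : w ≠ 0 := fun h0 => hw0 0 (by rw [h0, zero_smul])
    refine h.center_mem hmax hm hM hM' ((h.2 u w hw).conj hg) fun h0 => hw0 ?_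
    have h1 := congrArg (fun z => (z ᵥ* g.1) ᵥ* B) h0
    simpa [vecMul_vecMul, h.1, Matrix.mul_assoc] using h1
  by_contra! H
  have h1 : ∃ u, g.1 *ᵥ (B *ᵥ u) ≠ B *ᵥ (C *ᵥ (g.1 *ᵥ (B *ᵥ u))) := by
    by_contra! H'
    refine H.1 (Matrix.ext_of_mulVec_single fun i => ?_)
    simpa only [← mulVec_mulVec] using H' (Pi.single i 1)
  have h2 : ∃ u, C *ᵥ (g.1 *ᵥ (B *ᵥ u)) ≠ 0 := by
    by_contra! H'
    refine H.2 (Matrix.ext_of_mulVec_single fun i => ?_)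
    simpa only [← mulVec_mulVec, zero_mulVec] using H' (Pi.single i 1)
  obtain ⟨u, hu⟩ := h1
  obtain ⟨v, hv⟩ := h2
  have hu' := (key u).resolve_left hu
  have hv' := (key v).resolve_right hv
  rcases key (u + v) with h3 | h3
  · simp only [mulVec_add] at h3
    rw [← hv', hu', mulVec_zero, zero_add] at h3
    refine hu ?_
    rw [hu', mulVec_zero]
    exact add_eq_right.1 h3
  · simp only [mulVec_add] at h3
    rw [hu', zero_add] at h3
    exact hv h3

theorem TPair.le_card (h : TPair M B C) : m ≤ Fintype.card ι := by
  have h1 := rank_mul_le_right C B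
  rw [h.1, rank_one, Fintype.card_fin] at h1
  exact h1.trans (rank_le_card_height B)

theorem TPair.isTV_of_card_eq (h : TPair M B C) (hm : m = Fintype.card ι) (h0 : φ ⬝ᵥ a = 0) :
    IsTV M a φ := by
  have e : Fin m ≃ ι := Fintype.equivOfCardEq (by simpa using hm)
  have h1 : B * C = 1 := (mul_eq_one_comm_of_equiv e).1 h.1
  have := h.2 (C *ᵥ a) (φ ᵥ* B) (by
    rw [← dotProduct_mulVec, mulVec_mulVec, h1, one_mulVec, h0])
  rwa [mulVec_mulVec, vecMul_vecMul, h1, one_mulVec, vecMul_one] at this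

theorem sl_le_of_isTV (h : ∀ a φ : ι → F, φ ⬝ᵥ a = 0 → IsTV M a φ) :
    (SpecialLinearGroup.toGL (n := ι) (R := F)).range ≤ M := by
  refine sl_le_of_transvection_mem M fun i j hij c => ?_
  obtain ⟨m, hm, e⟩ := (h (Pi.single i 1) (Pi.single j 1) (by simp [hij.symm])).2 c
  convert hm
  refine Units.ext ?_
  rw [e]
  change transvection i j c = _
  ext x y
  simp only [transvection, Matrix.add_apply, Matrix.smul_apply, vecMulVec_apply, single_apply,
    Pi.single_apply,
    smul_eq_mul]
  grind

/-- An irreducible group containing a `TPair` of size at least three and not containing `SL`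
preserves a system of imprimitivity. -/
theorem exists_imprimitivity (h : TPair M B C) (hm : 3 ≤ m) (hM : IsIrr M)
    (hM' : IsIrr (transposeSubgroup M))
    (hSL : ¬ (SpecialLinearGroup.toGL (n := ι) (R := F)).range ≤ M) :
    ∃ k, m ≤ k ∧ k < Fintype.card ι ∧ ∃ (B : Matrix ι (Fin k) F) (C : Matrix (Fin k) ι F),
      C * B = 1 ∧ ∀ g ∈ M, g.1 * B = B * (C * g.1 * B) ∨ C * g.1 * B = 0 := by
  classical
  let P : ℕ → Prop := fun k => ∃ (B : Matrix ι (Fin k) F) (C : Matrix (Fin k) ι F), TPair M B C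
  let k := Nat.findGreatest P (Fintype.card ι)
  have hmk : m ≤ k := Nat.le_findGreatest h.le_card ⟨B, C, h⟩
  obtain ⟨B', C', h'⟩ : P k := Nat.findGreatest_spec h.le_card ⟨B, C, h⟩
  have hmax : TPMax M k := fun B C hBC => by
    have : k + 1 ≤ k := Nat.le_findGreatest hBC.le_card ⟨B, C, hBC⟩
    omega
  refine ⟨k, hmk, lt_of_le_of_ne h'.le_card fun he => hSL (sl_le_of_isTV fun a φ =>
    h'.isTV_of_card_eq he), B', C', h'.1, fun g hg => h'.mul_eq_or hmax (hm.trans hmk) hM hM' hg⟩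
end Structure
end BostonShalev

namespace BostonShalev

open Polynomial Matrix

section DetDvd

variable {ι κ R : Type*} [Fintype ι] [Fintype κ] [DecidableEq ι] [DecidableEq κ] [CommRing R]

theorem det_dvd_det_of_mul_eq {Y : Matrix ι ι R} {J B : Matrix ι κ R} {L : Matrix κ ι R}
    {γ : Matrix κ κ R} (hL : L * J = 1) (h : Y * J = B * γ) : γ.det ∣ Y.det := by
  have key : Y = (B * L + Y * (1 - J * L)) * (1 + J * ((γ - 1) * L)) := by
    have h1 : J * L * J = J := by rw [Matrix.mul_assoc, hL, Matrix.mul_one]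
    have h2 : (B * L + Y * (1 - J * L)) * J = B := by
      rw [Matrix.add_mul, Matrix.mul_assoc, hL, Matrix.mul_assoc, Matrix.sub_mul, h1]; simp
    have h3 : Y * (J * L) = B * (γ * L) := by
      rw [← Matrix.mul_assoc, h, Matrix.mul_assoc]
    rw [Matrix.mul_add, ← Matrix.mul_assoc _ J, h2, Matrix.mul_one, Matrix.mul_sub,
      Matrix.mul_one, h3, Matrix.sub_mul, Matrix.mul_sub, Matrix.one_mul]
    abel
  conv_rhs => rw [key]
  rw [det_mul, det_one_add_mul_comm, Matrix.mul_assoc, hL]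
  simp

end DetDvd

section Cyclic

variable {ι κ F : Type*} [Fintype ι] [Fintype κ] [DecidableEq ι] [DecidableEq κ] [Field F]

/-- The characteristic polynomial of a matrix permuting cyclically `c` independent subspaces. -/
theorem expand_charpoly_dvd {g : Matrix ι ι F} {B : Matrix ι κ F} {L : Matrix κ ι F}
    {A : Matrix κ κ F} {c : ℕ} (hA : g ^ (c + 1) * B = B * A) (hL : L * (g ^ c * B) = 1)
    (hL0 : ∀ i < c, L * (g ^ i * B) = 0) : expand F (c + 1) A.charpoly ∣ g.charpoly := by
  have e : expand F (c + 1) A.charpoly =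
      ((X : F[X]) ^ (c + 1) • (1 : Matrix κ κ F[X]) - A.map C).det := by
    rw [charpoly, AlgHom.map_det]
    congr 1
    ext1 i j
    by_cases hij : i = j
    · subst hij; simp
    · simp [hij]
  rw [e, charpoly]
  refine det_dvd_det_of_mul_eq (J := ∑ i ∈ Finset.range (c + 1), (X : F[X]) ^ (c - i) •
    (g ^ i * B).map C) (B := B.map C) (L := L.map C) ?_ ?_
  · rw [Matrix.mul_sum, Finset.sum_range_succ, Finset.sum_eq_zero]
    · rw [Matrix.mul_smul, ← Matrix.map_mul, hL]; simp
    · intro i hi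
      rw [Matrix.mul_smul, ← Matrix.map_mul, hL0 i (Finset.mem_range.1 hi)]; simp
  · have hY : g.charmatrix = (X : F[X]) • (1 : Matrix ι ι F[X]) - g.map C := by
      rw [charmatrix]
      simp [scalar_apply, ← smul_one_eq_diagonal]
    have key : ∀ d ≤ c + 1, g.charmatrix * ∑ i ∈ Finset.range d, (X : F[X]) ^ (c - i) •
        (g ^ i * B).map C = (X : F[X]) ^ (c + 1) • B.map C -
          (X : F[X]) ^ (c + 1 - d) • (g ^ d * B).map C := by
      intro d
      induction d with
      | zero => simp
      | succ d ih =>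
        intro hd
        rw [Finset.sum_range_succ, Matrix.mul_add, ih (by omega), hY, Matrix.sub_mul,
          Matrix.mul_smul, Matrix.mul_smul, ← Matrix.map_mul, ← Matrix.mul_assoc g, ← pow_succ']
        rw [Matrix.smul_mul, Matrix.one_mul, smul_smul, ← pow_succ,
          show c + 1 - d = c - d + 1 by omega, show c + 1 - (d + 1) = c - d by omega]
        abel
    rw [key _ le_rfl, hA, Matrix.map_mul, Matrix.mul_sub, Matrix.mul_smul, Matrix.mul_one]
    simp

variable {H : Subgroup (GL ι F)} {B : Matrix ι κ F} {C : Matrix κ ι F} [Finite (GL ι F)]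

theorem exists_expand_charpoly_dvd [Nonempty κ] (hCB : C * B = 1)
    (h : ∀ g ∈ H, g.1 * B = B * (C * g.1 * B) ∨ C * g.1 * B = 0) {g : GL ι F} (hg : g ∈ H) :
    ∃ c, ∃ A : Matrix κ κ F, expand F (c + 1) A.charpoly ∣ g.1.charpoly := by
  classical
  have h10 : (1 : Matrix κ κ F) ≠ 0 := one_ne_zero
  have hex : ∃ c, C * (g ^ (c + 1)).1 * B ≠ 0 := by
    refine ⟨orderOf g - 1, ?_⟩
    rw [Nat.sub_add_cancel (orderOf_pos g), pow_orderOf_eq_one]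
    simp [hCB]
  let c := Nat.find hex
  have hc : C * (g ^ (c + 1)).1 * B ≠ 0 := Nat.find_spec hex
  have hlt : ∀ i < c, C * (g ^ (i + 1)).1 * B = 0 := fun i hi => by
    simpa using Nat.find_min hex hi
  have hneg : ∀ i < c, C * (g ^ (i + 1))⁻¹.1 * B = 0 := by
    intro i hi
    by_contra h0
    have h1 := (h _ (H.inv_mem (H.pow_mem hg (i + 1)))).resolve_right h0
    have h2 : B = (g ^ (i + 1)).1 * (B * (C * (g ^ (i + 1))⁻¹.1 * B)) := by
      rw [← h1, ← Matrix.mul_assoc, ← Units.val_mul, mul_inv_cancel, Units.val_one, Matrix.one_mul]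
    apply h10
    rw [← hCB]
    conv_lhs => rw [h2]
    rw [← Matrix.mul_assoc, ← Matrix.mul_assoc, hlt i hi, Matrix.zero_mul]
  refine ⟨c, C * (g ^ (c + 1)).1 * B, expand_charpoly_dvd (B := B) (L := C * (g ^ c)⁻¹.1) ?_ ?_ ?_⟩
  · rw [← Units.val_pow_eq_pow_val]
    exact (h _ (H.pow_mem hg (c + 1))).resolve_right hc
  · rw [← Units.val_pow_eq_pow_val, Matrix.mul_assoc, ← Matrix.mul_assoc _ _ B, ← Units.val_mul,
      inv_mul_cancel, Units.val_one, Matrix.one_mul, hCB]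
  · intro i hi
    have e : (g ^ c)⁻¹ * g ^ i = (g ^ (c - i - 1 + 1))⁻¹ := by
      rw [show c - i - 1 + 1 = c - i by omega, inv_mul_eq_iff_eq_mul, eq_mul_inv_iff_mul_eq,
        ← pow_add, show i + (c - i) = c by omega]
    rw [← Units.val_pow_eq_pow_val, Matrix.mul_assoc, ← Matrix.mul_assoc _ _ B, ← Units.val_mul, e,
      ← Matrix.mul_assoc]
    exact hneg _ (by omega)

end Cyclic

section Count

variable {F : Type*} [Field F] {n m : ℕ}

/-- Polynomials of degree `n` divisible by `p(X ^ c)` for some `c ≥ 2` and `p` of degree `m`. -/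
def imprimitivePolys (F : Type*) [Field F] (n m : ℕ) : Set F[X] :=
  {f | f ∈ monics F n ∧ ∃ c, 2 ≤ c ∧ ∃ p ∈ monics F m, expand F c p ∣ f}

variable {G H : Subgroup (GL (Fin n) F)}

theorem exists_charpoly_dvd_of_not_isIrr (h : ¬ IsIrr H) :
    ∃ k, 0 < k ∧ k < n ∧ ∀ g ∈ H, ∃ p ∈ monics F k, p ∣ g.1.charpoly := by
  unfold IsIrr at h
  push Not at h
  obtain ⟨W, hW, h0, h1⟩ := h
  refine ⟨Module.finrank F W, Module.finrank_pos_iff.2 (Submodule.nontrivial_iff_ne_bot.2 h0),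
    ?_, fun g hg => ?_⟩
  · simpa using Submodule.finrank_lt h1
  let b := Module.finBasis F W
  let f : (Fin (Module.finrank F W) → F) →ₗ[F] (Fin n → F) := W.subtype ∘ₗ b.equivFun.symm.toLinearMap
  have hf : LinearMap.ker f = ⊥ := by
    rw [LinearMap.ker_eq_bot]
    exact W.injective_subtype.comp b.equivFun.symm.injective
  obtain ⟨l, hl⟩ := f.exists_leftInverse_of_injective hf
  have hL : LinearMap.toMatrix' l * LinearMap.toMatrix' f = 1 := by
    rw [← LinearMap.toMatrix'_comp, hl, LinearMap.toMatrix'_id]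
  refine ⟨_, charpoly_mem_monics (LinearMap.toMatrix' l * g.1 * LinearMap.toMatrix' f),
    charpoly_dvd_of_mul_eq hL ?_⟩
  refine Matrix.ext_of_mulVec_single fun i => ?_
  have hw := hW g hg _ (b.equivFun.symm (Pi.single i 1)).2
  obtain ⟨x, hx⟩ : ∃ x, f x = g.1 *ᵥ f (Pi.single i 1) :=
    ⟨b.equivFun ⟨_, hw⟩, by simp [f]⟩
  have e : l (f x) = x := LinearMap.congr_fun hl x
  simp only [← mulVec_mulVec, LinearMap.toMatrix'_mulVec]
  rw [← hx, e]

variable [Fintype F]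

theorem finite_imprimitivePolys : (imprimitivePolys F n m).Finite :=
  (finite_monics F n).subset fun _ h => h.1

theorem ncard_imprimitivePolys_mul_le (hm : 2 ≤ m) (hmn : m ≤ n) :
    (imprimitivePolys F n m).ncard * Fintype.card F ^ (m - 2) ≤ Fintype.card F ^ (n - 1) := by
  classical
  have hq : 2 ≤ Fintype.card F := Fintype.one_lt_card
  let I := (Finset.Icc 2 n).filter fun c => c * m ≤ n
  have h1 : (imprimitivePolys F n m).ncard ≤
      ∑ c ∈ I, Fintype.card F ^ m * Fintype.card F ^ (n - c * m) := by
    rw [Set.ncard_eq_toFinset_card _ finite_imprimitivePolys]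
    refine (Finset.card_le_card (t := I.biUnion fun c => (mon F m).biUnion fun p =>
      (mon F (p.natDegree * c + (n - c * m))).filter (expand F c p ∣ ·)) ?_).trans
        (Finset.card_biUnion_le.trans (Finset.sum_le_sum fun c hc => ?_))
    · intro f hf
      simp only [Set.Finite.mem_toFinset] at hf
      obtain ⟨hf, c, hc, p, hp, hd⟩ := hf
      have hcm : c * m ≤ n := by
        have := natDegree_le_of_dvd hd hf.1.ne_zero
        rwa [natDegree_expand, hp.2, hf.2, mul_comm] at this
      simp only [Finset.mem_biUnion, Finset.mem_filter, mem_mon, I, Finset.mem_Icc]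
      refine ⟨c, ⟨⟨hc, le_trans (Nat.le_mul_of_pos_right _ (by omega)) hcm⟩, hcm⟩, p, hp, ?_, hd⟩
      rw [hp.2, mul_comm m, Nat.add_sub_cancel' hcm]
      exact hf
    · rw [← card_mon m]
      refine Finset.card_biUnion_le_card_mul _ _ _ fun p hp => ?_
      have hc0 : 0 < c := by
        have := (Finset.mem_Icc.1 (Finset.mem_filter.1 hc).1).1
        omega
      rw [mem_mon] at hp
      exact card_filter_dvd_le ⟨(monic_expand_iff hc0).2 hp.1, natDegree_expand _ _⟩
  have h2 : ∑ c ∈ I, Fintype.card F ^ m * Fintype.card F ^ (n - c * m) <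
      Fintype.card F ^ (n - m + 1) := by
    have hI : ∀ c ∈ I, 2 ≤ c ∧ c * m ≤ n := fun c hc => by
      have h := Finset.mem_filter.1 hc
      exact ⟨(Finset.mem_Icc.1 h.1).1, h.2⟩
    have hinj : Set.InjOn (fun c => m + (n - c * m)) I := by
      intro c hc d hd hcd
      have h1 := hI c hc
      have h2 := hI d hd
      have : c * m = d * m := by simp only at hcd; omega
      exact Nat.eq_of_mul_eq_mul_right (by omega) this
    calc _ = ∑ k ∈ I.image fun c => m + (n - c * m), Fintype.card F ^ k := by
          rw [Finset.sum_image hinj]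
          exact Finset.sum_congr rfl fun c _ => (pow_add _ _ _).symm
      _ < _ := Nat.geomSum_lt hq fun k hk => by
          obtain ⟨c, hc, rfl⟩ := Finset.mem_image.1 hk
          obtain ⟨h1, h2⟩ := hI c hc
          have : 2 * m ≤ c * m := Nat.mul_le_mul_right _ h1
          omega
  calc _ ≤ Fintype.card F ^ (n - m + 1) * Fintype.card F ^ (m - 2) :=
        Nat.mul_le_mul_right _ (h1.trans h2.le)
    _ = _ := by rw [← pow_add]; congr 1; omega

theorem ncard_classPolys_le_of_imprimitive (hG : ContainsSL G) (hm : 2 ≤ m) (hmn : m < n)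
    (hq : 1024 ≤ Fintype.card F ^ (m - 2)) {B : Matrix (Fin n) (Fin m) F}
    {C : Matrix (Fin m) (Fin n) F} (hCB : C * B = 1)
    (h : ∀ g ∈ H, g.1 * B = B * (C * g.1 * B) ∨ C * g.1 * B = 0) :
    ((classPolys G).ncard : ℝ) ≤ 1024 * missed G H := by
  have : Nonempty (Fin m) := ⟨⟨0, by omega⟩⟩
  have h1 := ncard_classPolys_le_missed_add (H := H) hG (k := m) (by omega) hmn
    (E := imprimitivePolys F n m) finite_imprimitivePolys fun x hx => by
      obtain ⟨c, A, hd⟩ := exists_expand_charpoly_dvd hCB h hx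
      rcases Nat.eq_zero_or_pos c with rfl | hc
      · rw [zero_add, expand_one] at hd
        exact Or.inl ⟨_, charpoly_mem_monics A, hd⟩
      · exact Or.inr ⟨charpoly_mem_monics _, c + 1, by omega, _, charpoly_mem_monics A, hd⟩
  have h2 : (imprimitivePolys F n m).ncard * 1024 ≤ (classPolys G).ncard := by
    refine (Nat.mul_le_mul_left _ hq).trans ((ncard_imprimitivePolys_mul_le hm hmn.le).trans ?_)
    obtain ⟨n, rfl⟩ : ∃ k, n = k + 1 := ⟨n - 1, by omega⟩
    rw [ncard_classPolys]
    exact Nat.le_mul_of_pos_left _ ((Set.ncard_pos (Set.toFinite _)).2 constants_nonempty)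
  have h3 : ((imprimitivePolys F n m).ncard : ℝ) * 1024 ≤ (classPolys G).ncard := by
    exact_mod_cast h2
  linarith

theorem ncard_classPolys_le_of_not_isIrr (hG : ContainsSL G)
    (h : ¬ IsIrr H ∨ ¬ IsIrr (transposeSubgroup H)) :
    ((classPolys G).ncard : ℝ) ≤ 512 * missed G H := by
  obtain ⟨k, hk, hkn, hd⟩ :
      ∃ k, 0 < k ∧ k < n ∧ ∀ g ∈ H, ∃ p ∈ monics F k, p ∣ g.1.charpoly := by
    rcases h with h | h
    · exact exists_charpoly_dvd_of_not_isIrr h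
    · obtain ⟨k, hk, hkn, hd⟩ := exists_charpoly_dvd_of_not_isIrr h
      refine ⟨k, hk, hkn, fun g hg => ?_⟩
      have := hd (transposeGL g) (by
        rwa [← transposeSubgroup_transposeSubgroup H, mem_transposeSubgroup] at hg)
      have e : (transposeGL g).1 = g.1ᵀ := rfl
      rwa [e, charpoly_transpose] at this
  simpa using ncard_classPolys_le_missed_add hG hk hkn Set.finite_empty
    fun x hx => Or.inl (hd x hx)

/-- A subgroup not containing `SL` but containing `SL_m` on a direct summand, `m` large,
misses many classes. -/
theorem ncard_classPolys_le_of_tPair (hG : ContainsSL G) (hH : ¬ ContainsSL H) (hm : 3 ≤ m)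
    (hq : 1024 ≤ Fintype.card F ^ (m - 2)) {B : Matrix (Fin n) (Fin m) F}
    {C : Matrix (Fin m) (Fin n) F} (h : TPair H B C) :
    ((classPolys G).ncard : ℝ) ≤ 1024 * missed G H := by
  by_cases hM : IsIrr H ∧ IsIrr (transposeSubgroup H)
  · obtain ⟨k, hmk, hk, B', C', hCB, hg⟩ := exists_imprimitivity h hm hM.1 hM.2 hH
    rw [Fintype.card_fin] at hk
    exact ncard_classPolys_le_of_imprimitive hG (by omega) hk
      (hq.trans (Nat.pow_le_pow_right Fintype.card_pos (by omega))) hCB hg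
  · have := ncard_classPolys_le_of_not_isIrr (H := H) hG (by tauto)
    have h0 : (0 : ℝ) ≤ missed G H := Nat.cast_nonneg _
    linarith

end Count

end BostonShalev

namespace BostonShalev

open Polynomial Matrix

section Transitive

variable {ι κ F : Type*} [Fintype ι] [Fintype κ] [DecidableEq ι] [DecidableEq κ] [Field F]

theorem exists_mul_eq {A B : Matrix ι κ F} (hA : Function.Injective A.mulVec)
    (hB : Function.Injective B.mulVec) : ∃ z : GL ι F, z.1 * A = B := by
  obtain ⟨U, hU⟩ := (LinearMap.range A.mulVecLin).exists_isCompl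
  obtain ⟨W, hW⟩ := (LinearMap.range B.mulVecLin).exists_isCompl
  let e := (LinearEquiv.ofInjective A.mulVecLin hA).symm.trans (LinearEquiv.ofInjective B.mulVecLin hB)
  have hr := e.finrank_eq
  have h1 := Submodule.finrank_add_eq_of_isCompl hU
  have h2 := Submodule.finrank_add_eq_of_isCompl hW
  let e' : U ≃ₗ[F] W := LinearEquiv.ofFinrankEq _ _ (by omega)
  let z := (Submodule.prodEquivOfIsCompl _ _ hU).symm.trans
    ((e.prodCongr e').trans (Submodule.prodEquivOfIsCompl _ _ hW))
  refine ⟨GeneralLinearGroup.toLin.symm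
    (LinearMap.GeneralLinearGroup.ofLinearEquiv z), Matrix.ext_of_mulVec_single fun i => ?_⟩
  rw [← mulVec_mulVec]
  have h3 : ∀ x, (GeneralLinearGroup.toLin.symm
      (LinearMap.GeneralLinearGroup.ofLinearEquiv z)).1 *ᵥ x = z x := by
    intro x
    change LinearMap.toMatrix' _ *ᵥ x = _
    rw [LinearMap.toMatrix'_mulVec]
    rfl
  rw [h3]
  have h4 : (Submodule.prodEquivOfIsCompl _ _ hU).symm (A *ᵥ Pi.single i 1) =
      (⟨A *ᵥ Pi.single i 1, ⟨_, rfl⟩⟩, 0) := by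
    rw [LinearEquiv.symm_apply_eq]; simp
  have h5 : (LinearEquiv.ofInjective A.mulVecLin hA).symm ⟨A *ᵥ Pi.single i 1, ⟨_, rfl⟩⟩ =
      Pi.single i 1 := by
    rw [LinearEquiv.symm_apply_eq]; rfl
  simp only [z, LinearEquiv.trans_apply, h4, LinearEquiv.prodCongr_apply, e, h5]
  simp only [map_zero, Submodule.coe_prodEquivOfIsCompl', Submodule.coe_zero, add_zero]
  rfl

theorem ncard_mul_eq_le [Finite F] (C : Matrix κ κ F) :
    {p : GL ι F × Matrix ι κ F | Function.Injective p.2.mulVec ∧ p.1.1 * p.2 = p.2 * C}.ncard ≤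
      Nat.card (GL ι F) := by
  classical
  have : Finite (GL ι F) := inferInstance
  set S := {p : GL ι F × Matrix ι κ F | Function.Injective p.2.mulVec ∧ p.1.1 * p.2 = p.2 * C}
  rcases S.eq_empty_or_nonempty with h | ⟨⟨a, A⟩, hA, -⟩
  · simp [h]
  choose! z hz using fun (B : Matrix ι κ F) (hB : Function.Injective B.mulVec) =>
    exists_mul_eq (A := A) hA hB
  choose! y hy using fun (B : Matrix ι κ F) (h : ∃ g : GL ι F, g.1 * B = B * C) => h
  rw [← Set.ncard_univ]
  refine Set.ncard_le_ncard_of_injOn (fun p => (y p.2)⁻¹ * p.1 * z p.2) (fun _ _ => trivial) ?_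
    Set.finite_univ
  have key : ∀ p ∈ S, ((y p.2)⁻¹ * p.1 * z p.2).1 * A = p.2 := by
    rintro ⟨g, B⟩ ⟨hB, hg⟩
    rw [Units.val_mul, Units.val_mul, Matrix.mul_assoc, hz B hB, Matrix.mul_assoc]
    have h1 := hy B ⟨g, hg⟩
    simp only at hg ⊢
    rw [hg, ← h1, ← Matrix.mul_assoc, ← Units.val_mul, inv_mul_cancel, Units.val_one,
      Matrix.one_mul]
  rintro ⟨g, B⟩ hp ⟨g', B'⟩ hp' h
  obtain rfl : B = B' := by
    have h1 := key _ hp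
    have h2 := key _ hp'
    simp only at h h1 h2
    rw [← h1, ← h2, h]
  simpa using h

end Transitive

section AnnPoly

variable {F : Type*} [Field F] {n : ℕ}

theorem exists_annPoly (g : Matrix (Fin n) (Fin n) F) (v : Fin n → F) : ∃ f : F[X], f.Monic ∧
    aeval g f *ᵥ v = 0 ∧ ∀ p : F[X], p.degree < f.degree → aeval g p *ᵥ v = 0 → p = 0 := by
  classical
  have hex : ∃ d, ∃ f : F[X], f.Monic ∧ f.natDegree = d ∧ aeval g f *ᵥ v = 0 :=
    ⟨_, g.charpoly, charpoly_monic g, rfl, by rw [aeval_self_charpoly, zero_mulVec]⟩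
  obtain ⟨f, hf, hd, hv⟩ := Nat.find_spec hex
  refine ⟨f, hf, hv, fun p hp hpv => ?_⟩
  by_contra h0
  refine Nat.find_min hex (m := p.natDegree) ?_
    ⟨p * C p.leadingCoeff⁻¹, monic_mul_leadingCoeff_inv h0, ?_, ?_⟩
  · rw [← hd]; exact natDegree_lt_natDegree h0 hp
  · rw [natDegree_mul_C (inv_ne_zero (leadingCoeff_ne_zero.2 h0))]
  · rw [mul_comm, map_mul, ← mulVec_mulVec, hpv, mulVec_zero]

/-- The minimal polynomial of `g` at the vector `v`. -/
noncomputable def annPoly (g : Matrix (Fin n) (Fin n) F) (v : Fin n → F) : F[X] :=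
  (exists_annPoly g v).choose

variable {g : Matrix (Fin n) (Fin n) F} {v : Fin n → F}

theorem annPoly_monic : (annPoly g v).Monic := (exists_annPoly g v).choose_spec.1

theorem aeval_annPoly : aeval g (annPoly g v) *ᵥ v = 0 := (exists_annPoly g v).choose_spec.2.1

theorem eq_zero_of_degree_lt_annPoly {p : F[X]} (h : p.degree < (annPoly g v).degree)
    (hp : aeval g p *ᵥ v = 0) : p = 0 := (exists_annPoly g v).choose_spec.2.2 p h hp

theorem aeval_modByMonic_mulVec {f : F[X]} (hv : aeval g f *ᵥ v = 0) (p : F[X]) :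
    aeval g (p %ₘ f) *ᵥ v = aeval g p *ᵥ v := by
  conv_rhs => rw [← modByMonic_add_div p f]
  rw [map_add, mul_comm f, map_mul, add_mulVec, ← mulVec_mulVec, hv, mulVec_zero, add_zero]

theorem annPoly_dvd {p : F[X]} (hp : aeval g p *ᵥ v = 0) : annPoly g v ∣ p := by
  rw [← modByMonic_eq_zero_iff_dvd annPoly_monic]
  refine eq_zero_of_degree_lt_annPoly (degree_modByMonic_lt _ annPoly_monic) ?_
  rw [aeval_modByMonic_mulVec aeval_annPoly, hp]

theorem annPoly_dvd_charpoly : annPoly g v ∣ g.charpoly :=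
  annPoly_dvd (by rw [aeval_self_charpoly, zero_mulVec])

/-- The matrix with columns `v, g v, …, g ^ (d - 1) v`. -/
def krylov (g : Matrix (Fin n) (Fin n) F) (v : Fin n → F) (d : ℕ) : Matrix (Fin n) (Fin d) F :=
  Matrix.of fun i j => (g ^ j.1 *ᵥ v) i

theorem krylov_mulVec {d : ℕ} (p : degreeLT F d) :
    krylov g v d *ᵥ (fun i => p.1.coeff i) = aeval g p.1 *ᵥ v := by
  ext i
  have hp : aeval g p.1 = ∑ j : Fin d, p.1.coeff j • g ^ j.1 := by
    have h := mem_degreeLT.1 p.2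
    rw [Fin.sum_univ_eq_sum_range (fun j => p.1.coeff j • g ^ j) d]
    by_cases h0 : p.1 = 0
    · simp [h0]
    · exact aeval_eq_sum_range' (by rwa [← natDegree_lt_iff_degree_lt h0] at h) g
  rw [hp, sum_mulVec]
  simp [mulVec, dotProduct, krylov, mul_comm, Finset.sum_apply, smul_mulVec]

variable [Fintype F]

theorem ncard_annPoly_eq_le (f : F[X]) :
    {p : GL (Fin n) F × (Fin n → F) | annPoly p.1.1 p.2 = f}.ncard ≤ Nat.card (GL (Fin n) F) := by
  classical
  set d := f.natDegree
  let Q : Matrix (Fin d) (Fin d) F := Matrix.of fun i j => (X ^ (j.1 + 1) %ₘ f : F[X]).coeff i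
  refine le_trans (Set.ncard_le_ncard_of_injOn (fun p => (p.1, krylov p.1.1 p.2 d)) ?_ ?_
    (Set.toFinite _)) (ncard_mul_eq_le Q)
  · rintro ⟨g, v⟩ (hf : annPoly g.1 v = f)
    have hm : f.Monic := hf ▸ annPoly_monic
    have hdeg : f.degree = d := degree_eq_natDegree hm.ne_zero
    refine ⟨?_, Matrix.ext_of_mulVec_single fun j => ?_⟩
    · rw [← coe_mulVecLin, ← LinearMap.ker_eq_bot, LinearMap.ker_eq_bot']
      intro w hw
      let p := (degreeLTEquiv F d).symm w
      have hpw : (fun i : Fin d => p.1.coeff i) = w := (degreeLTEquiv F d).apply_symm_apply w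
      have h1 : p.1 = 0 := by
        refine eq_zero_of_degree_lt_annPoly (g := g.1) (v := v) ?_ ?_
        · rw [hf, hdeg]; exact mem_degreeLT.1 p.2
        · rw [← krylov_mulVec, hpw]; exact hw
      rw [← hpw, h1]; ext; simp
    · rw [← mulVec_mulVec, ← mulVec_mulVec]
      have h1 : Q *ᵥ Pi.single j 1 = fun i : Fin d => (X ^ (j.1 + 1) %ₘ f : F[X]).coeff i := by
        ext i; simp [Q]
      have h2 : krylov g.1 v d *ᵥ Pi.single j 1 = g.1 ^ j.1 *ᵥ v := by
        ext i; simp [krylov]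
      have h3 : (X ^ (j.1 + 1) %ₘ f : F[X]) ∈ degreeLT F d := by
        rw [mem_degreeLT, ← hdeg]; exact degree_modByMonic_lt _ hm
      rw [h1, h2, krylov_mulVec ⟨_, h3⟩, aeval_modByMonic_mulVec (hf ▸ aeval_annPoly)]
      simp [pow_succ']
  · rintro ⟨g, v⟩ (hf : annPoly g.1 v = f) ⟨g', v'⟩ (hf' : annPoly g'.1 v' = f) h
    simp only [Prod.mk.injEq] at h
    obtain ⟨rfl, h⟩ := h
    simp only [Prod.mk.injEq, true_and]
    have hm : f.Monic := hf ▸ annPoly_monic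
    rcases Nat.eq_zero_or_pos d with h0 | h0
    · have h1 : f = 1 := hm.natDegree_eq_zero.1 h0
      have h2 := aeval_annPoly (g := g.1) (v := v)
      have h3 := aeval_annPoly (g := g.1) (v := v')
      rw [hf, h1, map_one, one_mulVec] at h2
      rw [hf', h1, map_one, one_mulVec] at h3
      rw [h2, h3]
    · ext i
      have := congrFun (congrFun h i) ⟨0, h0⟩
      simpa [krylov] using this

end AnnPoly

end BostonShalev

namespace BostonShalev

open Polynomial Matrix

section Nice

variable {F : Type*} [Field F] {n : ℕ}

theorem ncard_mul_le_of_annPoly [Fintype F] (S : Finset F[X]) (Y : Set (GL (Fin n) F)) {t c : ℕ}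
    (hY : ∀ g ∈ Y, t ≤ c * {v | annPoly g.1 v ∈ S}.ncard) :
    Y.ncard * t ≤ c * (S.card * Nat.card (GL (Fin n) F)) := by
  classical
  have h1 : {p : GL (Fin n) F × (Fin n → F) | annPoly p.1.1 p.2 ∈ S}.ncard ≤
      Nat.card (GL (Fin n) F) * S.card := by
    have hc : ∀ f ∈ (S : Set F[X]), {p : GL (Fin n) F × (Fin n → F) |
        p ∈ {p : GL (Fin n) F × (Fin n → F) | annPoly p.1.1 p.2 ∈ S} ∧
          annPoly p.1.1 p.2 = f}.ncard ≤ Nat.card (GL (Fin n) F) := by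
      intro f _
      refine le_trans (Set.ncard_le_ncard ?_ (Set.toFinite _)) (ncard_annPoly_eq_le f)
      rintro p ⟨-, hp⟩
      exact hp
    have := ncard_le_mul_ncard S.finite_toSet
      (fun p : GL (Fin n) F × (Fin n → F) => annPoly p.1.1 p.2) (fun a ha => ha) _
      (Set.toFinite {p : GL (Fin n) F × (Fin n → F) | annPoly p.1.1 p.2 ∈ S}) hc
    rwa [Set.ncard_coe_finset] at this
  rw [ncard_prod_eq_sum fun (g : GL (Fin n) F) v => annPoly g.1 v ∈ S] at h1
  rw [mul_comm S.card]
  refine le_trans ?_ (Nat.mul_le_mul_left c h1)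
  rw [Finset.mul_sum, mul_comm, ← sum_ite_const]
  refine Finset.sum_le_sum fun g _ => ?_
  split_ifs with hg
  · exact hY g hg
  · exact Nat.zero_le _

variable [Fintype F]

theorem card_biUnion_mon_lt [DecidableEq F] (k : ℕ) :
    ((Finset.range k).biUnion fun d => mon F d).card < Fintype.card F ^ k := by
  refine lt_of_le_of_lt Finset.card_biUnion_le ?_
  simp only [card_mon]
  exact Nat.geomSum_lt Fintype.one_lt_card (by simp)

/-- At least half of the vectors generate, under `g`, a subspace of codimension at most `D`. -/
def IsNice (D : ℕ) (g : GL (Fin n) F) : Prop :=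
  Fintype.card F ^ n ≤ 2 * {v | n ≤ (annPoly g.1 v).natDegree + D}.ncard

theorem ncard_not_isNice_mul_le (D : ℕ) :
    {g : GL (Fin n) F | ¬IsNice D g}.ncard * Fintype.card F ^ n ≤
      2 * (Fintype.card F ^ (n - D) * Nat.card (GL (Fin n) F)) := by
  classical
  refine le_trans (ncard_mul_le_of_annPoly ((Finset.range (n - D)).biUnion fun d => mon F d) _ ?_)
    (Nat.mul_le_mul_left 2 (Nat.mul_le_mul_right _ (card_biUnion_mon_lt _).le))
  intro g (hg : ¬(Fintype.card F ^ n ≤ _))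
  have h1 := Set.ncard_add_ncard_compl {v | n ≤ (annPoly g.1 v).natDegree + D}
  have h2 : {v | n ≤ (annPoly g.1 v).natDegree + D}ᶜ ⊆
      {v | annPoly g.1 v ∈ (Finset.range (n - D)).biUnion fun d => mon F d} := by
    intro v (hv : ¬ n ≤ (annPoly g.1 v).natDegree + D)
    refine Finset.mem_biUnion.2 ⟨_, Finset.mem_range.2 ?_, mem_mon.2 ⟨annPoly_monic, rfl⟩⟩
    omega
  have h3 := Set.ncard_le_ncard h2 (Set.toFinite _)
  have h4 : Nat.card (Fin n → F) = Fintype.card F ^ n := by simp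
  omega

theorem ncard_isNice_charpoly_mul_le (D : ℕ) (χ : F[X]) :
    {g : GL (Fin n) F | IsNice D g ∧ g.1.charpoly = χ}.ncard * Fintype.card F ^ n ≤
      2 * (Fintype.card F ^ (D + 1) * Nat.card (GL (Fin n) F)) := by
  classical
  refine le_trans (ncard_mul_le_of_annPoly
    (((Finset.range (D + 1)).biUnion fun d => mon F d).image fun k => χ /ₘ k) _ ?_)
    (Nat.mul_le_mul_left 2 (Nat.mul_le_mul_right _
      (Finset.card_image_le.trans (card_biUnion_mon_lt _).le)))
  rintro g ⟨hg, rfl⟩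
  refine le_trans hg (Nat.mul_le_mul_left 2 (Set.ncard_le_ncard ?_ (Set.toFinite _)))
  intro v (hv : n ≤ _)
  obtain ⟨k, hk⟩ := annPoly_dvd_charpoly (g := g.1) (v := v)
  have hm : k.Monic := annPoly_monic.of_mul_monic_left (hk ▸ charpoly_monic _)
  have hd := congrArg natDegree hk
  rw [annPoly_monic.natDegree_mul hm, charpoly_natDegree_eq_dim, Fintype.card_fin] at hd
  refine Finset.mem_image.2 ⟨k, Finset.mem_biUnion.2
    ⟨k.natDegree, Finset.mem_range.2 (by omega), mem_mon.2 ⟨hm, rfl⟩⟩, ?_⟩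
  rw [hk]
  rw [mul_comm]
  exact mul_divByMonic_cancel_left _ hm

theorem ncard_derangements_mul_le (G H : Subgroup (GL (Fin n) F)) (D : ℕ) :
    (derangements G H).ncard * Fintype.card F ^ n ≤
      2 * ((Fintype.card F ^ (n - D) + missed G H * Fintype.card F ^ (D + 1)) *
        Nat.card (GL (Fin n) F)) := by
  classical
  set P := {f : F[X] | ∃ g ∈ derangements G H, g.1.charpoly = f}
  have hP : P.Finite := (Set.toFinite ((fun g : GL (Fin n) F => g.1.charpoly) '' derangements G H))
  have h1 : {g | g ∈ derangements G H ∧ IsNice D g}.ncard * Fintype.card F ^ n ≤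
      P.ncard * (2 * (Fintype.card F ^ (D + 1) * Nat.card (GL (Fin n) F))) := by
    rcases Nat.eq_zero_or_pos (Fintype.card F ^ n) with h0 | h0
    · simp [h0]
    have hc : ∀ f ∈ P, {g | g ∈ {g | g ∈ derangements G H ∧ IsNice D g} ∧ g.1.charpoly = f}.ncard ≤
        2 * (Fintype.card F ^ (D + 1) * Nat.card (GL (Fin n) F)) / Fintype.card F ^ n := by
      intro f _
      refine (Nat.le_div_iff_mul_le h0).2 (le_trans (Nat.mul_le_mul_right _
        (Set.ncard_le_ncard ?_ (Set.toFinite _))) (ncard_isNice_charpoly_mul_le D f))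
      rintro g ⟨hg, h⟩
      exact ⟨hg.2, h⟩
    have := ncard_le_mul_ncard hP (fun g : GL (Fin n) F => g.1.charpoly)
      (fun g hg => ⟨g, hg.1, rfl⟩) _
      (Set.toFinite {g | g ∈ derangements G H ∧ IsNice D g}) hc
    refine le_trans (Nat.mul_le_mul_right _ this) ?_
    rw [mul_comm (_ / _), mul_assoc]
    exact Nat.mul_le_mul_left _ (Nat.div_mul_le_self _ _)
  have h2 : (derangements G H).ncard ≤ {g | g ∈ derangements G H ∧ IsNice D g}.ncard +
      {g : GL (Fin n) F | ¬IsNice D g}.ncard := by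
    refine le_trans (Set.ncard_le_ncard ?_ (Set.toFinite _)) (Set.ncard_union_le _ _)
    intro g hg
    by_cases h : IsNice D g
    · exact Or.inl ⟨hg, h⟩
    · exact Or.inr h
  have h3 := ncard_not_isNice_mul_le (F := F) (n := n) D
  have h4 : P.ncard ≤ missed G H := ncard_charpoly_derangements_le
  have h5 := Nat.mul_le_mul_right (2 * (Fintype.card F ^ (D + 1) * Nat.card (GL (Fin n) F))) h4
  have h6 := Nat.mul_le_mul_right (Fintype.card F ^ n) h2
  linarith

end Nice

end BostonShalev

namespace BostonShalev

open Polynomial Matrix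

section Inclusions

variable (F : Type*) [Field F] (K m : ℕ)

/-- The inclusion of the first `K` coordinates. -/
def inclL : Matrix (Fin (K + m)) (Fin K) F :=
  (1 : Matrix (Fin (K + m)) (Fin (K + m)) F).submatrix id (Fin.castAdd m)

/-- The inclusion of the last `m` coordinates. -/
def inclR : Matrix (Fin (K + m)) (Fin m) F :=
  (1 : Matrix (Fin (K + m)) (Fin (K + m)) F).submatrix id (Fin.natAdd K)

theorem transpose_inclL_mul_inclL : (inclL F K m)ᵀ * inclL F K m = 1 := by
  rw [inclL, transpose_submatrix, transpose_one,
    ← submatrix_mul _ _ _ id _ Function.bijective_id, Matrix.one_mul,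
    submatrix_one _ (Fin.castAdd_injective K m)]

theorem transpose_inclR_mul_inclR : (inclR F K m)ᵀ * inclR F K m = 1 := by
  rw [inclR, transpose_submatrix, transpose_one,
    ← submatrix_mul _ _ _ id _ Function.bijective_id, Matrix.one_mul,
    submatrix_one _ (Fin.natAdd_injective m K)]

theorem transpose_inclL_mul_inclR : (inclL F K m)ᵀ * inclR F K m = 0 := by
  rw [inclR, inclL, transpose_submatrix, transpose_one,
    ← submatrix_mul _ _ _ id _ Function.bijective_id, Matrix.one_mul]
  ext i j
  have : Fin.castAdd m i ≠ Fin.natAdd K j := by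
    intro h
    have := congrArg Fin.val h
    simp at this
    omega
  simp [one_apply_ne this]

theorem transpose_inclR_mul_inclL : (inclR F K m)ᵀ * inclL F K m = 0 := by
  have := congrArg transpose (transpose_inclL_mul_inclR F K m)
  simpa using this

theorem inclL_mul_add_inclR_mul :
    inclL F K m * (inclL F K m)ᵀ + inclR F K m * (inclR F K m)ᵀ = 1 := by
  ext i j
  rw [Matrix.add_apply, mul_apply, mul_apply]
  refine (Fin.sum_univ_add fun k : Fin (K + m) =>
    (1 : Matrix _ _ F) i k * (1 : Matrix _ _ F) j k).symm.trans ?_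
  simp [one_apply]

end Inclusions

section Fix

variable {F : Type*} [Field F] {K m n : ℕ}

/-- The number of vectors fixed by a matrix. -/
noncomputable def fixCard (A : Matrix (Fin n) (Fin n) F) : ℕ := {v | A *ᵥ v = v}.ncard

variable [Fintype F]

theorem ncard_mul_eq_self_le (A : Matrix (Fin n) (Fin n) F) :
    {B : Matrix (Fin n) (Fin K) F | A * B = B}.ncard ≤ fixCard A ^ K := by
  have h : fixCard A ^ K = Nat.card (Fin K → {v | A *ᵥ v = v}) := by
    rw [Nat.card_fun]; simp [fixCard]
  rw [h, ← Nat.card_coe_set_eq]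
  refine Nat.card_le_card_of_injective
    (fun B j => ⟨fun i => B.1 i j, ?_⟩) ?_
  · have := congrArg (fun M : Matrix (Fin n) (Fin K) F => fun i => M i j) B.2
    exact this
  · intro B B' h
    ext i j
    exact congrFun (congrArg Subtype.val (congrFun h j)) i

theorem fixCard_conj_le {A A' : Matrix (Fin (K + m)) (Fin (K + m)) F} (hA : A' * A = 1)
    (x : Matrix (Fin m) (Fin m) F) :
    fixCard (A * blockHom (transpose_inclR_mul_inclR F K m) x * A') ≤
      Fintype.card F ^ K * fixCard x := by
  have h : Fintype.card F ^ K * fixCard x =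
      ((Set.univ : Set (Fin K → F)) ×ˢ {v | x *ᵥ v = v}).ncard := by
    rw [Set.ncard_prod, Set.ncard_univ]; simp [fixCard]
  have hA' : A * A' = 1 := mul_eq_one_comm.1 hA
  rw [h]
  refine Set.ncard_le_ncard_of_injOn
    (fun v => ((inclL F K m)ᵀ *ᵥ (A' *ᵥ v), (inclR F K m)ᵀ *ᵥ (A' *ᵥ v))) ?_ ?_ (Set.toFinite _)
  · intro v (hv : _ *ᵥ v = v)
    refine ⟨trivial, ?_⟩
    have h1 := congrArg (A' *ᵥ ·) hv
    simp only [mulVec_mulVec, ← Matrix.mul_assoc, hA, Matrix.one_mul] at h1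
    have h2 := congrArg ((inclR F K m)ᵀ *ᵥ ·) h1
    simp only [mulVec_mulVec, ← Matrix.mul_assoc] at h2
    rw [mul_blockHom] at h2
    change x *ᵥ _ = _
    simp only [mulVec_mulVec]
    rw [← Matrix.mul_assoc]
    exact h2
  · intro v _ v' _ h
    simp only [Prod.mk.injEq] at h
    have h1 : A' *ᵥ v = A' *ᵥ v' := by
      rw [← one_mulVec (A' *ᵥ v), ← one_mulVec (A' *ᵥ v'), ← inclL_mul_add_inclR_mul, add_mulVec,
        add_mulVec]
      simp only [← mulVec_mulVec _ (inclL F K m), ← mulVec_mulVec _ (inclR F K m), h.1, h.2]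
    have h2 := congrArg (A *ᵥ ·) h1
    simpa [mulVec_mulVec, hA'] using h2

open scoped Classical in
theorem ncard_lt_fixCard_mul_le (t : ℕ) :
    {s : GL (Fin m) F | t < fixCard s.1}.ncard * t ≤ 2 * Nat.card (GL (Fin m) F) := by
  have h := ncard_mul_le_of_annPoly ({1, X - C 1} : Finset F[X])
    {s : GL (Fin m) F | t < fixCard s.1} (t := t) (c := 1) ?_
  · rw [one_mul] at h
    exact h.trans (Nat.mul_le_mul_right _ Finset.card_le_two)
  · intro s (hs : t < fixCard s.1)
    rw [one_mul]
    refine hs.le.trans (Set.ncard_le_ncard ?_ (Set.toFinite _))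
    intro v (hv : s.1 *ᵥ v = v)
    have hd : annPoly s.1 v ∣ X - C 1 := annPoly_dvd (by simp [sub_mulVec, hv])
    have hm := annPoly_monic (g := s.1) (v := v)
    change annPoly s.1 v ∈ ({1, X - C 1} : Finset F[X])
    rw [Finset.mem_insert, Finset.mem_singleton]
    rcases (irreducible_X_sub_C (1 : F)).dvd_iff.1 hd with h | h
    · exact Or.inl (hm.isUnit_iff.1 h)
    · exact Or.inr (eq_of_monic_of_associated hm (monic_X_sub_C 1) h.symm)

theorem ncard_lt_fixCard_transpose_mul_le (t : ℕ) :
    {s : GL (Fin m) F | t < fixCard s.1ᵀ}.ncard * t ≤ 2 * Nat.card (GL (Fin m) F) := by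
  refine le_trans (Nat.mul_le_mul_right _ ?_) (ncard_lt_fixCard_mul_le t)
  refine Set.ncard_le_ncard_of_injOn transposeGL (fun s hs => hs) ?_ (Set.toFinite _)
  intro s _ s' _ h
  rw [← transposeGL_transposeGL s, h, transposeGL_transposeGL]

theorem card_le_mul_ncard_det_eq_one : Nat.card (GL (Fin m) F) ≤
    Fintype.card F * {s : GL (Fin m) F | s.1.det = 1}.ncard := by
  have h := card_mul_constants (G := (⊤ : Subgroup (GL (Fin m) F))) le_top
  have h1 : Nat.card (⊤ : Subgroup (GL (Fin m) F)) = Nat.card (GL (Fin m) F) :=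
    Subgroup.card_top
  rw [← h1, h]
  refine Nat.mul_le_mul ?_ ?_
  · rw [← Nat.card_eq_fintype_card, ← Set.ncard_univ]
    exact Set.ncard_le_ncard (Set.subset_univ _) (Set.toFinite _)
  · rw [← Nat.card_coe_set_eq]
    refine Nat.card_le_card_of_injective (fun x => ⟨SpecialLinearGroup.toGL x, x.2⟩) ?_
    intro x y h
    have := congrArg (fun z => z.1.1) h
    exact Subtype.ext this

theorem card_le_mul_ncard_few_fixed : Nat.card (GL (Fin m) F) ≤ 2 * Fintype.card F *
    {s : GL (Fin m) F | s.1.det = 1 ∧ fixCard s.1 ≤ 8 * Fintype.card F ∧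
      fixCard s.1ᵀ ≤ 8 * Fintype.card F}.ncard := by
  have h1 := ncard_lt_fixCard_mul_le (F := F) (m := m) (8 * Fintype.card F)
  have h2 := ncard_lt_fixCard_transpose_mul_le (F := F) (m := m) (8 * Fintype.card F)
  have h3 := card_le_mul_ncard_det_eq_one (F := F) (m := m)
  set S := {s : GL (Fin m) F | s.1.det = 1 ∧ fixCard s.1 ≤ 8 * Fintype.card F ∧
      fixCard s.1ᵀ ≤ 8 * Fintype.card F}
  have h4 : {s : GL (Fin m) F | s.1.det = 1}.ncard ≤ S.ncard +
      ({s : GL (Fin m) F | 8 * Fintype.card F < fixCard s.1}.ncard +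
        {s : GL (Fin m) F | 8 * Fintype.card F < fixCard s.1ᵀ}.ncard) := by
    refine le_trans (Set.ncard_le_ncard (t := S ∪ ({s : GL (Fin m) F |
      8 * Fintype.card F < fixCard s.1} ∪ {s : GL (Fin m) F | 8 * Fintype.card F < fixCard s.1ᵀ}))
      ?_ (Set.toFinite _)) ((Set.ncard_union_le _ _).trans
        (Nat.add_le_add_left (Set.ncard_union_le _ _) _))
    intro s (hs : s.1.det = 1)
    rcases le_or_gt (fixCard s.1) (8 * Fintype.card F) with h | h
    · rcases le_or_gt (fixCard s.1ᵀ) (8 * Fintype.card F) with h' | h'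
      · exact Or.inl ⟨hs, h, h'⟩
      · exact Or.inr (Or.inr h')
    · exact Or.inr (Or.inl h)
  have h5 := Nat.mul_le_mul_left (Fintype.card F) h4
  nlinarith

end Fix

end BostonShalev

namespace BostonShalev

open Polynomial Matrix

variable {F : Type*} [Field F] {K m n : ℕ}

theorem det_conj_eq (z g : GL (Fin n) F) : (z * g * z⁻¹).1.det = g.1.det := by
  have : GeneralLinearGroup.det (z * g * z⁻¹) = GeneralLinearGroup.det g := by simp
  exact congrArg Units.val this

/-- Elements acting trivially on a `K`-dimensional direct summand. -/
def FixesBlock (K : ℕ) (g : GL (Fin n) F) : Prop :=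
  ∃ (B : Matrix (Fin n) (Fin K) F) (C : Matrix (Fin K) (Fin n) F),
    C * B = 1 ∧ g.1 * B = B ∧ C * g.1 = C

theorem FixesBlock.conj {g : GL (Fin n) F} (h : FixesBlock K g) (x : GL (Fin n) F) :
    FixesBlock K (x * g * x⁻¹) := by
  obtain ⟨B, C, h1, h2, h3⟩ := h
  have hx : (x⁻¹).1 * x.1 = 1 := by rw [← Units.val_mul, inv_mul_cancel, Units.val_one]
  refine ⟨x.1 * B, C * (x⁻¹).1, conj_mul_eq_one h1 x, ?_, ?_⟩
  · simp only [Units.val_mul, Matrix.mul_assoc]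
    rw [← Matrix.mul_assoc _ x.1 B, hx, Matrix.one_mul, h2]
  · simp only [Units.val_mul, Matrix.mul_assoc]
    rw [← Matrix.mul_assoc _ x.1, hx, Matrix.one_mul, ← Matrix.mul_assoc, h3]

theorem eq_of_fixes_inclL {x : Matrix (Fin (K + m)) (Fin (K + m)) F}
    (h : x * inclL F K m = inclL F K m) (h' : (inclL F K m)ᵀ * x = (inclL F K m)ᵀ) :
    x = blockHom (transpose_inclR_mul_inclR F K m) ((inclR F K m)ᵀ * x * inclR F K m) := by
  set E := inclL F K m
  set J := inclR F K m
  have h1 : E * Eᵀ + J * Jᵀ = 1 := inclL_mul_add_inclR_mul F K m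
  have hJ : Jᵀ * J = 1 := transpose_inclR_mul_inclR F K m
  have h3 : Eᵀ * J = 0 := transpose_inclL_mul_inclR F K m
  have h4 : Jᵀ * E = 0 := transpose_inclR_mul_inclL F K m
  have hx : x * J = J * (Jᵀ * x * J) := by
    calc x * J = (E * Eᵀ + J * Jᵀ) * (x * J) := by rw [h1, Matrix.one_mul]
      _ = E * (Eᵀ * x * J) + J * (Jᵀ * x * J) := by
        simp only [Matrix.add_mul, Matrix.mul_assoc]
      _ = _ := by rw [h', h3, Matrix.mul_zero, zero_add]
  calc x = x * (E * Eᵀ + J * Jᵀ) := by rw [h1, Matrix.mul_one]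
    _ = E * Eᵀ + J * (Jᵀ * x * J) * Jᵀ := by
      rw [Matrix.mul_add, ← Matrix.mul_assoc, ← Matrix.mul_assoc, h, hx]
    _ = 1 + J * (Jᵀ * x * J - 1) * Jᵀ := by
      rw [Matrix.mul_sub, Matrix.sub_mul, Matrix.mul_one, ← h1]; abel

theorem fixesBlock_conj (z : GL (Fin (K + m)) F) (s : GL (Fin m) F) :
    FixesBlock K (z * blockGL (transpose_inclR_mul_inclR F K m) s * z⁻¹) := by
  refine FixesBlock.conj ⟨inclL F K m, (inclL F K m)ᵀ, transpose_inclL_mul_inclL F K m, ?_, ?_⟩ z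
  · rw [coe_blockGL, Matrix.add_mul, Matrix.one_mul, Matrix.mul_assoc,
      transpose_inclR_mul_inclL, Matrix.mul_zero, add_zero]
  · rw [coe_blockGL, Matrix.mul_add, Matrix.mul_one, Matrix.mul_assoc, ← Matrix.mul_assoc _ (inclR F K m),
      transpose_inclL_mul_inclR, Matrix.zero_mul, add_zero]

variable [Fintype F]

theorem ncard_fibre_le (g : GL (Fin (K + m)) F) (B : Matrix (Fin (K + m)) (Fin K) F)
    (C : Matrix (Fin K) (Fin (K + m)) F) :
    {p : GL (Fin (K + m)) F × GL (Fin m) F |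
      p.1 * blockGL (transpose_inclR_mul_inclR F K m) p.2 * p.1⁻¹ = g ∧
      p.1.1 * inclL F K m = B ∧ (inclL F K m)ᵀ * (p.1⁻¹).1 = C}.ncard ≤ Nat.card (GL (Fin m) F) := by
  classical
  set A := {p : GL (Fin (K + m)) F × GL (Fin m) F |
      p.1 * blockGL (transpose_inclR_mul_inclR F K m) p.2 * p.1⁻¹ = g ∧
      p.1.1 * inclL F K m = B ∧ (inclL F K m)ᵀ * (p.1⁻¹).1 = C}
  rcases A.eq_empty_or_nonempty with h | ⟨⟨z₀, s₀⟩, h0, h0B, h0C⟩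
  · simp [h]
  set E := inclL F K m
  set J := inclR F K m
  have hE : ∀ p ∈ A, (z₀⁻¹ * p.1).1 * E = E ∧ Eᵀ * (z₀⁻¹ * p.1).1 = Eᵀ := by
    rintro ⟨z, s⟩ ⟨-, hB, hC⟩
    simp only at hB hC h0B h0C
    have e1 : (z₀⁻¹).1 * z₀.1 = 1 := by rw [← Units.val_mul, inv_mul_cancel, Units.val_one]
    have e2 : (z⁻¹).1 * z.1 = 1 := by rw [← Units.val_mul, inv_mul_cancel, Units.val_one]
    constructor
    · rw [Units.val_mul, Matrix.mul_assoc, hB, ← h0B, ← Matrix.mul_assoc, e1, Matrix.one_mul]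
    · rw [Units.val_mul, ← Matrix.mul_assoc, h0C, ← hC, Matrix.mul_assoc, e2, Matrix.mul_one]
  have hx : ∀ p ∈ A, (z₀⁻¹ * p.1).1 = blockHom (transpose_inclR_mul_inclR F K m)
      (Jᵀ * (z₀⁻¹ * p.1).1 * J) := fun p hp => eq_of_fixes_inclL (hE p hp).1 (hE p hp).2
  have hr : (Set.range (Units.val : GL (Fin m) F → _)).ncard = Nat.card (GL (Fin m) F) := by
    rw [← Set.image_univ, Set.ncard_image_of_injective _ Units.val_injective, Set.ncard_univ]
  rw [← hr]
  refine Set.ncard_le_ncard_of_injOn (fun p => Jᵀ * (z₀⁻¹ * p.1).1 * J) ?_ ?_ (Set.toFinite _)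
  · intro p hp
    have hu : IsUnit (Jᵀ * (z₀⁻¹ * p.1).1 * J) := by
      rw [isUnit_iff_isUnit_det, ← det_blockHom (transpose_inclR_mul_inclR F K m),
        ← isUnit_iff_isUnit_det, ← hx p hp]
      exact Units.isUnit _
    exact ⟨hu.unit, rfl⟩
  · rintro ⟨z, s⟩ hp ⟨z', s'⟩ hp' h
    have h1 : z₀⁻¹ * z = z₀⁻¹ * z' := by
      refine Units.ext ?_
      rw [hx _ hp, hx _ hp']
      simp only at h ⊢
      rw [h]
    obtain rfl := mul_left_cancel h1
    have h2 := hp.1.trans hp'.1.symm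
    simp only [mul_left_inj, mul_right_inj] at h2
    rw [blockGL_injective _ h2]

theorem ncard_fibre_few_fixed_le (g : GL (Fin (K + m)) F) {t : ℕ} :
    {p : GL (Fin (K + m)) F × GL (Fin m) F | (fixCard p.2.1 ≤ t ∧ fixCard p.2.1ᵀ ≤ t) ∧
      p.1 * blockGL (transpose_inclR_mul_inclR F K m) p.2 * p.1⁻¹ = g}.ncard ≤
      Nat.card (GL (Fin m) F) * (Fintype.card F ^ K * t) ^ (2 * K) := by
  classical
  set A := {p : GL (Fin (K + m)) F × GL (Fin m) F | (fixCard p.2.1 ≤ t ∧ fixCard p.2.1ᵀ ≤ t) ∧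
      p.1 * blockGL (transpose_inclR_mul_inclR F K m) p.2 * p.1⁻¹ = g}
  rcases A.eq_empty_or_nonempty with h | ⟨⟨z₀, s₀⟩, ⟨ht, ht'⟩, h0⟩
  · simp [h]
  simp only at ht ht' h0
  set E := inclL F K m
  set J := inclR F K m
  have hinv : ∀ z : GL (Fin (K + m)) F, (z⁻¹).1 * z.1 = 1 := fun z => by
    rw [← Units.val_mul, inv_mul_cancel, Units.val_one]
  have hinv' : ∀ z : GL (Fin (K + m)) F, z.1 * (z⁻¹).1 = 1 := fun z => by
    rw [← Units.val_mul, mul_inv_cancel, Units.val_one]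
  have hg : fixCard g.1 ≤ Fintype.card F ^ K * t := by
    rw [← h0]
    exact (fixCard_conj_le (hinv z₀) s₀.1).trans (Nat.mul_le_mul_left _ ht)
  have hg' : fixCard g.1ᵀ ≤ Fintype.card F ^ K * t := by
    have e : (z₀ * blockGL (transpose_inclR_mul_inclR F K m) s₀ * z₀⁻¹).1ᵀ =
        (z₀⁻¹).1ᵀ * blockHom (transpose_inclR_mul_inclR F K m) s₀.1ᵀ * z₀.1ᵀ := by
      simp [Units.val_mul, coe_blockGL, blockHom_apply, transpose_mul, Matrix.mul_assoc]
    rw [← h0, e]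
    refine (fixCard_conj_le ?_ s₀.1ᵀ).trans (Nat.mul_le_mul_left _ ht')
    rw [← transpose_mul, hinv, transpose_one]
  have hT : ({B : Matrix (Fin (K + m)) (Fin K) F | g.1 * B = B} ×ˢ
      {C : Matrix (Fin K) (Fin (K + m)) F | C * g.1 = C}).ncard ≤
        (Fintype.card F ^ K * t) ^ (2 * K) := by
    rw [Set.ncard_prod, two_mul, pow_add]
    refine Nat.mul_le_mul ((ncard_mul_eq_self_le _).trans (Nat.pow_le_pow_left hg _))
      (le_trans ?_ ((ncard_mul_eq_self_le (K := K) _).trans (Nat.pow_le_pow_left hg' _)))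
    refine Set.ncard_le_ncard_of_injOn transpose ?_ (fun _ _ _ _ h => transpose_injective h)
      (Set.toFinite _)
    intro C (hC : C * g.1 = C)
    change g.1ᵀ * Cᵀ = Cᵀ
    rw [← transpose_mul, hC]
  refine le_trans (ncard_le_mul_ncard (Set.toFinite _)
    (fun p : GL (Fin (K + m)) F × GL (Fin m) F => (p.1.1 * E, Eᵀ * (p.1⁻¹).1)) ?_
      (Nat.card (GL (Fin m) F)) (Set.toFinite A) ?_) (Nat.mul_le_mul_left _ hT)
  · rintro ⟨z, s⟩ ⟨-, rfl⟩
    constructor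
    · change (z * _ * z⁻¹).1 * (z.1 * E) = z.1 * E
      rw [Units.val_mul, Units.val_mul, Matrix.mul_assoc, ← Matrix.mul_assoc _ z.1, hinv,
        Matrix.one_mul, Matrix.mul_assoc, coe_blockGL, Matrix.add_mul, Matrix.one_mul,
        Matrix.mul_assoc, transpose_inclR_mul_inclL, Matrix.mul_zero, add_zero]
    · change Eᵀ * (z⁻¹).1 * (z * _ * z⁻¹).1 = Eᵀ * (z⁻¹).1
      rw [Units.val_mul, Units.val_mul, ← Matrix.mul_assoc, ← Matrix.mul_assoc,
        Matrix.mul_assoc Eᵀ, hinv, Matrix.mul_one, coe_blockGL, Matrix.mul_add, Matrix.mul_one,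
        Matrix.mul_assoc J, ← Matrix.mul_assoc Eᵀ, transpose_inclL_mul_inclR, Matrix.zero_mul,
        add_zero]
  · rintro ⟨B, C⟩ -
    refine le_trans (Set.ncard_le_ncard ?_ (Set.toFinite _)) (ncard_fibre_le g B C)
    rintro p ⟨⟨-, hp⟩, h⟩
    exact ⟨hp, (Prod.ext_iff.1 h).1, (Prod.ext_iff.1 h).2⟩

theorem card_le_mul_ncard_fixesBlock : Nat.card (GL (Fin (K + m)) F) ≤
    2 * Fintype.card F * (Fintype.card F ^ K * (8 * Fintype.card F)) ^ (2 * K) *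
      {g : GL (Fin (K + m)) F | g.1.det = 1 ∧ FixesBlock K g}.ncard := by
  classical
  set S := {s : GL (Fin m) F | s.1.det = 1 ∧ fixCard s.1 ≤ 8 * Fintype.card F ∧
      fixCard s.1ᵀ ≤ 8 * Fintype.card F}
  have h1 : Nat.card (GL (Fin m) F) ≤ 2 * Fintype.card F * S.ncard := card_le_mul_ncard_few_fixed
  have h2 : ((Set.univ : Set (GL (Fin (K + m)) F)) ×ˢ S).ncard ≤
      Nat.card (GL (Fin m) F) * (Fintype.card F ^ K * (8 * Fintype.card F)) ^ (2 * K) *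
      {g : GL (Fin (K + m)) F | g.1.det = 1 ∧ FixesBlock K g}.ncard := by
    refine ncard_le_mul_ncard (Set.toFinite _)
      (fun p => p.1 * blockGL (transpose_inclR_mul_inclR F K m) p.2 * p.1⁻¹) ?_ _
      (Set.toFinite _) ?_
    · rintro ⟨z, s⟩ ⟨-, hs, -⟩
      refine ⟨?_, fixesBlock_conj z s⟩
      rw [det_conj_eq, ← hs]
      exact congrArg Units.val (det_blockGL (transpose_inclR_mul_inclR F K m) s)
    · intro g _
      refine le_trans (Set.ncard_le_ncard ?_ (Set.toFinite _)) (ncard_fibre_few_fixed_le g)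
      rintro ⟨z, s⟩ ⟨⟨-, hs⟩, h⟩
      exact ⟨hs.2, h⟩
  rw [Set.ncard_prod, Set.ncard_univ] at h2
  have h3 : 0 < Nat.card (GL (Fin m) F) := Nat.card_pos
  refine Nat.le_of_mul_le_mul_left ?_ h3
  calc _ ≤ 2 * Fintype.card F * S.ncard * Nat.card (GL (Fin (K + m)) F) := Nat.mul_le_mul_right _ h1
    _ = 2 * Fintype.card F * (Nat.card (GL (Fin (K + m)) F) * S.ncard) := by ring
    _ ≤ _ := Nat.mul_le_mul_left _ h2
    _ = _ := by ring

theorem exists_tPair_of_missed_lt {G H : Subgroup (GL (Fin n) F)} (hG : ContainsSL G) (hHG : H ≤ G)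
    (hn : K ≤ n) (D : ℕ)
    (h : 12 * Fintype.card F * (Fintype.card F ^ K * (8 * Fintype.card F)) ^ (2 * K) *
      (Fintype.card F ^ (n - D) + missed G H * Fintype.card F ^ (D + 1)) < Fintype.card F ^ n) :
    ∃ (B : Matrix (Fin n) (Fin K) F) (C : Matrix (Fin K) (Fin n) F), TPair H B C := by
  classical
  obtain ⟨m, rfl⟩ := Nat.exists_eq_add_of_le hn
  set X := {g : GL (Fin (K + m)) F | g.1.det = 1 ∧ FixesBlock K g}
  have hdet : ∀ g : GL (Fin (K + m)) F, g.1.det = 1 → g ∈ G := fun g hg =>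
    hG (det_eq_one_iff_mem_range.2 hg)
  have h1 : Nat.card (GL (Fin (K + m)) F) ≤ _ * X.ncard := card_le_mul_ncard_fixesBlock
  have h2 := ncard_derangements_mul_le G H D
  have h3 : 3 * (derangements G H).ncard < X.ncard := by
    set L := 2 * Fintype.card F * (Fintype.card F ^ K * (8 * Fintype.card F)) ^ (2 * K)
    set W := Fintype.card F ^ (K + m - D) + missed G H * Fintype.card F ^ (D + 1)
    have h4 : 6 * L * W < Fintype.card F ^ (K + m) := by
      refine lt_of_eq_of_lt ?_ h
      simp only [L, W]; ring
    have h0 : 0 < Nat.card (GL (Fin (K + m)) F) := Nat.card_pos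
    have hX : 0 < X.ncard := by
      rcases Nat.eq_zero_or_pos X.ncard with hX | hX
      · rw [hX, mul_zero] at h1; omega
      · exact hX
    refine Nat.lt_of_mul_lt_mul_right (a := Fintype.card F ^ (K + m)) ?_
    calc _ = 3 * ((derangements G H).ncard * Fintype.card F ^ (K + m)) := by ring
      _ ≤ 3 * (2 * (W * (L * X.ncard))) :=
        Nat.mul_le_mul_left _ (h2.trans (Nat.mul_le_mul_left _ (Nat.mul_le_mul_left _ h1)))
      _ = 6 * L * W * X.ncard := by ring
      _ < Fintype.card F ^ (K + m) * X.ncard := Nat.mul_lt_mul_of_pos_right h4 hX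
      _ = _ := mul_comm _ _
  obtain ⟨g, ⟨hg, B, C, hCB, hB, hC⟩, hgood⟩ := exists_good_of_lt hHG X (fun g hg => hdet g hg.1)
    (fun g hg x _ => ⟨(det_conj_eq x g).trans hg.1, hg.2.conj x⟩) h3
  refine ⟨B, C, tPair_of_blockGL_mem hCB fun x hx => ?_⟩
  have hd : (blockGL hCB x).1.det = 1 := by
    rw [← hx]; exact congrArg Units.val (det_blockGL hCB x)
  refine hgood.mem_of_commute (hdet g hg) (hdet _ hd) ?_
  have hc : Commute (blockGL hCB x) g :=
    commute_blockGL hCB (y := 1) (by rw [hB, Matrix.mul_one]) (by rw [hC, Matrix.one_mul])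
      (Commute.one_right _)
  rw [hc.eq, mul_inv_cancel_right]
  exact Commute.refl g

end BostonShalev

namespace BostonShalev

open Polynomial Matrix

variable {F : Type*} [Field F] [Fintype F] {n : ℕ}

theorem card_le_mul_ncard_charpoly_eq {G : Subgroup (GL (Fin n) F)} (hG : ContainsSL G)
    {f : F[X]} (hf : f ∈ classPolys G) : Nat.card (GL (Fin n) F) ≤
      Fintype.card F ^ n * {g | g ∈ G ∧ g.1.charpoly = f}.ncard := by
  classical
  obtain ⟨g, hg, rfl, v, hv⟩ := exists_mem_charpoly_eq hG hf
  have h : Fintype.card F ^ n * {x | x ∈ G ∧ x.1.charpoly = g.1.charpoly}.ncard =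
      ({x | x ∈ G ∧ x.1.charpoly = g.1.charpoly} ×ˢ (Set.univ : Set (Fin n → F))).ncard := by
    rw [Set.ncard_prod, Set.ncard_univ, mul_comm]; simp
  rw [h, ← Set.ncard_univ]
  refine Set.ncard_le_ncard_of_injOn (fun z => (z * g * z⁻¹, z.1 *ᵥ v)) ?_ ?_ (Set.toFinite _)
  · intro z _
    have hc := charpoly_conj z g
    exact ⟨⟨hG.mem_iff.2 (by rw [hc]; exact hf.2), hc⟩, trivial⟩
  · intro z _ z' _ h
    simp only [Prod.mk.injEq] at h
    have h1 : Commute (z'⁻¹ * z) g := by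
      have h2 := congrArg (fun x => z'⁻¹ * x * z) h.1
      change z'⁻¹ * z * g = g * (z'⁻¹ * z)
      calc z'⁻¹ * z * g = z'⁻¹ * (z * g * z⁻¹) * z := by group
        _ = z'⁻¹ * (z' * g * z'⁻¹) * z := h2
        _ = _ := by group
    have h3 : (z'⁻¹ * z).1 = 1 := by
      refine hv _ _ (congrArg Units.val h1.eq) (Commute.one_left _) ?_
      rw [Units.val_mul, ← mulVec_mulVec, h.2, mulVec_mulVec, ← Units.val_mul, inv_mul_cancel,
        Units.val_one]
    exact (inv_mul_eq_one.1 (Units.ext h3)).symm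

theorem card_sub_one_le_ncard_constants :
    Fintype.card F - 1 ≤ (constants (⊤ : Subgroup (GL (Fin (n + 1)) F))).ncard := by
  classical
  rw [← Nat.card_eq_fintype_card, ← Nat.card_units, ← Set.ncard_univ]
  refine Set.ncard_le_ncard_of_injOn Units.val ?_ (fun _ _ _ _ h => Units.ext h) (Set.toFinite _)
  intro δ _
  have hf : (X ^ (n + 1) + C δ.1 : F[X]) ∈ monics F (n + 1) :=
    ⟨monic_X_pow_add_C _ n.succ_ne_zero, natDegree_X_pow_add_C⟩
  obtain ⟨A, -, hA, -⟩ := exists_companion hf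
  have hc : A.charpoly.coeff 0 = δ := by rw [hA]; simp
  obtain ⟨u, rfl⟩ := isUnit_of_charpoly_coeff_ne (by rw [hc]; exact δ.ne_zero)
  exact ⟨u, Subgroup.mem_top _, by rw [← det_eq_of_charpoly, hc]⟩

theorem ncard_mul_le_ncard_charpoly_mem {G : Subgroup (GL (Fin (n + 1)) F)} (hG : ContainsSL G)
    {S : Set F[X]} (hS : S ⊆ classPolys G) :
    S.ncard * (Fintype.card F - 1) * Nat.card G ≤
      (classPolys G).ncard * Fintype.card F * {g | g ∈ G ∧ g.1.charpoly ∈ S}.ncard := by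
  classical
  have hfin := (finite_classPolys G).subset hS
  have h1 : S.ncard * Nat.card (GL (Fin (n + 1)) F) ≤
      Fintype.card F ^ (n + 1) * {g | g ∈ G ∧ g.1.charpoly ∈ S}.ncard := by
    rw [Set.ncard_eq_toFinset_card S hfin, Set.ncard_eq_toFinset_card',
      Finset.card_eq_sum_card_fiberwise (f := fun g : GL (Fin (n + 1)) F => g.1.charpoly)
        (t := hfin.toFinset) (fun g hg => by simpa using (by simpa using hg : _ ∧ _).2),
      Finset.mul_sum, ← smul_eq_mul, ← Finset.sum_const]
    refine Finset.sum_le_sum fun f hf => ?_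
    refine (card_le_mul_ncard_charpoly_eq hG (hS (by simpa using hf))).trans
      (Nat.mul_le_mul_left _ ?_)
    rw [Set.ncard_eq_toFinset_card']
    refine Finset.card_le_card fun g hg => ?_
    simp only [Set.mem_toFinset, Set.mem_ofPred_eq, Finset.mem_filter] at hg ⊢
    exact ⟨⟨hg.1, hg.2 ▸ by simpa using hf⟩, hg.2⟩
  have h2 := card_mul_constants hG
  have h3 := card_mul_constants (G := (⊤ : Subgroup (GL (Fin (n + 1)) F))) le_top
  have h4 := card_sub_one_le_ncard_constants (F := F) (n := n)
  have h5 := ncard_classPolys G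
  rw [show Nat.card (⊤ : Subgroup (GL (Fin (n + 1)) F)) = Nat.card (GL (Fin (n + 1)) F) from
    Subgroup.card_top] at h3
  rw [h3] at h1
  rw [h2, h5]
  calc _ = (constants G).ncard * (S.ncard * ((Fintype.card F - 1) *
        Nat.card (SpecialLinearGroup (Fin (n + 1)) F))) := by ring
    _ ≤ (constants G).ncard * (S.ncard * ((constants (⊤ : Subgroup (GL (Fin (n + 1)) F))).ncard *
        Nat.card (SpecialLinearGroup (Fin (n + 1)) F))) := by gcongr
    _ ≤ _ := Nat.mul_le_mul_left _ h1
    _ = _ := by ring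

theorem ncard_derangements_le {G : Subgroup (GL (Fin (n + 1)) F)} (hG : ContainsSL G)
    (H : Subgroup (GL (Fin (n + 1)) F)) : ((derangements G H).ncard : ℝ) ≤
      Nat.card G * (1 / Fintype.card F + missed G H / (classPolys G).ncard) := by
  classical
  set P := {f : F[X] | ∃ g ∈ derangements G H, g.1.charpoly = f}
  have hP : P.ncard ≤ missed G H := ncard_charpoly_derangements_le
  have hPG : P ⊆ classPolys G := by
    rintro f ⟨g, hg, rfl⟩
    exact charpoly_mem_classPolys hg.1
  have h1 := ncard_mul_le_ncard_charpoly_mem hG (S := classPolys G \ P) Set.sdiff_subset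
  have h2 := Set.ncard_sdiff_add_ncard_of_subset hPG (finite_classPolys G)
  have h3 : (derangements G H).ncard + {g | g ∈ G ∧ g.1.charpoly ∈ classPolys G \ P}.ncard ≤
      Nat.card G := by
    rw [← Set.ncard_union_eq (Set.disjoint_left.2 fun g hg hg' => hg'.2.2 ⟨g, hg, rfl⟩)
      (Set.toFinite _) (Set.toFinite _), show Nat.card G = (G : Set (GL (Fin (n + 1)) F)).ncard from
      Nat.card_coe_set_eq _]
    exact Set.ncard_le_ncard (Set.union_subset (fun g hg => hg.1) fun g hg => hg.1) (Set.toFinite _)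
  have hq : 2 ≤ Fintype.card F := Fintype.one_lt_card
  have hN : 0 < (classPolys G).ncard := by
    rw [Set.ncard_pos (finite_classPolys G)]
    exact ⟨_, charpoly_mem_classPolys G.one_mem⟩
  obtain ⟨q, hqF⟩ : ∃ q : ℕ, Fintype.card F = q + 1 := ⟨Fintype.card F - 1, by omega⟩
  rw [hqF] at h1 ⊢
  generalize (classPolys G \ P).ncard = s at *
  generalize {g | g ∈ G ∧ g.1.charpoly ∈ classPolys G \ P}.ncard = y at *
  generalize (derangements G H).ncard = z at *
  generalize Nat.card G = c at *
  generalize (classPolys G).ncard = N at *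
  generalize P.ncard = p at *
  generalize missed G H = e at *
  rify at h1 h2 h3 hP hN
  simp only [Nat.add_sub_cancel] at h1
  have hN' : (N : ℝ) ≠ 0 := hN.ne'
  have hc : (0 : ℝ) ≤ c := c.cast_nonneg
  have hq0 : (0 : ℝ) ≤ q := q.cast_nonneg
  have he : (0 : ℝ) ≤ e := e.cast_nonneg
  push_cast
  rw [div_add_div _ _ (by positivity) hN', mul_div_assoc', le_div_iff₀ (by positivity)]
  have h4 : ((z : ℝ) + y) * (N * (q + 1)) ≤ c * (N * (q + 1)) := by gcongr
  have h5 : (s : ℝ) = N - p := by linarith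
  rw [h5] at h1
  have h6 : (p : ℝ) * (c * q) ≤ e * (c * (q + 1)) := by gcongr; linarith
  nlinarith

end BostonShalev

namespace BostonShalev

open Polynomial Matrix

variable {F ι κ : Type*} [Field F] [Fintype ι] [DecidableEq ι] [Fintype κ] [DecidableEq κ]

theorem exists_projection_of_simple_root {m : Matrix ι ι F} {α : F} {p : F[X]}
    (h : m.charpoly = (X - C α) * p) (hp : p.eval α ≠ 0) :
    ∃ u φ : ι → F, φ ⬝ᵥ u = 1 ∧ m *ᵥ u = α • u ∧ φ ᵥ* m = α • φ ∧
      vecMulVec u φ = (p.eval α)⁻¹ • aeval m p := by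
  have hne : m.charpoly ≠ 0 := m.charpoly_monic.ne_zero
  have hp0 : p ≠ 0 := by rintro rfl; simp at hp
  have hroot : m.charpoly.rootMultiplicity α = 1 := by
    rw [h, rootMultiplicity_mul (h ▸ hne), rootMultiplicity_X_sub_C_self,
      rootMultiplicity_eq_zero (by exact hp)]
  have hdim : Module.finrank F (Module.End.maxGenEigenspace (toLin' m) α) = 1 := by
    rw [LinearMap.finrank_maxGenEigenspace_eq, charpoly_toLin', hroot]
  have hann : ∀ v, m *ᵥ (aeval m p *ᵥ v) = α • (aeval m p *ᵥ v) := by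
    intro v
    have h1 := aeval_self_charpoly m
    rw [h, map_mul, map_sub, aeval_X, aeval_C, algebraMap_eq_diagonal] at h1
    have h2 := congrArg (· *ᵥ v) h1
    rw [sub_mul, ← algebraMap_eq_diagonal, ← Algebra.smul_def] at h2
    simp only [sub_mulVec, zero_mulVec, smul_mulVec, ← mulVec_mulVec] at h2
    exact sub_eq_zero.1 h2
  have heig : ∀ v, m *ᵥ v = α • v → v ∈ Module.End.maxGenEigenspace (toLin' m) α := fun v hv =>
    (Module.End.mem_maxGenEigenspace _ _ _).2 ⟨1, by simp [hv]⟩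
  obtain ⟨u, hu0, hu⟩ : ∃ u, u ≠ 0 ∧ m *ᵥ u = α • u := by
    have hr : Module.End.HasEigenvalue (toLin' m) α := by
      rw [Module.End.hasEigenvalue_iff_isRoot_charpoly, charpoly_toLin', h]
      simp
    obtain ⟨u, hu⟩ := hr.exists_hasEigenvector
    exact ⟨u, hu.2, by simpa using hu.apply_eq_smul⟩
  have hspan : ∀ v, m *ᵥ v = α • v → ∃ c : F, c • u = v := by
    intro v hv
    obtain ⟨c, hc⟩ := (finrank_eq_one_iff_of_nonzero' (⟨u, heig u hu⟩ :
      Module.End.maxGenEigenspace (toLin' m) α) (by simpa [Subtype.ext_iff] using hu0)).1 hdim ⟨v, heig v hv⟩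
    exact ⟨c, congrArg Subtype.val hc⟩
  have hpu : aeval m p *ᵥ u = p.eval α • u := by
    have h1 : ∀ k : ℕ, m ^ k *ᵥ u = α ^ k • u := by
      intro k
      induction k with
      | zero => simp
      | succ k ih => rw [pow_succ, ← mulVec_mulVec, hu, mulVec_smul, ih, smul_smul, pow_succ']
    rw [aeval_eq_sum_range, eval_eq_sum_range, sum_mulVec, Finset.sum_smul]
    exact Finset.sum_congr rfl fun k _ => by rw [smul_mulVec, h1, smul_smul]
  set Q := (p.eval α)⁻¹ • aeval m p with hQ
  have hQu : Q *ᵥ u = u := by rw [hQ, smul_mulVec, hpu, smul_smul, inv_mul_cancel₀ hp, one_smul]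
  have hQe : ∀ j, ∃ c : F, c • u = Q *ᵥ Pi.single j 1 := fun j => hspan _ (by
    rw [hQ, smul_mulVec, mulVec_smul, hann, smul_comm])
  choose φ hφ using hQe
  have hQφ : vecMulVec u φ = Q := by
    refine Matrix.ext_of_mulVec_single fun j => ?_
    rw [← hφ j, vecMulVec_mulVec]
    simp
  have hφu : φ ⬝ᵥ u = 1 := by
    obtain ⟨i, hi⟩ := Function.ne_iff.1 hu0
    have h1 := congrFun hQu i
    rw [← hQφ, vecMulVec_mulVec] at h1
    refine mul_left_cancel₀ hi ?_
    simpa using h1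
  refine ⟨u, φ, hφu, hu, ?_, hQφ⟩
  have hQm : Q * m = m * Q := by
    have h1 : aeval m p * aeval m (X : F[X]) = aeval m (X : F[X]) * aeval m p := by
      rw [← map_mul, ← map_mul, mul_comm]
    rw [aeval_X] at h1
    rw [hQ, smul_mul_assoc, mul_smul_comm, h1]
  rw [← hQφ, vecMulVec_mul, mul_vecMulVec, hu] at hQm
  obtain ⟨i, hi⟩ := Function.ne_iff.1 hu0
  funext j
  have h1 := congrFun (congrFun hQm i) j
  simp only [vecMulVec_apply, Pi.smul_apply, smul_eq_mul] at h1 ⊢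
  refine mul_left_cancel₀ hi ?_
  rw [h1]; ring

theorem exists_frame {r : ℕ} {m : Matrix ι ι F} {α : Fin (r + 2) → F}
    (hα : Function.Injective α) {h : F[X]} (hf : m.charpoly = (∏ i, (X - C (α i))) * h)
    (hh : ∀ i, h.eval (α i) ≠ 0) : ∃ (B : Matrix ι (Fin (r + 2)) F) (C' : Matrix (Fin (r + 2)) ι F),
      C' * B = 1 ∧ m * B = B * diagonal α ∧ C' * m = diagonal α * C' ∧
      aeval m ((∏ i : Fin r, (X - Polynomial.C (α i.succ.succ))) * h) *
        (1 - B * planeB F (0 : Fin (r + 2)) 1 * ((planeB F (0 : Fin (r + 2)) 1)ᵀ * C')) = 0 := by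
  set p : Fin (r + 2) → F[X] := fun i => (∏ j ∈ Finset.univ.erase i, (X - C (α j))) * h with hp
  have hfp : ∀ i, m.charpoly = (X - C (α i)) * p i := fun i => by
    rw [hf, hp, ← mul_assoc, Finset.mul_prod_erase _ (fun i => X - C (α i)) (Finset.mem_univ i)]
  have hpi : ∀ i, (p i).eval (α i) ≠ 0 := fun i => by
    simp only [hp, eval_mul, eval_prod, eval_sub, eval_X, eval_C]
    refine mul_ne_zero (Finset.prod_ne_zero_iff.2 fun j hj => sub_ne_zero.2 fun h => ?_) (hh i)
    exact (Finset.ne_of_mem_erase hj) (hα h.symm)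
  choose u φ hφu hu hφ hQ using fun i => exists_projection_of_simple_root (hfp i) (hpi i)
  refine ⟨of fun a i => u i a, of fun i a => φ i a, ?_, ?_, ?_, ?_⟩
  · ext i j
    rw [Matrix.mul_apply]
    change φ i ⬝ᵥ u j = _
    by_cases hij : i = j
    · rw [hij, hφu, one_apply_eq]
    · rw [one_apply_ne hij]
      have h1 : φ i ᵥ* m ⬝ᵥ u j = φ i ⬝ᵥ m *ᵥ u j := (dotProduct_mulVec _ _ _).symm
      rw [hφ, hu, smul_dotProduct, dotProduct_smul, smul_eq_mul, smul_eq_mul] at h1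
      exact (mul_eq_mul_right_iff.1 h1).resolve_left fun h => hij (hα h)
  · ext a i
    rw [mul_diagonal, Matrix.mul_apply]
    exact (congrFun (hu i) a).trans (mul_comm _ _)
  · ext i a
    rw [diagonal_mul, Matrix.mul_apply]
    exact congrFun (hφ i) a
  · have h01 : (0 : Fin (r + 2)) ≠ 1 := by simp
    set h2 := (∏ i : Fin r, (X - C (α i.succ.succ))) * h with hh2
    have hf2 : m.charpoly = (X - C (α 0)) * ((X - C (α 1)) * h2) := by
      rw [hf, Fin.prod_univ_succ, Fin.prod_univ_succ, hh2]
      simp only [Fin.succ_zero_eq_one]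
      ring
    have hp0 : p 0 = (X - C (α 1)) * h2 :=
      mul_left_cancel₀ (X_sub_C_ne_zero (α 0)) ((hfp 0).symm.trans hf2)
    have hp1 : p 1 = (X - C (α 0)) * h2 :=
      mul_left_cancel₀ (X_sub_C_ne_zero (α 1)) ((hfp 1).symm.trans (hf2.trans (by ring)))
    have hP : of (fun a i => u i a) * planeB F (0 : Fin (r + 2)) 1 *
        ((planeB F (0 : Fin (r + 2)) 1)ᵀ * of fun i a => φ i a) =
        vecMulVec (u 0) (φ 0) + vecMulVec (u 1) (φ 1) := by
      ext a b
      have h4 : ∀ c, (of (fun a i => u i a) * planeB F (0 : Fin (r + 2)) 1) a c =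
          u (![0, 1] c) a := fun c => by
        simp [planeB, Matrix.mul_apply]
      have h5 : ∀ c, ((planeB F (0 : Fin (r + 2)) 1)ᵀ * of fun i a => φ i a) c b =
          φ (![0, 1] c) b := fun c => by
        simp [planeB, Matrix.mul_apply]
      rw [Matrix.mul_apply]
      simp [h4, h5, Fin.sum_univ_two, vecMulVec_apply]
    obtain ⟨w, hw⟩ : (X - C (α 0)) * (X - C (α 1)) ∣
        1 - C ((p 0).eval (α 0))⁻¹ * p 0 - C ((p 1).eval (α 1))⁻¹ * p 1 := by
      refine IsCoprime.mul_dvd (pairwise_coprime_X_sub_C hα h01) ?_ ?_ <;> rw [dvd_iff_isRoot, IsRoot]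
      · have := inv_mul_cancel₀ (hpi 0)
        rw [hp0] at this ⊢
        simp [hp1] at this ⊢
        simp [this]
      · have := inv_mul_cancel₀ (hpi 1)
        rw [hp1] at this ⊢
        simp [hp0] at this ⊢
        simp [this]
    have h3 : (1 : Matrix ι ι F) - (vecMulVec (u 0) (φ 0) + vecMulVec (u 1) (φ 1)) =
        aeval m (1 - C ((p 0).eval (α 0))⁻¹ * p 0 - C ((p 1).eval (α 1))⁻¹ * p 1) := by
      rw [hQ, hQ, map_sub, map_sub, map_one, ← smul_eq_C_mul, ← smul_eq_C_mul, map_smul, map_smul,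
        sub_sub]
    rw [hP, h3, ← map_mul, hw, show h2 * ((X - C (α 0)) * (X - C (α 1)) * w) = m.charpoly * w by
      rw [hf2]; ring, map_mul, aeval_self_charpoly, zero_mul]

/-- If `m` is good and acts on a block as `y`, then `H` contains every element of determinant one
of this block that conjugates `y` into its centralizer. -/
theorem IsGood.blockGL_mem {G H : Subgroup (GL ι F)} (hG : ∀ g : GL ι F, g.1.det = 1 → g ∈ G)
    {m : GL ι F} (hm : IsGood G H m) (hmG : m ∈ G) {B : Matrix ι κ F} {C : Matrix κ ι F}
    (h : C * B = 1) {y : GL κ F} (hB : m.1 * B = B * y.1) (hC : C * m.1 = y.1 * C) {x : GL κ F}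
    (hx : x.1.det = 1) (hxy : Commute (x * y * x⁻¹) y) : blockGL h x ∈ H := by
  have hdet : (blockGL h x).1.det = 1 := by
    have := congrArg Units.val (det_blockGL h x)
    exact this.trans hx
  refine hm.mem_of_commute hmG (hG _ hdet) ?_
  obtain ⟨n, rfl⟩ : ∃ n, m = blockGL h y * n := ⟨(blockGL h y)⁻¹ * m, by group⟩
  have hyB : (blockGL h y).1 * B = B * y.1 := blockHom_mul_left h y.1
  have hyC : C * (blockGL h y).1 = y.1 * C := mul_blockHom h y.1
  have hnB : n.1 * B = B * (1 : Matrix κ κ F) := by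
    rw [Units.val_mul, Matrix.mul_assoc, ← hyB] at hB
    have h2 := congrArg (((blockGL h y)⁻¹).1 * ·) hB
    simp only [← Matrix.mul_assoc] at h2
    rw [← Units.val_mul, inv_mul_cancel, Units.val_one] at h2
    simpa using h2
  have hnC : C * n.1 = (1 : Matrix κ κ F) * C := by
    rw [Units.val_mul, ← Matrix.mul_assoc, hyC, Matrix.mul_assoc] at hC
    have h2 := congrArg ((y⁻¹).1 * ·) hC
    simp only [← Matrix.mul_assoc] at h2
    rw [← Units.val_mul, inv_mul_cancel, Units.val_one] at h2
    simpa using h2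
  have hn : ∀ z : GL κ F, Commute (blockGL h z) n := fun z =>
    commute_blockGL h hnB hnC (Commute.one_right _)
  have h1 : blockGL h x * (blockGL h y * n) * (blockGL h x)⁻¹ = blockGL h (x * y * x⁻¹) * n := by
    rw [mul_assoc, mul_assoc, ← map_inv, ← (hn x⁻¹).eq, map_mul, map_mul]
    simp only [mul_assoc]
  rw [h1]
  exact Commute.mul_left (Commute.mul_right (hxy.map _) (hn _)) (Commute.mul_right (hn y).symm
    (Commute.refl _))

end BostonShalev

namespace BostonShalev

open Polynomial Matrix

variable {F ι : Type*} [Field F] [Fintype ι] [DecidableEq ι]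

/-- `P` is the projection with image the kernel of `g ^ 2 + e`, along its image. -/
def Splits (g P : Matrix ι ι F) (e : F) : Prop :=
  (g * g + e • 1) * P = 0 ∧ P * (g * g + e • 1) = 0 ∧
    ∃ R, (g * g + e • 1) * R = 1 - P ∧ R * (g * g + e • 1) = 1 - P

theorem Splits.unique {g P P' : Matrix ι ι F} {e : F} (h : Splits g P e) (h' : Splits g P' e) :
    P = P' := by
  obtain ⟨-, h2, R, -, h4⟩ := h
  obtain ⟨h1, -, R', h3, -⟩ := h'
  have h5 : P' = P * P' := by
    have : R * ((g * g + e • 1) * P') = 0 := by rw [h1, Matrix.mul_zero]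
    rw [← Matrix.mul_assoc, h4, Matrix.sub_mul, Matrix.one_mul, sub_eq_zero] at this
    exact this
  have h6 : P = P * P' := by
    have : P * (g * g + e • 1) * R' = 0 := by rw [h2, Matrix.zero_mul]
    rw [Matrix.mul_assoc, h3, Matrix.mul_sub, Matrix.mul_one, sub_eq_zero] at this
    exact this
  rw [h6, ← h5]

/-- The negatives of the eigenvalues of `g ^ 2`. -/
def singularSet (g : Matrix ι ι F) : Set F := {δ | (g * g + δ • 1).det = 0}

theorem mem_singularSet_iff {g : Matrix ι ι F} {δ : F} :
    δ ∈ singularSet g ↔ ∃ v ≠ 0, (g * g + δ • 1) *ᵥ v = 0 :=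
  exists_mulVec_eq_zero_iff.symm

theorem singularSet_subset {g : Matrix ι ι F} :
    singularSet g ⊆ {δ | ¬ IsCoprime (X ^ 2 + Polynomial.C δ) g.charpoly} := by
  rintro δ hδ ⟨a, b, hab⟩
  obtain ⟨v, hv, h⟩ := mem_singularSet_iff.1 hδ
  have h1 := congrArg (aeval g) hab
  rw [map_add, map_mul, map_mul, aeval_self_charpoly, mul_zero, add_zero, map_one, map_add,
    map_pow, aeval_X, aeval_C, Algebra.algebraMap_eq_smul_one, pow_two] at h1
  refine hv ?_
  rw [← one_mulVec v, ← h1, ← mulVec_mulVec, h, mulVec_zero]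

/-- The matrix `!![0, t; -t⁻¹, 0]`. -/
def weyl (t : Fˣ) : GL (Fin 2) F where
  val := !![0, t; -t⁻¹, 0]
  inv := !![0, -t; t⁻¹, 0]
  val_inv := by simp [one_fin_two]
  inv_val := by simp [one_fin_two]

theorem coe_weyl (t : Fˣ) : (weyl t).1 = !![0, (t : F); -(t : F)⁻¹, 0] := by simp [weyl]

theorem det_weyl (t : Fˣ) : (weyl t).1.det = 1 := by simp [coe_weyl, det_fin_two]

/-- The matrix `m` acts diagonally, with eigenvalues `a` and `b`, on a plane with projection `B * C`,
and `m ^ 2 + a * b` is invertible on the complement. -/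
structure IsPlane (m : Matrix ι ι F) (a b : F) (B : Matrix ι (Fin 2) F) (C : Matrix (Fin 2) ι F) :
    Prop where
  mul_eq : m * B = B * diagonal ![a, b]
  eq_mul : C * m = diagonal ![a, b] * C
  exists_inv : ∃ s : F[X], aeval m (s * (X ^ 2 + Polynomial.C (a * b))) * (1 - B * C) = 1 - B * C

variable {m : GL ι F} {a b : F} {B : Matrix ι (Fin 2) F} {C : Matrix (Fin 2) ι F}

theorem IsPlane.sub_mul (hm : IsPlane m.1 a b B C) : (1 - B * C) * m.1 = m.1 * (1 - B * C) := by
  rw [Matrix.sub_mul, Matrix.mul_sub, Matrix.mul_assoc, hm.eq_mul, ← Matrix.mul_assoc,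
    ← Matrix.mul_assoc, hm.mul_eq, Matrix.mul_one, Matrix.one_mul]

theorem IsPlane.blockGL_mul_sub (hm : IsPlane m.1 a b B C) (h : C * B = 1) (x : GL (Fin 2) F) :
    (blockGL h x * m).1 * (1 - B * C) = m.1 * (1 - B * C) := by
  have hCQ : C * (1 - B * C) = 0 := by
    rw [Matrix.mul_sub, ← Matrix.mul_assoc, h, Matrix.mul_one, Matrix.one_mul, sub_self]
  rw [Units.val_mul, coe_blockGL, Matrix.mul_assoc, ← hm.sub_mul, ← Matrix.mul_assoc,
    Matrix.add_mul, Matrix.mul_assoc _ C, hCQ]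
  simp

theorem IsPlane.splits (hm : IsPlane m.1 a b B C) (h : C * B = 1) (t : Fˣ) :
    Splits (blockGL h (weyl t) * m).1 (B * C) (a * b) := by
  obtain ⟨hB, hC, s, hs⟩ := hm
  set g := (blockGL h (weyl t) * m).1 with hg
  set y : Matrix (Fin 2) (Fin 2) F := (weyl t).1 * diagonal ![a, b] with hy
  have hyy : y * y + (a * b) • 1 = 0 := by
    have ht := t.ne_zero
    have hy' : y = !![0, t * b; -(t : F)⁻¹ * a, 0] := by
      rw [hy, coe_weyl]
      ext i j
      fin_cases i <;> fin_cases j <;> simp [mul_diagonal]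
    rw [hy']
    ext i j
    fin_cases i <;> fin_cases j <;> simp <;> field_simp <;> ring
  have hgB : g * B = B * y := by
    rw [hg, Units.val_mul, Matrix.mul_assoc, hB, ← Matrix.mul_assoc, hy, ← Matrix.mul_assoc]
    exact congrArg (· * _) (blockHom_mul_left h _)
  have hgC : C * g = y * C := by
    rw [hg, Units.val_mul, ← Matrix.mul_assoc, hy, Matrix.mul_assoc (weyl t).1, ← hC,
      ← Matrix.mul_assoc]
    exact congrArg (· * _) (mul_blockHom h _)
  clear_value y
  have h1 : (g * g + (a * b) • 1) * B = 0 := by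
    have : (g * g + (a * b) • 1) * B = B * (y * y + (a * b) • 1) := by
      rw [Matrix.add_mul, Matrix.mul_add, Matrix.smul_mul, Matrix.mul_smul, Matrix.one_mul,
        Matrix.mul_one, Matrix.mul_assoc, hgB, ← Matrix.mul_assoc, hgB, Matrix.mul_assoc]
    rw [this, hyy, Matrix.mul_zero]
  have h2 : C * (g * g + (a * b) • 1) = 0 := by
    have : C * (g * g + (a * b) • 1) = (y * y + (a * b) • 1) * C := by
      rw [Matrix.add_mul, Matrix.mul_add, Matrix.smul_mul, Matrix.mul_smul, Matrix.one_mul,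
        Matrix.mul_one, ← Matrix.mul_assoc, hgC, Matrix.mul_assoc y, hgC, Matrix.mul_assoc]
    rw [this, hyy, Matrix.zero_mul]
  have hQB : (1 - B * C) * B = 0 := by
    rw [Matrix.sub_mul, Matrix.mul_assoc, h, Matrix.mul_one, Matrix.one_mul, sub_self]
  have hmQ := IsPlane.sub_mul ⟨hB, hC, s, hs⟩
  have h3 : g * (1 - B * C) = m.1 * (1 - B * C) :=
    IsPlane.blockGL_mul_sub ⟨hB, hC, s, hs⟩ h _
  have h5 : (1 - B * C) * g = m.1 * (1 - B * C) := by
    rw [hg, Units.val_mul, coe_blockGL, ← Matrix.mul_assoc, ← hmQ, Matrix.mul_add,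
      ← Matrix.mul_assoc, ← Matrix.mul_assoc, hQB]
    simp
  have hA : aeval m.1 s * (1 - B * C) = (1 - B * C) * aeval m.1 s := by
    clear hs
    induction s using Polynomial.induction_on' with
    | add p q hp hq => rw [map_add, Matrix.add_mul, hp, hq, Matrix.mul_add]
    | monomial k c =>
      rw [aeval_monomial, mul_assoc, (Commute.pow_right hmQ k : Commute (1 - B * C) _).eq.symm,
        ← mul_assoc, Algebra.commutes, mul_assoc]
  rw [map_mul, map_add, map_pow, aeval_X, aeval_C, Algebra.algebraMap_eq_smul_one, pow_two] at hs
  have hK : (1 - B * C) * (g * g + (a * b) • 1) = (m.1 * m.1 + (a * b) • 1) * (1 - B * C) := by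
    rw [Matrix.mul_add, Matrix.add_mul, ← Matrix.mul_assoc, h5, Matrix.mul_assoc, h5,
      Matrix.mul_assoc, smul_mul_assoc, mul_smul_comm, Matrix.mul_one, Matrix.one_mul]
  have hK' : (g * g + (a * b) • 1) * (1 - B * C) = (m.1 * m.1 + (a * b) • 1) * (1 - B * C) := by
    rw [Matrix.add_mul, Matrix.add_mul, Matrix.mul_assoc, h3, ← hmQ, ← Matrix.mul_assoc, h3,
      Matrix.mul_assoc, Matrix.mul_assoc, hmQ]
  refine ⟨by rw [← Matrix.mul_assoc, h1, Matrix.zero_mul],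
    by rw [Matrix.mul_assoc, h2, Matrix.mul_zero], aeval m.1 s * (1 - B * C), ?_, ?_⟩
  · have hcomm : Commute (aeval m.1 s) (m.1 * m.1 + (a * b) • 1) := by
      have : m.1 * m.1 + (a * b) • 1 = aeval m.1 (X ^ 2 + Polynomial.C (a * b)) := by
        rw [map_add, map_pow, aeval_X, aeval_C, Algebra.algebraMap_eq_smul_one, pow_two]
      rw [this, Commute, SemiconjBy, ← map_mul, mul_comm, map_mul]
    rw [hA, ← Matrix.mul_assoc, hK', Matrix.mul_assoc, ← hA, ← Matrix.mul_assoc, ← hcomm.eq, hs]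
  · rw [Matrix.mul_assoc, hK, ← Matrix.mul_assoc, hs]

theorem IsPlane.singularSet_subset (hm : IsPlane m.1 a b B C) (h : C * B = 1) (t : Fˣ) :
    singularSet (blockGL h (weyl t) * m).1 ⊆ insert (a * b) (singularSet m.1) := by
  intro δ hδ
  obtain ⟨hP, hP', -⟩ := hm.splits h t
  obtain ⟨v, hv, hgv⟩ := mem_singularSet_iff.1 hδ
  by_cases he : δ = a * b
  · exact Or.inl he
  refine Or.inr (mem_singularSet_iff.2 ⟨v, hv, ?_⟩)
  set g := (blockGL h (weyl t) * m).1 with hg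
  have h1 : (B * C) *ᵥ v = 0 := by
    have h2 : g * g + δ • 1 = (g * g + (a * b) • 1) + (δ - a * b) • 1 := by
      rw [sub_smul]; abel
    have h3 := congrArg ((B * C) *ᵥ ·) hgv
    rw [mulVec_mulVec, h2, Matrix.mul_add, hP', zero_add, Matrix.mul_smul, Matrix.mul_one,
      smul_mulVec, mulVec_zero] at h3
    exact (smul_eq_zero.1 h3).resolve_left (sub_ne_zero.2 he)
  have hQv : (1 - B * C) *ᵥ v = v := by rw [sub_mulVec, h1, one_mulVec, sub_zero]
  have h3 : g * (1 - B * C) = m.1 * (1 - B * C) := hm.blockGL_mul_sub h _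
  have h4 : (g * g) *ᵥ v = (m.1 * m.1) *ᵥ v := by
    rw [← hQv, mulVec_mulVec, mulVec_mulVec, Matrix.mul_assoc, h3, ← hm.sub_mul, ← Matrix.mul_assoc,
      h3, Matrix.mul_assoc, hm.sub_mul, Matrix.mul_assoc]
  rw [add_mulVec, ← h4, ← add_mulVec, hgv]

theorem Splits.mem_singularSet {g P : Matrix ι ι F} {e : F} (h : Splits g P e) (hP : P ≠ 0) :
    e ∈ singularSet g := by
  by_contra he
  have hu : IsUnit (g * g + e • 1) := (isUnit_iff_isUnit_det _).2 (isUnit_iff_ne_zero.2 he)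
  exact hP (hu.mul_right_eq_zero.1 h.1)

/-- Every element of determinant one of `H` in the block is monomial. -/
def IsTame (H : Subgroup (GL ι F)) (h : C * B = 1) : Prop :=
  ∀ x : GL (Fin 2) F, x.1.det = 1 → blockGL h x ∈ H →
    (x.1 0 0 = 0 ∧ x.1 1 1 = 0) ∨ (x.1 0 1 = 0 ∧ x.1 1 0 = 0)

/-- The matrix `diag(t, t⁻¹)`. -/
def torus (t : Fˣ) : GL (Fin 2) F where
  val := !![(t : F), 0; 0, (t : F)⁻¹]
  inv := !![(t : F)⁻¹, 0; 0, (t : F)]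
  val_inv := by simp [one_fin_two]
  inv_val := by simp [one_fin_two]

theorem coe_torus (t : Fˣ) : (torus t).1 = !![(t : F), 0; 0, (t : F)⁻¹] := rfl

theorem det_torus (t : Fˣ) : (torus t).1.det = 1 := by simp [coe_torus, det_fin_two]

theorem weyl_or_torus {x : GL (Fin 2) F} (hx : x.1.det = 1)
    (h : (x.1 0 0 = 0 ∧ x.1 1 1 = 0) ∨ (x.1 0 1 = 0 ∧ x.1 1 0 = 0)) :
    ∃ t : Fˣ, x = weyl t ∨ x = torus t := by
  rw [det_fin_two] at hx
  obtain ⟨h1, h2⟩ | ⟨h1, h2⟩ := h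
  · have h3 : x.1 0 1 ≠ 0 := by rintro h; simp [h1, h] at hx
    refine ⟨Units.mk0 _ h3, Or.inl (Units.ext ?_)⟩
    have h4 : x.1 1 0 = -(x.1 0 1)⁻¹ := by
      rw [h1] at hx
      field_simp
      linear_combination -hx
    rw [coe_weyl]
    ext i j
    fin_cases i <;> fin_cases j <;> simp [h1, h2, h4]
  · have h3 : x.1 0 0 ≠ 0 := by rintro h; simp [h1, h] at hx
    refine ⟨Units.mk0 _ h3, Or.inr (Units.ext ?_)⟩
    have h4 : x.1 1 1 = (x.1 0 0)⁻¹ := by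
      rw [h1] at hx
      field_simp
      linear_combination hx
    rw [coe_torus]
    ext i j
    fin_cases i <;> fin_cases j <;> simp [h1, h2, h4]

theorem ncard_block_le [Fintype F] {H : Subgroup (GL ι F)} {h : C * B = 1} (ht : IsTame H h) :
    {k : GL ι F | k ∈ H ∧ k.1.det = 1 ∧ k.1 = 1 + B * C * (k.1 - 1) * (B * C)}.ncard ≤
      2 * (Fintype.card F - 1) := by
  classical
  have hcard : Nat.card (Fˣ ⊕ Fˣ) = 2 * (Fintype.card F - 1) := by
    rw [Nat.card_sum, Nat.card_units, Nat.card_eq_fintype_card, two_mul]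
  rw [← hcard, ← Set.ncard_univ]
  refine le_trans (Set.ncard_le_ncard ?_ (Set.toFinite _)) (Set.ncard_image_le (f :=
    (Sum.elim (fun t => blockGL h (weyl t)) fun t => blockGL h (torus t))) (Set.toFinite _))
  rintro k ⟨hkH, hdet, hk⟩
  have hkx : k.1 = blockHom h (C * k.1 * B) := by
    have h1 : B * C * (k.1 - 1) * (B * C) = B * (C * k.1 * B - 1) * C := by
      rw [← h]
      simp only [Matrix.mul_sub, Matrix.sub_mul, Matrix.mul_one, Matrix.mul_assoc]
    rw [blockHom_apply, ← h1, ← hk]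
  have hx : (C * k.1 * B).det = 1 := by rw [← det_blockHom h, ← hkx, hdet]
  set x : GL (Fin 2) F := GeneralLinearGroup.mkOfDetNeZero (C * k.1 * B) (by simp [hx]) with hxd
  have hkx' : k = blockGL h x := Units.ext hkx
  obtain ⟨t, ht | ht⟩ := weyl_or_torus (x := x) hx (ht x hx (hkx' ▸ hkH))
  · exact ⟨Sum.inl t, trivial, by rw [hkx', ht]; rfl⟩
  · exact ⟨Sum.inr t, trivial, by rw [hkx', ht]; rfl⟩

end BostonShalev

namespace BostonShalev

open Polynomial Matrix

theorem exists_sq_add_sq_mul_eq_one {F : Type*} [Field F] [Fintype F] (hq : 5 < Fintype.card F)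
    (e : F) : ∃ a b : F, a ≠ 0 ∧ b ≠ 0 ∧ a ^ 2 + b ^ 2 * e = 1 := by
  classical
  by_cases h2 : ringChar F = 2
  · obtain ⟨s, hs⟩ := FiniteField.isSquare_of_char_two h2 e
    have h2' : (2 : F) = 0 := by
      have := ringChar.Nat.cast_ringChar (R := F)
      rw [h2] at this
      exact_mod_cast this
    obtain ⟨b, hb⟩ := Polynomial.exists_eval_ne_zero_of_natDegree_lt_card
      (X * (1 + C s * X) : F[X]) (mul_ne_zero X_ne_zero fun h => by
        simpa using congrArg (eval 0) h) (by
        have h : (X * (1 + C s * X) : F[X]).natDegree ≤ 2 := by compute_degree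
        simp; omega)
    simp only [eval_mul, eval_add, eval_X, eval_one, eval_C] at hb
    refine ⟨1 + s * b, b, right_ne_zero_of_mul hb, left_ne_zero_of_mul hb, ?_⟩
    rw [hs]
    linear_combination (s * b + s ^ 2 * b ^ 2) * h2'
  · have h2' : (2 : F) ≠ 0 := Ring.two_ne_zero h2
    obtain ⟨s, hs⟩ := Polynomial.exists_eval_ne_zero_of_natDegree_lt_card
      (X * (1 + C e * X ^ 2) * (1 - C e * X ^ 2) : F[X]) (mul_ne_zero (mul_ne_zero X_ne_zero
        fun h => by simpa using congrArg (eval 0) h) fun h => by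
        simpa using congrArg (eval 0) h) (by
        have h : (X * (1 + C e * X ^ 2) * (1 - C e * X ^ 2) : F[X]).natDegree ≤ 5 := by
          compute_degree
        simp; omega)
    simp only [eval_mul, eval_add, eval_sub, eval_pow, eval_X, eval_one, eval_C] at hs
    have h1 := right_ne_zero_of_mul (left_ne_zero_of_mul hs)
    refine ⟨(1 - e * s ^ 2) / (1 + e * s ^ 2), 2 * s / (1 + e * s ^ 2),
      div_ne_zero (right_ne_zero_of_mul hs) h1, div_ne_zero (mul_ne_zero h2'
        (left_ne_zero_of_mul (left_ne_zero_of_mul hs))) h1, ?_⟩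
    field_simp
    ring

variable {F ι : Type*} [Field F] [Fintype F] [Fintype ι] [DecidableEq ι] {m : GL ι F} {a b : F}
  {B : Matrix ι (Fin 2) F} {C : Matrix (Fin 2) ι F} {G H : Subgroup (GL ι F)}

theorem IsPlane.not_isGood (hm : IsPlane m.1 a b B C) (hSL : ∀ g : GL ι F, g.1.det = 1 → g ∈ G)
    (hmG : m ∈ G) (h : C * B = 1) (ha : a ≠ 0) (hb : b ≠ 0) (hq : 5 < Fintype.card F)
    (ht : IsTame H h) (t : Fˣ) : ¬ IsGood G H (blockGL h (weyl t) * m) := by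
  intro hg
  obtain ⟨c, d, hc, hd, hcd⟩ := exists_sq_add_sq_mul_eq_one hq (a * b)
  have ht0 := t.ne_zero
  set y : Matrix (Fin 2) (Fin 2) F := !![0, t * b; -(t : F)⁻¹ * a, 0] with hy
  have hydet : y.det = a * b := by rw [hy, det_fin_two]; simp; field_simp
  have hyd : y = (weyl t).1 * diagonal ![a, b] := by
    rw [hy, coe_weyl]
    ext i j
    fin_cases i <;> fin_cases j <;> simp [mul_diagonal]
  set y' : GL (Fin 2) F := GeneralLinearGroup.mkOfDetNeZero y (by
    rw [hydet]; exact mul_ne_zero ha hb) with hy'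
  have hxdet : (c • (1 : Matrix (Fin 2) (Fin 2) F) + d • y).det = 1 := by
    rw [hy, det_fin_two]
    simp
    field_simp
    linear_combination hcd
  set x : GL (Fin 2) F := GeneralLinearGroup.mkOfDetNeZero (c • 1 + d • y) (by simp [hxdet]) with hx
  have hxy : Commute x y' := by
    refine Units.ext ?_
    change (c • 1 + d • y) * y = y * (c • 1 + d • y)
    simp [Matrix.add_mul, Matrix.mul_add]
  have hmem := hg.blockGL_mem hSL (G.mul_mem (hSL _ ?_) hmG) h (y := y') (x := x) ?_ ?_ hxdet
    (by rw [hxy.eq, mul_inv_cancel_right])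
  · rcases ht x hxdet hmem with ⟨h1, -⟩ | ⟨h1, -⟩
    · have : x.1 0 0 = c := by
        change (c • (1 : Matrix (Fin 2) (Fin 2) F) + d • y) 0 0 = c
        simp [hy]
      exact hc (this ▸ h1)
    · have : x.1 0 1 = d * (t * b) := by
        change (c • (1 : Matrix (Fin 2) (Fin 2) F) + d • y) 0 1 = _
        simp [hy]
      rw [this] at h1
      exact mul_ne_zero hd (mul_ne_zero ht0 hb) h1
  · exact (congrArg Units.val (det_blockGL h _)).trans (det_weyl t)
  · change _ = B * y
    rw [Units.val_mul, Matrix.mul_assoc, hm.mul_eq, hyd, ← Matrix.mul_assoc, ← Matrix.mul_assoc]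
    exact congrArg (· * _) (blockHom_mul_left h _)
  · change _ = y * C
    rw [hyd, Units.val_mul, ← Matrix.mul_assoc, Matrix.mul_assoc (weyl t).1, ← hm.eq_mul,
      ← Matrix.mul_assoc]
    exact congrArg (· * _) (mul_blockHom h _)

theorem IsPlane.blockGL_mem (hm : IsPlane m.1 a b B C) (hSL : ∀ g : GL ι F, g.1.det = 1 → g ∈ G)
    (hmG : m ∈ G) (h : C * B = 1) (ha : a ≠ 0) (hb : b ≠ 0) (hg : IsGood G H m) (t : Fˣ) :
    blockGL h (weyl t) ∈ H ∧ blockGL h (torus t) ∈ H := by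
  set y : GL (Fin 2) F := GeneralLinearGroup.mkOfDetNeZero (diagonal ![a, b]) (by
    simp [ha, hb]) with hy
  constructor
  · refine hg.blockGL_mem hSL hmG h (y := y) hm.mul_eq hm.eq_mul (det_weyl t) ?_
    have h1 : weyl t * y = GeneralLinearGroup.mkOfDetNeZero (diagonal ![b, a]) (by
        simp [ha, hb]) * weyl t := by
      refine Units.ext ?_
      change (weyl t).1 * diagonal ![a, b] = diagonal ![b, a] * (weyl t).1
      rw [coe_weyl]
      ext i j
      fin_cases i <;> fin_cases j <;> simp [mul_diagonal, mul_comm]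
    rw [h1, mul_inv_cancel_right]
    exact Units.ext (by
      change diagonal ![b, a] * diagonal ![a, b] = diagonal ![a, b] * diagonal ![b, a]
      simp [mul_comm])
  · refine hg.blockGL_mem hSL hmG h (y := y) hm.mul_eq hm.eq_mul (det_torus t) ?_
    have h1 : torus t * y = y * torus t := by
      refine Units.ext ?_
      change (torus t).1 * diagonal ![a, b] = diagonal ![a, b] * (torus t).1
      rw [coe_torus]
      ext i j
      fin_cases i <;> fin_cases j <;> simp [mul_diagonal, mul_comm]
    rw [h1, mul_inv_cancel_right]

theorem ncard_tame_le (hHG : H ≤ G) (hSL : ∀ g : GL ι F, g.1.det = 1 → g ∈ G)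
    (hq : 5 < Fintype.card F) {T : Set (GL ι F)} (hT : ∀ m ∈ T, IsGood G H m) {d : ℕ}
    (hd : ∀ m ∈ T, (singularSet m.1).ncard ≤ d) (hfr : ∀ m ∈ T, ∃ (a b : F)
      (B : Matrix ι (Fin 2) F) (C : Matrix (Fin 2) ι F) (h : C * B = 1),
      a ≠ 0 ∧ b ≠ 0 ∧ IsPlane m.1 a b B C ∧ IsTame H h) :
    T.ncard ≤ 2 * (d + 1) * {g | g ∈ H ∧ ¬ IsGood G H g}.ncard := by
  classical
  choose a b B C h ha hb hP ht using fun m : T => hfr m.1 m.2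
  set f : T × Fˣ → GL ι F × F := fun p => (blockGL (h p.1) (weyl p.2) * p.1.1, a p.1 * b p.1)
    with hf
  set Y : Set (GL ι F × F) := {p | (p.1 ∈ H ∧ ¬ IsGood G H p.1) ∧ (singularSet p.1.1).ncard ≤ d + 1 ∧
    p.2 ∈ singularSet p.1.1} with hY
  have hBC : ∀ m, B m * C m ≠ 0 := fun m h0 => by
    have h1 : C m * (B m * C m) * B m = 1 := by
      rw [← Matrix.mul_assoc, h, Matrix.one_mul, h]
    rw [h0, Matrix.mul_zero, Matrix.zero_mul] at h1
    exact zero_ne_one h1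
  have hfY : ∀ p ∈ (Set.univ : Set (T × Fˣ)), f p ∈ Y := by
    rintro ⟨m, t⟩ -
    have hmG := hHG (hT m.1 m.2).1
    refine ⟨⟨H.mul_mem ((hP m).blockGL_mem hSL hmG (h m) (ha m) (hb m) (hT m.1 m.2) t).1
      (hT m.1 m.2).1, (hP m).not_isGood hSL hmG (h m) (ha m) (hb m) hq (ht m) t⟩, ?_,
      ((hP m).splits (h m) t).mem_singularSet (hBC m)⟩
    refine (Set.ncard_le_ncard ((hP m).singularSet_subset (h m) t) (Set.toFinite _)).trans ?_
    exact (Set.ncard_insert_le _ _).trans (Nat.succ_le_succ (hd m.1 m.2))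
  have hfib : ∀ p ∈ Y, {x | x ∈ (Set.univ : Set (T × Fˣ)) ∧ f x = p}.ncard ≤
      2 * (Fintype.card F - 1) := by
    intro p _
    by_cases hne : ∃ x, f x = p
    · obtain ⟨⟨m, t⟩, rfl⟩ := hne
      refine le_trans ?_ (ncard_block_le (ht m))
      have hPP : ∀ x : T × Fˣ, f x = f (m, t) → B x.1 * C x.1 = B m * C m := by
        rintro ⟨m', t'⟩ hx
        have h1 := (hP m').splits (h m') t'
        simp only [hf, Prod.mk.injEq] at hx
        rw [hx.1, hx.2] at h1
        exact h1.unique ((hP m).splits (h m) t)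
      refine Set.ncard_le_ncard_of_injOn (fun x => blockGL (h x.1) (weyl x.2)) ?_ ?_ (Set.toFinite _)
      · rintro ⟨m', t'⟩ ⟨-, hx⟩
        refine ⟨((hP m').blockGL_mem hSL (hHG (hT m'.1 m'.2).1) (h m') (ha m') (hb m')
          (hT m'.1 m'.2) t').1, (congrArg Units.val (det_blockGL (h m') _)).trans (det_weyl t'), ?_⟩
        rw [← hPP _ hx]
        change (blockGL (h m') (weyl t')).1 = 1 + B m' * C m' * ((blockGL (h m') (weyl t')).1 - 1) *
          (B m' * C m')
        rw [coe_blockGL, add_sub_cancel_left]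
        congr 1
        simp only [Matrix.mul_assoc]
        rw [← Matrix.mul_assoc (C m') (B m'), h m', Matrix.one_mul, ← Matrix.mul_assoc (C m') (B m'),
          h m', Matrix.one_mul]
      · rintro ⟨m₁, t₁⟩ ⟨-, h₁⟩ ⟨m₂, t₂⟩ ⟨-, h₂⟩ hk
        simp only at hk
        have h3 := congrArg Prod.fst (h₁.trans h₂.symm)
        simp only [hf] at h3
        rw [hk] at h3
        obtain rfl : m₁ = m₂ := Subtype.ext (mul_left_cancel h3)
        have h4 := congrArg (fun g : GL (Fin 2) F => g.1 0 1) (blockGL_injective (h m₁) hk)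
        simp only [coe_weyl, of_apply, cons_val', cons_val_one, cons_val_zero, cons_val_fin_one] at h4
        rw [Units.ext h4]
    · rw [show {x | x ∈ (Set.univ : Set (T × Fˣ)) ∧ f x = p} = ∅ from
        Set.eq_empty_of_forall_notMem fun x hx => hne ⟨x, hx.2⟩, Set.ncard_empty]
      exact Nat.zero_le _
  have h1 := ncard_le_mul_ncard (Set.toFinite Y) f hfY _ (Set.toFinite _) hfib
  have hfib' : ∀ g ∈ {g | g ∈ H ∧ ¬ IsGood G H g}, {p | p ∈ Y ∧ p.1 = g}.ncard ≤ d + 1 := by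
    intro g _
    by_cases hg : (singularSet g.1).ncard ≤ d + 1
    · refine le_trans (Set.ncard_le_ncard_of_injOn Prod.snd ?_ ?_ (Set.toFinite _)) hg
      · rintro ⟨g', e⟩ ⟨hp, rfl⟩
        exact hp.2.2
      · rintro ⟨g₁, e₁⟩ ⟨-, h₁⟩ ⟨g₂, e₂⟩ ⟨-, h₂⟩ h₃
        exact Prod.ext (h₁.trans h₂.symm) h₃
    · rw [show {p | p ∈ Y ∧ p.1 = g} = ∅ from
        Set.eq_empty_of_forall_notMem fun p hp => hg (hp.2 ▸ hp.1.2.1), Set.ncard_empty]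
      exact Nat.zero_le _
  have h2 := ncard_le_mul_ncard (Set.toFinite {g | g ∈ H ∧ ¬ IsGood G H g}) Prod.fst
    (fun p (hp : p ∈ Y) => hp.1) _ (Set.toFinite _) hfib'
  rw [Set.ncard_univ, Nat.card_prod, Nat.card_units, Nat.card_coe_set_eq,
    Nat.card_eq_fintype_card] at h1
  have hq1 : 0 < Fintype.card F - 1 := by omega
  refine Nat.le_of_mul_le_mul_right (h1.trans ((Nat.mul_le_mul_left _ h2).trans (le_of_eq ?_))) hq1
  ring

end BostonShalev

namespace BostonShalev

open Polynomial Matrix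

variable {F : Type*} [Field F]

theorem inv_val_fin_two {x : GL (Fin 2) F} (hx : x.1.det = 1) :
    (x⁻¹).1 = !![x.1 1 1, -x.1 0 1; -x.1 1 0, x.1 0 0] := by
  have h : (x⁻¹).1 = (x.1)⁻¹ := GeneralLinearGroup.coe_inv x
  rw [h, Matrix.inv_def, hx, adjugate_fin_two]
  simp

theorem isSquare_div_of_iff [Fintype F] {a b : F} (ha : a ≠ 0) (hb : b ≠ 0)
    (h : IsSquare a ↔ IsSquare b) : ∃ t : Fˣ, (t : F) ^ 2 * a = b := by
  classical
  have h1 : IsSquare (a * b) := by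
    by_cases hs : IsSquare a
    · exact hs.mul (h.1 hs)
    · rw [← quadraticChar_one_iff_isSquare (mul_ne_zero ha hb), map_mul,
        quadraticChar_neg_one_iff_not_isSquare.2 hs,
        quadraticChar_neg_one_iff_not_isSquare.2 (h.not.1 hs)]
      norm_num
  obtain ⟨s, hs⟩ := h1
  have hs0 : s ≠ 0 := by
    rintro rfl
    exact mul_ne_zero ha hb (by simpa using hs)
  refine ⟨Units.mk0 (s / a) (div_ne_zero hs0 ha), ?_⟩
  simp only [Units.val_mk0]
  field_simp
  linear_combination -hs

theorem det_mul_eq_one {x y : GL (Fin 2) F} (hx : x.1.det = 1) (hy : y.1.det = 1) :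
    (x * y).1.det = 1 := by rw [Units.val_mul, Matrix.det_mul, hx, hy, one_mul]

theorem det_inv_eq_one {x : GL (Fin 2) F} (hx : x.1.det = 1) : (x⁻¹).1.det = 1 := by
  rw [inv_val_fin_two hx, det_fin_two]
  rw [det_fin_two] at hx
  simp
  linear_combination hx

theorem exists_upper_of_ratio {K : Subgroup (GL (Fin 2) F)} {y₁ y₂ : GL (Fin 2) F} (h₁ : y₁ ∈ K)
    (h₂ : y₂ ∈ K) (hd₁ : y₁.1.det = 1) (hd₂ : y₂.1.det = 1)
    (hr : y₁.1 0 0 * y₂.1 1 0 = y₂.1 0 0 * y₁.1 1 0)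
    (hs : y₁.1 0 0 * y₁.1 1 1 ≠ y₂.1 0 0 * y₂.1 1 1) :
    ∃ z ∈ K, z.1.det = 1 ∧ z.1 1 0 = 0 ∧ z.1 0 1 ≠ 0 := by
  refine ⟨y₁⁻¹ * y₂, K.mul_mem (K.inv_mem h₁) h₂, det_mul_eq_one (det_inv_eq_one hd₁) hd₂, ?_, ?_⟩
  · rw [Units.val_mul, inv_val_fin_two hd₁]
    simp [Matrix.mul_apply, Fin.sum_univ_two]
    linear_combination hr
  · rw [Units.val_mul, inv_val_fin_two hd₁]
    simp only [Matrix.mul_apply, Fin.sum_univ_two]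
    simp
    intro h
    refine hs ?_
    rw [det_fin_two] at hd₁ hd₂
    linear_combination (-y₁.1 0 0 * y₁.1 1 1) * hd₂ + (y₂.1 0 0 * y₂.1 1 1) * hd₁ -
      y₁.1 1 1 * y₂.1 0 1 * hr - y₂.1 0 0 * y₁.1 1 0 * h

theorem card_units_le_natDegree {A : Finset Fˣ} {P : F[X]} (hP : P ≠ 0)
    (h : ∀ t ∈ A, P.eval (t : F) = 0) : A.card ≤ P.natDegree := by
  classical
  rw [← Finset.card_map ⟨fun t : Fˣ => (t : F), Units.val_injective⟩]
  refine card_le_degree_of_subset_roots fun x hx => ?_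
  obtain ⟨t, ht, rfl⟩ := Finset.mem_map.1 hx
  exact (mem_roots hP).2 (h t ht)

theorem exists_upper_of_ne_zero [Fintype F] {K : Subgroup (GL (Fin 2) F)}
    (hq : 13 < Fintype.card F) (hT : ∀ t, torus t ∈ K) {y : GL (Fin 2) F} (hy : y ∈ K)
    (hdet : y.1.det = 1) (h00 : y.1 0 0 ≠ 0) (h01 : y.1 0 1 ≠ 0) (h10 : y.1 1 0 ≠ 0)
    (h11 : y.1 1 1 ≠ 0) : ∃ z ∈ K, z.1.det = 1 ∧ z.1 1 0 = 0 ∧ z.1 0 1 ≠ 0 := by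
  classical
  by_contra hK
  set s := y.1 0 0 * y.1 1 1 with hs
  have hbc : y.1 0 1 * y.1 1 0 = s - 1 := by
    rw [det_fin_two] at hdet
    linear_combination -hdet
  have hs0 : s ≠ 0 := mul_ne_zero h00 h11
  have hs1 : s - 1 ≠ 0 := hbc ▸ mul_ne_zero h01 h10
  set k := s * (s - 1) with hk
  have hk0 : k ≠ 0 := mul_ne_zero hs0 hs1
  set Y : Fˣ → GL (Fin 2) F := fun t => y * torus t * y⁻¹ with hY
  have hYK : ∀ t, Y t ∈ K := fun t => K.mul_mem (K.mul_mem hy (hT t)) (K.inv_mem hy)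
  have hYd : ∀ t, (Y t).1.det = 1 := fun t =>
    det_mul_eq_one (det_mul_eq_one hdet (det_torus t)) (det_inv_eq_one hdet)
  have hYv : ∀ t, (Y t).1 = !![s * t - (s - 1) * (t : F)⁻¹, y.1 0 0 * y.1 0 1 * ((t : F)⁻¹ - t);
      y.1 1 0 * y.1 1 1 * (t - (t : F)⁻¹), s * (t : F)⁻¹ - (s - 1) * t] := by
    intro t
    rw [hY]
    simp only [Units.val_mul]
    rw [inv_val_fin_two hdet, coe_torus, ← hbc, hs]
    ext i j
    fin_cases i <;> fin_cases j <;> simp [Matrix.mul_apply, Fin.sum_univ_two] <;> ring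
  set σ : Fˣ → F := fun t => 1 - k * (t - (t : F)⁻¹) ^ 2 with hσ
  have hYσ : ∀ t, (Y t).1 0 0 * (Y t).1 1 1 = σ t := by
    intro t
    have := t.ne_zero
    rw [hYv]
    simp [hσ, hk]
    field_simp
    ring
  set Λ : Finset Fˣ := Finset.univ.filter fun t => (Y t).1 0 0 ≠ 0 ∧ (Y t).1 1 0 ≠ 0 with hΛ
  have hcard : Fintype.card F - 5 ≤ Λ.card := by
    set P : F[X] := (X ^ 2 - 1) * (C s * X ^ 2 - C (s - 1)) with hP
    have hP0 : P ≠ 0 := fun h => hs1 <| by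
      have := congrArg (eval 0) h
      simpa [hP] using this
    have hPd : P.natDegree ≤ 4 := by rw [hP]; compute_degree
    have hc := card_units_le_natDegree (A := Λᶜ) hP0 fun t ht => by
      have ht0 := t.ne_zero
      simp only [hΛ, Finset.mem_compl, Finset.mem_filter, Finset.mem_univ, true_and, not_and_or,
        not_not, hYv] at ht
      have : (t : F) ^ 2 - 1 = 0 ∨ s * (t : F) ^ 2 - (s - 1) = 0 := by
        rcases ht with ht | ht
        · right
          simp at ht
          field_simp at ht
          linear_combination ht
        · left
          simp [h10, h11] at ht
          field_simp at ht
          linear_combination ht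
      simpa [hP] using this
    rw [Finset.card_compl, Fintype.card_units] at hc
    omega
  have hfib : ∀ v, (Λ.filter fun t => σ t = v).card ≤ 4 := by
    intro v
    set P : F[X] := C k * (X ^ 2 - 1) ^ 2 + C (v - 1) * X ^ 2 with hP
    have hP0 : P ≠ 0 := fun h => hk0 <| by
      have := congrArg (eval 0) h
      simpa [hP] using this
    have hPd : P.natDegree ≤ 4 := by rw [hP]; compute_degree
    refine (card_units_le_natDegree hP0 fun t ht => ?_).trans hPd
    have ht0 := t.ne_zero
    rw [hP, ← (Finset.mem_filter.1 ht).2]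
    simp [hσ]
    field_simp
    ring
  have himg : 2 < (Λ.image σ).card := by
    by_contra! h
    have := Finset.card_le_mul_card_image (f := σ) Λ 4 (fun v _ => hfib v)
    omega
  have hiff : ∀ t₁ ∈ Λ, ∀ t₂ ∈ Λ, σ t₁ ≠ σ t₂ →
      ¬ (IsSquare ((Y t₁).1 0 0 / (Y t₁).1 1 0) ↔ IsSquare ((Y t₂).1 0 0 / (Y t₂).1 1 0)) := by
    intro t₁ h₁ t₂ h₂ hne h
    rw [hΛ, Finset.mem_filter] at h₁ h₂
    obtain ⟨u, hu⟩ := isSquare_div_of_iff (div_ne_zero h₁.2.1 h₁.2.2) (div_ne_zero h₂.2.1 h₂.2.2) h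
    have hu0 := u.ne_zero
    have hc₁ := h₁.2.2
    have hc₂ := h₂.2.2
    refine hK (exists_upper_of_ratio (K.mul_mem (hT u) (hYK t₁)) (hYK t₂)
      (det_mul_eq_one (det_torus u) (hYd t₁)) (hYd t₂) ?_ ?_)
    · rw [Units.val_mul, coe_torus]
      simp [Matrix.mul_apply, Fin.sum_univ_two]
      field_simp at hu ⊢
      linear_combination hu
    · rw [hYσ, Units.val_mul, coe_torus]
      simp [Matrix.mul_apply, Fin.sum_univ_two]
      field_simp
      rw [hYσ]
      exact hne
  obtain ⟨a, b, c, ha, hb, hc, hab, hac, hbc'⟩ := Finset.two_lt_card_iff.1 himg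
  obtain ⟨t₁, h₁, rfl⟩ := Finset.mem_image.1 ha
  obtain ⟨t₂, h₂, rfl⟩ := Finset.mem_image.1 hb
  obtain ⟨t₃, h₃, rfl⟩ := Finset.mem_image.1 hc
  have := hiff t₁ h₁ t₂ h₂ hab
  have := hiff t₁ h₁ t₃ h₃ hac
  have := hiff t₂ h₂ t₃ h₃ hbc'
  tauto

theorem exists_upper [Fintype F] {K : Subgroup (GL (Fin 2) F)} (hq : 13 < Fintype.card F)
    (hT : ∀ t, torus t ∈ K) (hW : ∀ t, weyl t ∈ K) {y : GL (Fin 2) F} (hy : y ∈ K)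
    (hdet : y.1.det = 1) (h₁ : ¬ (y.1 0 0 = 0 ∧ y.1 1 1 = 0)) (h₂ : ¬ (y.1 0 1 = 0 ∧ y.1 1 0 = 0)) :
    ∃ z ∈ K, z.1.det = 1 ∧ z.1 1 0 = 0 ∧ z.1 0 1 ≠ 0 := by
  by_cases h10 : y.1 1 0 = 0
  · exact ⟨y, hy, hdet, h10, fun h => h₂ ⟨h, h10⟩⟩
  by_cases h01 : y.1 0 1 = 0
  · refine ⟨weyl 1 * y * (weyl 1)⁻¹, K.mul_mem (K.mul_mem (hW 1) hy) (K.inv_mem (hW 1)),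
      det_mul_eq_one (det_mul_eq_one (det_weyl 1) hdet) (det_inv_eq_one (det_weyl 1)), ?_, ?_⟩ <;>
    · rw [Units.val_mul, Units.val_mul, inv_val_fin_two (det_weyl 1), coe_weyl]
      simp [Matrix.mul_apply, Fin.sum_univ_two, vecMul, dotProduct, h01, h10]
  by_cases h11 : y.1 1 1 = 0
  · refine ⟨y * weyl 1, K.mul_mem hy (hW 1), det_mul_eq_one hdet (det_weyl 1), ?_, ?_⟩
    · rw [Units.val_mul, coe_weyl]
      simp [Matrix.mul_apply, Fin.sum_univ_two, h11]
    · rw [Units.val_mul, coe_weyl]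
      simp [Matrix.mul_apply, Fin.sum_univ_two]
      exact fun h => h₁ ⟨h, h11⟩
  by_cases h00 : y.1 0 0 = 0
  · refine ⟨weyl 1 * y, K.mul_mem (hW 1) hy, det_mul_eq_one (det_weyl 1) hdet, ?_, ?_⟩ <;>
    · rw [Units.val_mul, coe_weyl]
      simp [Matrix.mul_apply, Fin.sum_univ_two, h00, h11]
  exact exists_upper_of_ne_zero hq hT hy hdet h00 h01 h10 h11

/-- The unipotent matrix `!![1, c; 0, 1]`. -/
def upper (c : F) : GL (Fin 2) F := transvectionGL 0 1 (by decide) c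

theorem coe_upper (c : F) : (upper c).1 = !![1, c; 0, 1] := by
  ext i j
  fin_cases i <;> fin_cases j <;> simp [upper, transvectionGL, transvection]

theorem upper_add (c d : F) : upper (c + d) = upper c * upper d := by
  apply Units.ext
  rw [Units.val_mul, coe_upper, coe_upper, coe_upper]
  ext i j
  fin_cases i <;> fin_cases j <;> simp [Matrix.mul_apply, Fin.sum_univ_two, add_comm]

theorem upper_neg (c : F) : upper (-c) = (upper c)⁻¹ := by
  rw [eq_inv_iff_mul_eq_one, ← upper_add, neg_add_cancel]
  apply Units.ext
  rw [coe_upper, Units.val_one]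
  ext i j
  fin_cases i <;> fin_cases j <;> simp

theorem torus_mul_upper (t : Fˣ) (c : F) :
    torus t * upper c * (torus t)⁻¹ = upper ((t : F) ^ 2 * c) := by
  have := t.ne_zero
  rw [mul_inv_eq_iff_eq_mul]
  apply Units.ext
  simp only [Units.val_mul, coe_upper, coe_torus]
  ext i j
  fin_cases i <;> fin_cases j <;> simp [Matrix.mul_apply, Fin.sum_univ_two]
  field_simp

theorem upper_mem [Fintype F] {K : Subgroup (GL (Fin 2) F)} (hT : ∀ t, torus t ∈ K)
    {z : GL (Fin 2) F} (hz : z ∈ K) (hdet : z.1.det = 1) (h10 : z.1 1 0 = 0) (h01 : z.1 0 1 ≠ 0)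
    (c : F) : upper c ∈ K := by
  have h00 : z.1 0 0 ≠ 0 := by
    intro h
    rw [det_fin_two, h, h10] at hdet
    simp at hdet
  have h11 : z.1 0 0 * z.1 1 1 = 1 := by
    rw [det_fin_two, h10] at hdet
    linear_combination hdet
  obtain ⟨x, hx0, hx⟩ : ∃ x : F, x ≠ 0 ∧ upper x ∈ K := by
    refine ⟨z.1 0 1 / z.1 0 0, div_ne_zero h01 h00, ?_⟩
    have h : upper (z.1 0 1 / z.1 0 0) = (torus (Units.mk0 _ h00))⁻¹ * z := by
      apply Units.ext
      rw [Units.val_mul, inv_val_fin_two (det_torus _), coe_torus, coe_upper]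
      ext i j
      fin_cases i <;> fin_cases j <;>
        simp [Matrix.mul_apply, Fin.sum_univ_two, h00, h10, h11, div_eq_inv_mul]
    exact h ▸ K.mul_mem (K.inv_mem (hT _)) hz
  have hsq : ∀ t : F, upper (t ^ 2 * x) ∈ K := by
    intro t
    by_cases ht : t = 0
    · rw [ht]
      have := K.mul_mem hx (K.inv_mem hx)
      rw [← upper_neg, ← upper_add] at this
      simpa using this
    · have := K.mul_mem (K.mul_mem (hT (Units.mk0 t ht)) hx) (K.inv_mem (hT (Units.mk0 t ht)))
      rwa [torus_mul_upper] at this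
  by_cases h2 : ringChar F = 2
  · obtain ⟨t, ht⟩ := FiniteField.isSquare_of_char_two h2 (c / x)
    have := hsq t
    rwa [pow_two, ← ht, div_mul_cancel₀ _ hx0] at this
  · have h2' : (2 : F) ≠ 0 := Ring.two_ne_zero h2
    have := K.mul_mem (hsq ((c / x + 1) / 2)) (K.inv_mem (hsq ((c / x - 1) / 2)))
    rw [← upper_neg, ← upper_add] at this
    convert this using 2
    field_simp
    ring

end BostonShalev

namespace BostonShalev

open Polynomial Matrix

variable {F : Type*} [Field F] {ι κ : Type*} [Fintype ι] [DecidableEq ι] [Fintype κ] [DecidableEq κ]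

theorem exists_perm_apply_apply {i j a b : κ} (hij : i ≠ j) (hab : a ≠ b) :
    ∃ σ : Equiv.Perm κ, σ i = a ∧ σ j = b := by
  refine ⟨Equiv.swap (Equiv.swap i a j) b * Equiv.swap i a, ?_, ?_⟩
  · rw [Equiv.Perm.mul_apply, Equiv.swap_apply_left, Equiv.swap_apply_of_ne_of_ne _ hab]
    intro h
    exact hij ((Equiv.swap i a).injective ((Equiv.swap_apply_left i a).trans h))
  · rw [Equiv.Perm.mul_apply, Equiv.swap_apply_left]

theorem exists_monomial {i j a b : κ} (hij : i ≠ j) (hab : a ≠ b) : ∃ x : GL κ F, x.1.det = 1 ∧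
    (∀ y : κ → F, ∃ y', x.1 * diagonal y = diagonal y' * x.1) ∧
    ∀ c, ∃ c', x * transvectionGL a b hab c' * x⁻¹ = transvectionGL i j hij c := by
  obtain ⟨σ, hi, hj⟩ := exists_perm_apply_apply hij hab
  set s : F := ((Equiv.Perm.sign σ : ℤ) : F) with hs
  have hss : s * s = 1 := by
    rw [hs, ← Int.cast_mul, ← Units.val_mul, Int.units_mul_self]
    simp
  set d : κ → F := Function.update 1 i s with hd
  have hd0 : ∀ k, d k ≠ 0 := by
    intro k
    by_cases hk : k = i
    · subst hk
      rw [hd, Function.update_self]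
      exact left_ne_zero_of_mul_eq_one hss
    · rw [hd, Function.update_of_ne hk]
      exact one_ne_zero
  set A : Matrix κ κ F := σ.permMatrix F * diagonal d with hA
  have hdet : A.det = 1 := by
    rw [hA, Matrix.det_mul, det_permutation, det_diagonal, hd, Finset.prod_update_of_mem
      (Finset.mem_univ i)]
    simpa [hs] using hss
  have hAe : ∀ k l, A k l = if σ k = l then d l else 0 := by
    intro k l
    rw [hA, mul_diagonal, Equiv.Perm.permMatrix, PEquiv.toMatrix_apply]
    simp [Equiv.toPEquiv_apply]
  refine ⟨GeneralLinearGroup.mkOfDetNeZero A (by simp [hdet]), hdet, fun y => ⟨y ∘ σ, ?_⟩,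
    fun c => ⟨c * d b / d a, ?_⟩⟩
  · change A * diagonal y = diagonal (y ∘ σ) * A
    ext k l
    rw [mul_diagonal, diagonal_mul, hAe]
    split_ifs with h
    · simp [← h, mul_comm]
    · simp
  · rw [mul_inv_eq_iff_eq_mul]
    apply Units.ext
    change A * transvection a b _ = transvection i j c * A
    rw [transvection, transvection, Matrix.mul_add, Matrix.add_mul, Matrix.mul_one, Matrix.one_mul]
    congr 1
    ext k l
    have h1 : (A * single a b (c * d b / d a)) k l = if b = l then A k a * (c * d b / d a) else 0 := by
      split_ifs with h
      · subst h; exact mul_single_apply_same ..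
      · exact mul_single_apply_of_ne _ _ _ _ _ (Ne.symm h) _
    have h2 : (single i j c * A) k l = if i = k then c * A j l else 0 := by
      split_ifs with h
      · subst h; exact single_mul_apply_same ..
      · exact single_mul_apply_of_ne _ _ _ _ _ (Ne.symm h) _
    rw [h1, h2, hAe, hAe, hj]
    have := hd0 a
    by_cases hk : i = k
    · subst hk
      by_cases hl : b = l
      · subst hl
        simp [hi]
        field_simp
      · simp [hl]
    · have : σ k ≠ a := fun h => hk (σ.injective (hi.trans h.symm))
      simp [hk, this]

theorem blockGL_planeB_upper {i j : κ} (hij : i ≠ j) (c : F) :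
    blockGL (planeB_transpose_mul hij) (upper c) = transvectionGL i j hij c := by
  apply Units.ext
  rw [coe_blockGL, coe_upper]
  change _ = transvection i j c
  rw [transvection]
  congr 1
  ext k l
  simp [planeB, Matrix.mul_apply, Fin.sum_univ_two, single_apply, one_fin_two]
  by_cases hk : k = i <;> by_cases hl : l = j <;> simp [hk, hl]
  · exact fun h => absurd h.symm hl
  · exact fun h => absurd h.symm hk
  · exact fun h => absurd h.symm hk

theorem IsPlane.of_coprime {m B C} {a b : F} {p : F[X]} (hB : m * B = B * diagonal ![a, b])
    (hC : C * m = diagonal ![a, b] * C) (hp : IsCoprime (X ^ 2 + Polynomial.C (a * b)) p)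
    (h0 : aeval m p * (1 - B * C) = 0) : IsPlane (ι := ι) m a b B C := by
  obtain ⟨s, w, hsw⟩ := hp
  refine ⟨hB, hC, s, ?_⟩
  have h1 := congrArg (aeval m) hsw
  rw [map_add, map_mul (aeval m) w, map_one] at h1
  rw [eq_sub_of_add_eq h1, Matrix.sub_mul, Matrix.mul_assoc, h0, Matrix.mul_zero, sub_zero,
    Matrix.one_mul]

section

variable {r : ℕ} {G H : Subgroup (GL ι F)} {m : GL ι F} {B : Matrix ι (Fin (r + 2)) F}
  {C : Matrix (Fin (r + 2)) ι F}

theorem IsGood.blockGL_mem_of_not_isTame [Fintype F] (hq : 13 < Fintype.card F)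
    (hSL : ∀ g : GL ι F, g.1.det = 1 → g ∈ G) (hm : IsGood G H m) (hmG : m ∈ G) (h : C * B = 1)
    {α : Fin (r + 2) → F} (hα : ∀ i, α i ≠ 0) (hB : m.1 * B = B * diagonal α)
    (hC : C * m.1 = diagonal α * C) {B' : Matrix ι (Fin 2) F} {C' : Matrix (Fin 2) ι F}
    (hB' : B' = B * planeB F (0 : Fin (r + 2)) 1) (hC' : C' = (planeB F (0 : Fin (r + 2)) 1)ᵀ * C)
    (h' : C' * B' = 1)
    (hP : IsPlane m.1 (α 0) (α 1) B' C') (ht : ¬ IsTame H h') {x : GL (Fin (r + 2)) F}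
    (hx : x.1.det = 1) : blockGL h x ∈ H := by
  have hmem := fun t => hP.blockGL_mem hSL hmG h' (hα 0) (hα 1) hm t
  rw [IsTame] at ht
  push Not at ht
  obtain ⟨y, hyd, hy, hy1, hy2⟩ := ht
  obtain ⟨z, hz, hzd, hz10, hz01⟩ := exists_upper (K := H.comap (blockGL h')) hq
    (fun t => (hmem t).2) (fun t => (hmem t).1) hy hyd (fun h => hy1 h.1 h.2)
    (fun h => hy2 h.1 h.2)
  have hup := upper_mem (K := H.comap (blockGL h')) (fun t => (hmem t).2) hz hzd hz10 hz01
  have h01 : (0 : Fin (r + 2)) ≠ 1 := by simp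
  have hE : ∀ c, blockGL h (transvectionGL 0 1 h01 c) ∈ H := by
    intro c
    have h1 : blockGL h (transvectionGL 0 1 h01 c) = blockGL h' (upper c) := by
      rw [← blockGL_planeB_upper]
      apply Units.ext
      simp only [coe_blockGL, hB', hC', add_sub_cancel_left, Matrix.mul_assoc]
    rw [h1]
    exact hup c
  have key : (SpecialLinearGroup.toGL (n := Fin (r + 2)) (R := F)).range ≤ H.comap (blockGL h) := by
    refine sl_le_of_transvection_mem _ fun i j hij c => ?_
    obtain ⟨x, hxd, hxy, hxc⟩ := exists_monomial (F := F) hij h01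
    obtain ⟨c', hc'⟩ := hxc c
    rw [← hc']
    have hxH : x ∈ H.comap (blockGL h) := by
      refine hm.blockGL_mem hSL hmG h (y := GeneralLinearGroup.mkOfDetNeZero (diagonal α) (by
        simpa [Finset.prod_eq_zero_iff] using hα)) hB hC hxd ?_
      obtain ⟨y', hy'⟩ := hxy α
      have h1 : (x * GeneralLinearGroup.mkOfDetNeZero (diagonal α) (by
          simpa [Finset.prod_eq_zero_iff] using hα) * x⁻¹).1 = diagonal y' := by
        have h2 : x.1 * (x⁻¹).1 = 1 := by rw [← Units.val_mul, mul_inv_cancel, Units.val_one]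
        rw [Units.val_mul, Units.val_mul]
        change x.1 * diagonal α * _ = _
        rw [hy', Matrix.mul_assoc, h2, Matrix.mul_one]
      refine Units.ext ?_
      refine (Units.val_mul _ _).trans ?_
      refine Eq.trans ?_ (Units.val_mul _ _).symm
      rw [h1]
      change diagonal y' * diagonal α = diagonal α * diagonal y'
      rw [diagonal_mul_diagonal, diagonal_mul_diagonal]
      simp only [mul_comm]
    exact Subgroup.mul_mem _ (Subgroup.mul_mem _ hxH (hE c')) (Subgroup.inv_mem _ hxH)
  exact key (det_eq_one_iff_mem_range.2 hx)

end

end BostonShalev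

namespace BostonShalev

open Polynomial Matrix

variable {F : Type*} [Field F]

/-- The parameters `δ` for which `X ^ 2 + δ` and `f` have a common factor. -/
def badParams (f : F[X]) : Set F := {δ | ¬ IsCoprime (X ^ 2 + C δ) f}

/-- A polynomial with `r + 2` distinct simple nonzero roots `α i`, such that `X ^ 2 + α 0 * α 1` is
coprime to the cofactor of `(X - α 0) * (X - α 1)`, and with few bad parameters. -/
def HasFrame (r : ℕ) (f : F[X]) : Prop :=
  ∃ (α : Fin (r + 2) → F) (h : F[X]), Function.Injective α ∧ (∀ i, α i ≠ 0) ∧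
    f = (∏ i, (X - C (α i))) * h ∧ (∀ i, h.eval (α i) ≠ 0) ∧
    IsCoprime (X ^ 2 + C (α 0 * α 1)) ((∏ i : Fin r, (X - C (α i.succ.succ))) * h) ∧
    (badParams f).ncard ≤ 11

section

variable [Fintype F] {ι : Type*} [Fintype ι] [DecidableEq ι] {r : ℕ} {G H : Subgroup (GL ι F)}
  {m : GL ι F}

theorem exists_isPlane_of_hasFrame (hq : 13 < Fintype.card F)
    (hSL : ∀ g : GL ι F, g.1.det = 1 → g ∈ G) (hm : IsGood G H m) (hmG : m ∈ G)
    (hf : HasFrame r m.1.charpoly) : ∃ (a b : F) (B : Matrix ι (Fin 2) F) (C : Matrix (Fin 2) ι F)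
      (h : C * B = 1), a ≠ 0 ∧ b ≠ 0 ∧ IsPlane m.1 a b B C ∧ (¬ IsTame H h →
      ∃ (B' : Matrix ι (Fin (r + 2)) F) (C' : Matrix (Fin (r + 2)) ι F) (h' : C' * B' = 1),
        ∀ x : GL (Fin (r + 2)) F, x.1.det = 1 → blockGL h' x ∈ H) := by
  obtain ⟨α, p, hα, hα0, hmp, hpα, hcop, -⟩ := hf
  obtain ⟨B, C', hCB, hB, hC, h0⟩ := exists_frame hα hmp hpα
  have h01 : (0 : Fin (r + 2)) ≠ 1 := by simp
  have hdiag : diagonal α * planeB F (0 : Fin (r + 2)) 1 =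
      planeB F (0 : Fin (r + 2)) 1 * diagonal ![α 0, α 1] := by
    ext k l
    rw [diagonal_mul, mul_diagonal]
    simp only [planeB, of_apply]
    split_ifs with h
    · subst h
      fin_cases l <;> simp
    · simp
  have hdiag' : (planeB F (0 : Fin (r + 2)) 1)ᵀ * diagonal α =
      diagonal ![α 0, α 1] * (planeB F (0 : Fin (r + 2)) 1)ᵀ := by
    have := congrArg transpose hdiag
    simpa only [transpose_mul, diagonal_transpose] using this
  have hP : (planeB F (0 : Fin (r + 2)) 1)ᵀ * C' * (B * planeB F (0 : Fin (r + 2)) 1) = 1 := by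
    rw [Matrix.mul_assoc, ← Matrix.mul_assoc C', hCB, Matrix.one_mul, planeB_transpose_mul h01]
  have hplane : IsPlane m.1 (α 0) (α 1) (B * planeB F (0 : Fin (r + 2)) 1)
      ((planeB F (0 : Fin (r + 2)) 1)ᵀ * C') := by
    refine IsPlane.of_coprime ?_ ?_ hcop h0
    · rw [← Matrix.mul_assoc, hB, Matrix.mul_assoc, hdiag, Matrix.mul_assoc]
    · rw [Matrix.mul_assoc, hC, ← Matrix.mul_assoc, hdiag', Matrix.mul_assoc]
  exact ⟨α 0, α 1, _, _, hP, hα0 0, hα0 1, hplane, fun ht => ⟨B, C', hCB, fun x hx =>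
    hm.blockGL_mem_of_not_isTame hq hSL hmG hCB hα0 hB hC rfl rfl hP hplane ht hx⟩⟩

end

section

variable [Fintype F] {n r : ℕ} {G H : Subgroup (GL (Fin (n + 1)) F)}

theorem exists_block_or_ncard_le (hG : ContainsSL G) (hHG : H ≤ G) (hq : 13 < Fintype.card F)
    {S : Set F[X]} (hS : S ⊆ classPolys G) (hSf : ∀ f ∈ S, HasFrame r f) :
    (∃ (B : Matrix (Fin (n + 1)) (Fin (r + 2)) F) (C : Matrix (Fin (r + 2)) (Fin (n + 1)) F)
      (h : C * B = 1), ∀ x : GL (Fin (r + 2)) F, x.1.det = 1 → blockGL h x ∈ H) ∨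
    (S.ncard : ℝ) * (Fintype.card F - 1) ≤
      51 * ((classPolys G).ncard + Fintype.card F * missed G H) := by
  classical
  rw [or_iff_not_imp_left]
  intro hno
  have hSL : ∀ g : GL (Fin (n + 1)) F, g.1.det = 1 → g ∈ G := fun g hg =>
    hG (det_eq_one_iff_mem_range.2 hg)
  set X : Set (GL (Fin (n + 1)) F) := {g | g ∈ G ∧ g.1.charpoly ∈ S} with hX
  set T : Set (GL (Fin (n + 1)) F) := {g | g ∈ X ∧ IsGood G H g} with hT
  have h1 := ncard_mul_le_ncard_charpoly_mem hG hS
  have h2 := card_mul_le_of_conj_invariant hHG X (fun g hg => hg.1) fun g hg x hx =>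
    ⟨G.mul_mem (G.mul_mem hx hg.1) (G.inv_mem hx), by rw [charpoly_conj]; exact hg.2⟩
  have h3 := card_bad_mul_le hHG
  have h4 := ncard_derangements_le hG H
  have h5 : T.ncard ≤ 2 * (11 + 1) * {g | g ∈ H ∧ ¬ IsGood G H g}.ncard := by
    refine ncard_tame_le hHG hSL (by omega) (fun m hm => hm.2) ?_ ?_
    · intro m hm
      obtain ⟨α, p, -, -, -, -, -, hbad⟩ := hSf _ hm.1.2
      exact (Set.ncard_le_ncard singularSet_subset (Set.toFinite _)).trans hbad
    · intro m hm
      obtain ⟨a, b, B, C, h, ha, hb, hP, ht⟩ :=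
        exists_isPlane_of_hasFrame hq hSL hm.2 hm.1.1 (hSf _ hm.1.2)
      exact ⟨a, b, B, C, h, ha, hb, hP, by_contra fun h => hno (ht h)⟩
  have h6 : {g | g ∈ X ∧ g ∈ H}.ncard ≤ T.ncard + {g | g ∈ H ∧ ¬ IsGood G H g}.ncard := by
    refine (Set.ncard_le_ncard (t := T ∪ {g | g ∈ H ∧ ¬ IsGood G H g}) ?_ (Set.toFinite _)).trans
      (Set.ncard_union_le _ _)
    rintro g ⟨hgX, hgH⟩
    by_cases hg : IsGood G H g
    · exact Or.inl ⟨hgX, hg⟩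
    · exact Or.inr ⟨hgH, hg⟩
  have hH0 : 0 < Nat.card H := Nat.card_pos
  have hG0 : 0 < Nat.card G := Nat.card_pos
  have h7 : X.ncard ≤ 51 * (derangements G H).ncard := by
    refine Nat.le_of_mul_le_mul_left ?_ hH0
    have h8 : {g | g ∈ X ∧ g ∈ H}.ncard ≤ 25 * {g | g ∈ H ∧ ¬ IsGood G H g}.ncard := by omega
    nlinarith [Nat.mul_le_mul_left (Nat.card G) h8]
  have hq1 : 1 ≤ Fintype.card F := by omega
  have hq0 : (0 : ℝ) < Fintype.card F := by exact_mod_cast hq1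
  have hN0 : (0 : ℝ) ≤ (classPolys G).ncard := by positivity
  rify [hq1] at h1 h7
  have hG0' : (0 : ℝ) < Nat.card G := by exact_mod_cast hG0
  rcases hN0.eq_or_lt with hN | hN
  · have : S.ncard = 0 := by
      have := Set.ncard_le_ncard hS (finite_classPolys G)
      have : (classPolys G).ncard = 0 := by exact_mod_cast hN.symm
      omega
    rw [this]
    simp
    positivity
  refine le_of_mul_le_mul_right (h1.trans ?_) hG0'
  calc _ ≤ ((classPolys G).ncard : ℝ) * Fintype.card F * (51 * (Nat.card G *
        (1 / Fintype.card F + missed G H / (classPolys G).ncard))) := by gcongr; linarith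
    _ = _ := by field_simp

end

end BostonShalev

namespace BostonShalev

open Polynomial Finset

variable {F : Type*} [Field F]

theorem isCoprime_X_sub_C {p : F[X]} {a : F} (h : p.eval a ≠ 0) : IsCoprime p (X - C a) :=
  ((irreducible_X_sub_C a).coprime_iff_not_dvd.2 fun hd => h (dvd_iff_isRoot.1 hd)).symm

theorem badParams_X_sub_C_mul_subset (a : F) (f : F[X]) :
    badParams ((X - C a) * f) ⊆ insert (-a ^ 2) (badParams f) := by
  intro δ hδ
  rw [Set.mem_insert_iff, or_iff_not_imp_left]
  refine fun h hf => hδ ((isCoprime_X_sub_C ?_).mul_right hf)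
  simp only [eval_add, eval_pow, eval_X, eval_C]
  exact fun h0 => h (by linear_combination h0)

variable [Fintype F]

theorem ncard_badParams_X_sub_C_mul_le (a : F) (f : F[X]) :
    (badParams ((X - C a) * f)).ncard ≤ (badParams f).ncard + 1 :=
  (Set.ncard_le_ncard (badParams_X_sub_C_mul_subset a f) (Set.toFinite _)).trans
    (Set.ncard_insert_le _ _)

open scoped Classical in
/-- The number of roots of `f` plus the number of divisors of `f` of the form `X ^ 2 + δ`. -/
noncomputable def weight (f : F[X]) : ℕ := numRoots f + (univ.filter fun δ : F => X ^ 2 + C δ ∣ f).card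

theorem ncard_badParams_le_weight {f : F[X]} : (badParams f).ncard ≤ weight f := by
  classical
  have h : badParams f ⊆ (fun a => -a ^ 2) '' {a | f.IsRoot a} ∪ {δ : F | X ^ 2 + C δ ∣ f} := by
    intro δ hδ
    by_cases hr : ∃ a, f.IsRoot a ∧ -a ^ 2 = δ
    · exact Or.inl hr
    · push Not at hr
      right
      by_contra hd
      have hm : (X ^ 2 + C δ : F[X]).Monic := by monicity!
      have hdeg : (X ^ 2 + C δ : F[X]).natDegree = 2 := by compute_degree!
      by_cases hroot : ∃ a : F, (X ^ 2 + C δ : F[X]).IsRoot a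
      · obtain ⟨a, ha⟩ := hroot
        have ha' : δ = -a ^ 2 := by
          simp only [IsRoot.def, eval_add, eval_pow, eval_X, eval_C] at ha
          linear_combination ha
        have he : (X ^ 2 + C δ : F[X]) = (X - C a) * (X - C (-a)) := by
          rw [ha']
          simp only [map_neg, map_pow]
          ring
        refine hδ ?_
        rw [he]
        exact (isCoprime_X_sub_C fun h => hr a h ha'.symm).symm.mul_left
          (isCoprime_X_sub_C fun h => hr (-a) h (by rw [neg_sq, ha'])).symm
      · push Not at hroot
        have hirr : Irreducible (X ^ 2 + C δ : F[X]) := by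
          rw [irreducible_iff_roots_eq_zero_of_degree_le_three hdeg.ge (by omega)]
          exact Multiset.eq_zero_of_forall_notMem fun a ha => hroot a (isRoot_of_mem_roots ha)
        exact hδ (hirr.coprime_iff_not_dvd.2 hd)
  refine (Set.ncard_le_ncard h (Set.toFinite _)).trans ((Set.ncard_union_le _ _).trans ?_)
  refine add_le_add (Set.ncard_image_le (Set.toFinite _)) ?_
  rw [Set.ncard_eq_toFinset_card']
  simp

theorem sum_weight_le (n : ℕ) : ∑ f ∈ mon F n, weight f ≤ 2 * Fintype.card F ^ n := by
  classical
  simp only [weight]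
  rw [sum_add_distrib, two_mul]
  refine add_le_add (sum_numRoots_le n) ?_
  refine (sum_card_bipartiteAbove_eq_sum_card_bipartiteBelow
    (fun (f : F[X]) (δ : F) => X ^ 2 + C δ ∣ f)).trans_le ?_
  have hm : ∀ δ : F, (X ^ 2 + C δ : F[X]).Monic := fun δ => by monicity!
  have hdeg : ∀ δ : F, (X ^ 2 + C δ : F[X]).natDegree = 2 := fun δ => by compute_degree!
  rcases Nat.lt_or_ge n 2 with hn | hn
  · rw [sum_eq_zero]
    · exact Nat.zero_le _
    · intro δ _
      rw [card_eq_zero, bipartiteBelow, filter_eq_empty_iff]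
      intro f hf hd
      have hf' := mem_mon.1 hf
      have := natDegree_le_of_dvd hd hf'.1.ne_zero
      rw [hdeg, hf'.2] at this
      omega
  · obtain ⟨k, rfl⟩ := Nat.exists_eq_add_of_le hn
    calc _ ≤ ∑ δ : F, Fintype.card F ^ k := sum_le_sum fun δ _ =>
          card_filter_dvd_le ⟨hm δ, hdeg δ⟩
      _ ≤ Fintype.card F ^ (2 + k) := by
        rw [sum_const, card_univ, smul_eq_mul, ← pow_succ']
        exact Nat.pow_le_pow_right Fintype.card_pos (by omega)

open scoped Classical in
/-- Monic polynomials of degree `d` with nonzero constant term and weight at most `8`. -/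
noncomputable def lightPolys (F : Type*) [Field F] [Fintype F] (d : ℕ) : Finset F[X] :=
  (mon F d).filter fun h => h.coeff 0 ≠ 0 ∧ weight h ≤ 8

theorem pow_le_two_mul_card_lightPolys (hq : 4 ≤ Fintype.card F) (d : ℕ) :
    Fintype.card F ^ d ≤ 2 * (lightPolys F d).card := by
  classical
  have h1 := le_card_mon_coeff_ne_zero (F := F) d
  have h2 : ((mon F d).filter fun h => h.coeff 0 ≠ 0).card ≤
      (lightPolys F d).card + ((mon F d).filter fun h => 9 ≤ weight h).card := by
    refine (card_le_card fun h hh => ?_).trans (card_union_le _ _)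
    rw [mem_filter] at hh
    rw [mem_union, lightPolys, mem_filter, mem_filter]
    by_cases hw : weight h ≤ 8
    · exact Or.inl ⟨hh.1, hh.2, hw⟩
    · exact Or.inr ⟨hh.1, by omega⟩
  have h3 : 9 * ((mon F d).filter fun h => 9 ≤ weight h).card ≤ 2 * Fintype.card F ^ d := by
    refine le_trans ?_ (sum_weight_le d)
    rw [mul_comm, ← smul_eq_mul]
    exact (card_nsmul_le_sum _ _ _ fun h hh => (mem_filter.1 hh).2).trans
      (sum_le_sum_of_subset (filter_subset _ _))
  have hq' : (4 : ℝ) ≤ Fintype.card F := by exact_mod_cast hq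
  have h4 : 1 / (Fintype.card F : ℝ) ≤ 1 / 4 := one_div_le_one_div_of_le (by norm_num) hq'
  have h5 : (0 : ℝ) ≤ (Fintype.card F : ℝ) ^ d := by positivity
  rify at h2 h3 ⊢
  nlinarith [mul_le_mul_of_nonneg_left h4 h5]

open scoped Classical in
/-- The roots of `f` as a `Finset`. -/
noncomputable def rootFinset (f : F[X]) : Finset F := univ.filter f.IsRoot

open scoped Classical in
/-- `badParams f` as a `Finset`. -/
noncomputable def badParamFinset (f : F[X]) : Finset F := univ.filter (· ∈ badParams f)

theorem card_badParamFinset_le_weight {f : F[X]} : (badParamFinset f).card ≤ weight f := by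
  classical
  refine le_trans (le_of_eq ?_) ncard_badParams_le_weight
  rw [Set.ncard_eq_toFinset_card']
  congr 1
  ext
  simp [badParamFinset]

theorem card_rootFinset_le_weight {f : F[X]} : (rootFinset f).card ≤ weight f := by
  classical
  rw [weight, numRoots_eq, rootFinset]
  exact Nat.le_add_right _ _

open scoped Classical in
/-- The values of the third root excluded in the construction of polynomials with a frame. -/
noncomputable def badThird (h : F[X]) (κ : F) : Finset F :=
  {0} ∪ rootFinset h ∪ (badParamFinset h).image (κ / ·) ∪ (nthRoots 3 (-κ)).toFinset

open scoped Classical in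
/-- The values of the first root excluded in the construction of polynomials with a frame. -/
noncomputable def badFirst (h : F[X]) (e b : F) : Finset F :=
  {0} ∪ {b} ∪ {e / b} ∪ rootFinset h ∪ (rootFinset h).image (e / ·) ∪ (nthRoots 2 e).toFinset

theorem card_badThird_le {h : F[X]} (hh : weight h ≤ 8) (κ : F) : (badThird h κ).card ≤ 20 := by
  classical
  have h1 := card_rootFinset_le_weight (f := h)
  have h2 := card_badParamFinset_le_weight (f := h)
  have h3 := (Multiset.toFinset_card_le (nthRoots 3 (-κ))).trans (card_nthRoots 3 (-κ))
  have h4 := card_image_le (s := badParamFinset h) (f := (κ / ·))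
  have h5 := card_union_le ({0} ∪ rootFinset h ∪ (badParamFinset h).image (κ / ·))
    (nthRoots 3 (-κ)).toFinset
  have h6 := card_union_le ({0} ∪ rootFinset h) ((badParamFinset h).image (κ / ·))
  have h7 := card_union_le {0} (rootFinset h)
  rw [card_singleton] at h7
  unfold badThird
  omega

theorem card_badFirst_le {h : F[X]} (hh : weight h ≤ 8) (e b : F) :
    (badFirst h e b).card ≤ 21 := by
  classical
  have h1 := card_rootFinset_le_weight (f := h)
  have h3 := (Multiset.toFinset_card_le (nthRoots 2 e)).trans (card_nthRoots 2 e)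
  have h4 := card_image_le (s := rootFinset h) (f := (e / ·))
  have h5 := card_union_le ({0} ∪ {b} ∪ {e / b} ∪ rootFinset h ∪ (rootFinset h).image (e / ·))
    (nthRoots 2 e).toFinset
  have h6 := card_union_le ({0} ∪ {b} ∪ {e / b} ∪ rootFinset h) ((rootFinset h).image (e / ·))
  have h7 := card_union_le ({0} ∪ {b} ∪ {e / b}) (rootFinset h)
  have h8 := card_union_le ({0} ∪ {b}) {e / b}
  have h9 := card_union_le {0} {b}
  rw [card_singleton] at h8 h9
  rw [card_singleton] at h9
  unfold badFirst
  omega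

/-- The three roots `a`, `-δ / h(0) / b / a` and `b` attached to the data `(h, b, a)`. -/
noncomputable def frameRoots (δ : F) (s : Σ _ : F[X], Σ _ : F, F) : Fin 3 → F :=
  ![s.2.2, -δ / s.1.coeff 0 / s.2.1 / s.2.2, s.2.1]

/-- The polynomial with roots `frameRoots δ (h, b, a)` and cofactor `h`. -/
noncomputable def framePoly (δ : F) (s : Σ _ : F[X], Σ _ : F, F) : F[X] :=
  (∏ i, (X - C (frameRoots δ s i))) * s.1

open scoped Classical in
/-- The parameters of polynomials with a frame and constant coefficient `δ`. -/
noncomputable def frameData (d : ℕ) (δ : F) : Finset (Σ _ : F[X], Σ _ : F, F) :=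
  (lightPolys F d).sigma fun h => (univ \ badThird h (-δ / h.coeff 0)).sigma fun b =>
    univ \ badFirst h (-δ / h.coeff 0 / b) b

theorem pow_le_card_frameData (hq : 80 ≤ Fintype.card F) (d : ℕ) (δ : F) :
    Fintype.card F ^ (d + 2) ≤ 4 * (frameData d δ).card := by
  classical
  set q := Fintype.card F with hqF
  have h1 : ∀ h ∈ lightPolys F d, (q - 20) * (q - 21) ≤
      ((univ \ badThird h (-δ / h.coeff 0)).sigma fun b =>
        univ \ badFirst h (-δ / h.coeff 0 / b) b).card := by
    intro h hh
    have hw := (mem_filter.1 hh).2.2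
    rw [card_sigma]
    have h3 := card_badThird_le hw (-δ / h.coeff 0)
    have h4 : q - 20 ≤ (univ \ badThird h (-δ / h.coeff 0)).card := by
      rw [card_univ_sdiff, ← hqF]
      omega
    refine (Nat.mul_le_mul_right _ h4).trans ?_
    rw [← smul_eq_mul]
    refine card_nsmul_le_sum _ _ _ fun b _ => ?_
    have h5 := card_badFirst_le hw (-δ / h.coeff 0 / b) b
    rw [card_univ_sdiff, ← hqF]
    omega
  have h2 : (lightPolys F d).card * ((q - 20) * (q - 21)) ≤ (frameData d δ).card := by
    rw [frameData, card_sigma, ← smul_eq_mul]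
    exact card_nsmul_le_sum _ _ _ h1
  have h3 := pow_le_two_mul_card_lightPolys (F := F) (by omega) d
  have h4 : q ^ 2 ≤ 2 * ((q - 20) * (q - 21)) := by
    obtain ⟨k, hk⟩ := Nat.exists_eq_add_of_le hq
    rw [hk, show 80 + k - 20 = 60 + k by omega, show 80 + k - 21 = 59 + k by omega]
    nlinarith
  calc q ^ (d + 2) = q ^ d * q ^ 2 := pow_add _ _ _
    _ ≤ (2 * (lightPolys F d).card) * (2 * ((q - 20) * (q - 21))) := Nat.mul_le_mul h3 h4
    _ ≤ _ := by linarith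

section FramePoly

variable {d : ℕ} {δ : F} {s : Σ _ : F[X], Σ _ : F, F}

theorem framePoly_eq : framePoly δ s = (X - C (frameRoots δ s 0)) *
    ((X - C (frameRoots δ s 1)) * ((X - C (frameRoots δ s 2)) * s.1)) := by
  rw [framePoly, Fin.prod_univ_three]
  ring

theorem framePoly_mem (hδ : δ ≠ 0) (hs : s ∈ frameData d δ) :
    framePoly δ s ∈ monC (d + 3) δ ∧ HasFrame 1 (framePoly δ s) := by
  classical
  obtain ⟨h, b, a⟩ := s
  simp only [frameData, lightPolys, mem_sigma, mem_filter, mem_mon, mem_sdiff, mem_univ, true_and]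
    at hs
  obtain ⟨⟨hm, h0, hw⟩, hb, ha⟩ := hs
  have hR : ∀ x, x ∈ rootFinset h ↔ h.eval x = 0 := by simp [rootFinset]
  have hD : ∀ x, x ∈ badParamFinset h ↔ x ∈ badParams h := by simp [badParamFinset]
  have hκ0 : -δ / h.coeff 0 ≠ 0 := div_ne_zero (neg_ne_zero.2 hδ) h0
  have hκ : -δ / h.coeff 0 * h.coeff 0 = -δ := div_mul_cancel₀ _ h0
  set κ := -δ / h.coeff 0 with hκd
  simp only [badThird, mem_union, mem_singleton, not_or, mem_image, not_exists, not_and,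
    Multiset.mem_toFinset, mem_nthRoots (show 0 < 3 by norm_num), hR, hD] at hb
  obtain ⟨⟨⟨hb0, hbR⟩, hbD⟩, hb3⟩ := hb
  have he : κ / b * b = κ := div_mul_cancel₀ _ hb0
  have he0 : κ / b ≠ 0 := div_ne_zero hκ0 hb0
  set e := κ / b with hed
  simp only [badFirst, mem_union, mem_singleton, not_or, mem_image, not_exists, not_and,
    Multiset.mem_toFinset, mem_nthRoots (show 0 < 2 by norm_num), hR] at ha
  obtain ⟨⟨⟨⟨⟨ha0, hab⟩, haeb⟩, haR⟩, haI⟩, ha2⟩ := ha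
  have hc : e / a * a = e := div_mul_cancel₀ _ ha0
  have hc0 : e / a ≠ 0 := div_ne_zero he0 ha0
  set c := e / a with hcd
  have hα : frameRoots δ ⟨h, b, a⟩ = ![a, c, b] := rfl
  have hbad : e ∉ badParams h := fun h1 => hbD e h1 (by rw [← he]; field_simp)
  have hbe : b ^ 2 + e ≠ 0 := fun h1 => hb3 (by
    rw [← he]
    linear_combination b * h1)
  have hcR : h.eval c ≠ 0 := fun h1 => haI c h1 (by rw [← hc]; field_simp)
  have hac : a ≠ c := fun h1 => ha2 (by rw [← hc, ← h1]; ring)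
  have hcb : c ≠ b := fun h1 => haeb (by rw [← hc, h1]; field_simp)
  refine ⟨mem_monC.2 ⟨?_, ?_⟩, ![a, c, b], h, ?_, ?_, by rw [framePoly, hα], ?_, ?_, ?_⟩
  · rw [framePoly_eq]
    rw [show d + 3 = 1 + (1 + (1 + d)) by omega]
    exact monic_mul_mem (X_sub_C_mem (frameRoots δ ⟨h, b, a⟩ 0)) (monic_mul_mem
      (X_sub_C_mem (frameRoots δ ⟨h, b, a⟩ 1)) (monic_mul_mem
      (X_sub_C_mem (frameRoots δ ⟨h, b, a⟩ 2)) hm))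
  · rw [framePoly_eq, hα]
    simp [mul_coeff_zero]
    linear_combination (-h.coeff 0 * b) * hc - h.coeff 0 * he - hκ
  · intro i j hij
    fin_cases i <;> fin_cases j <;> simp at hij ⊢
    all_goals first | exact hab hij | exact hac hij | exact hcb hij | exact hab hij.symm |
      exact hac hij.symm | exact hcb hij.symm
  · intro i
    fin_cases i
    exacts [ha0, hc0, hb0]
  · intro i
    fin_cases i
    exacts [haR, hcR, hbR]
  · have h1 : (![a, c, b] : Fin 3 → F) 0 * (![a, c, b] : Fin 3 → F) 1 = e := by
      rw [← hc]
      exact mul_comm _ _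
    have h2 : IsCoprime (X ^ 2 + C e) ((X - C b) * h) := by
      refine (isCoprime_X_sub_C ?_).mul_right (not_not.1 hbad)
      simpa using hbe
    rw [Fin.prod_univ_one]
    exact h1.symm ▸ h2
  · rw [framePoly_eq]
    have h1 := ncard_badParams_le_weight (f := h)
    have h2 := ncard_badParams_X_sub_C_mul_le (frameRoots δ ⟨h, b, a⟩ 2) h
    have h3 := ncard_badParams_X_sub_C_mul_le (frameRoots δ ⟨h, b, a⟩ 1)
      ((X - C (frameRoots δ ⟨h, b, a⟩ 2)) * h)
    have h4 := ncard_badParams_X_sub_C_mul_le (frameRoots δ ⟨h, b, a⟩ 0)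
      ((X - C (frameRoots δ ⟨h, b, a⟩ 1)) * ((X - C (frameRoots δ ⟨h, b, a⟩ 2)) * h))
    exact h4.trans (by omega)

open scoped Classical in
theorem card_filter_framePoly_le (f : F[X]) :
    ((frameData d δ).filter (framePoly δ · = f)).card ≤ 11 ^ 3 := by
  rcases eq_empty_or_nonempty ((frameData d δ).filter (framePoly δ · = f)) with he | ⟨s, hs⟩
  · rw [he]
    simp
  have hf : (rootFinset f).card ≤ 11 := by
    rw [rootFinset, ← numRoots_eq]
    rw [mem_filter, framePoly_eq, frameData, mem_sigma, lightPolys, mem_filter, weight] at hs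
    rw [← hs.2]
    have hw := hs.1.1.2.2
    have h1 := fun x g => (numRoots_mul_le (X - C x) g).trans_eq
      (congrArg (· + numRoots g) (numRoots_X_sub_C (F := F) x))
    have h2 := h1 (frameRoots δ s 1) ((X - C (frameRoots δ s 2)) * s.1)
    have h3 := h1 (frameRoots δ s 2) s.1
    exact (h1 _ _).trans (by omega)
  have h1 : ((frameData d δ).filter (framePoly δ · = f)).card ≤
      (Fintype.piFinset fun _ : Fin 3 => rootFinset f).card := by
    refine card_le_card_of_injOn (frameRoots δ) ?_ ?_
    · intro s hs
      rw [mem_coe, mem_filter] at hs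
      rw [mem_coe, Fintype.mem_piFinset]
      intro i
      rw [rootFinset, mem_filter]
      refine ⟨mem_univ _, ?_⟩
      rw [← hs.2, framePoly, IsRoot.def, eval_mul, eval_prod,
        prod_eq_zero (mem_univ i) (by simp), zero_mul]
    · intro s hs t ht hst
      rw [mem_coe, mem_filter] at hs ht
      have h2 := hs.2.trans ht.2.symm
      rw [framePoly, framePoly, hst] at h2
      have h3 := mul_left_cancel₀ (prod_ne_zero_iff.2 fun i _ => X_sub_C_ne_zero _) h2
      have h4 := congrFun hst 0
      have h5 := congrFun hst 2
      obtain ⟨h, b, a⟩ := s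
      obtain ⟨h', b', a'⟩ := t
      simp [frameRoots] at h3 h4 h5
      subst h3 h4 h5
      rfl
  rw [Fintype.card_piFinset_const] at h1
  exact h1.trans (Nat.pow_le_pow_left hf 3)

end FramePoly

end BostonShalev

namespace BostonShalev

open Polynomial Finset Matrix

variable {F : Type*} [Field F] [Fintype F] {n d : ℕ} {δ : F}

open scoped Classical in
theorem ncard_classPolys_le_of_fibers {G : Subgroup (GL (Fin (n + 1)) F)} {P : F[X] → Prop} {c : ℕ}
    (h : ∀ δ ∈ constants G, Fintype.card F ^ n ≤ c * ((monC (n + 1) δ).filter P).card) :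
    (classPolys G).ncard ≤ c * {f | f ∈ classPolys G ∧ P f}.ncard := by
  have hfin : {f | f ∈ classPolys G ∧ P f}.Finite :=
    (finite_classPolys G).subset fun f hf => hf.1
  have hcon : (constants G).Finite := Set.toFinite _
  rw [ncard_classPolys, Set.ncard_eq_toFinset_card _ hfin, Set.ncard_eq_toFinset_card _ hcon,
    card_eq_sum_card_fiberwise (f := fun f : F[X] => f.coeff 0) (t := hcon.toFinset) (by
      intro f hf
      have := (hfin.mem_toFinset.1 hf).1.2
      exact hcon.mem_toFinset.2 this), mul_sum, ← smul_eq_mul]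
  refine card_nsmul_le_sum _ _ _ fun δ hδ => (h δ (hcon.mem_toFinset.1 hδ)).trans
    (Nat.mul_le_mul_left _ (card_le_card fun f hf => ?_))
  rw [mem_filter, mem_monC] at hf
  rw [mem_filter, hfin.mem_toFinset]
  have hf0 : f.coeff 0 ∈ constants G := by
    rw [hf.1.2]
    exact hcon.mem_toFinset.1 hδ
  exact ⟨⟨⟨hf.1.1, hf0⟩, hf.2⟩, hf.1.2⟩

theorem ncard_classPolys_le_hasFrame_one {G : Subgroup (GL (Fin (d + 2 + 1)) F)}
    (hq : 80 ≤ Fintype.card F) :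
    (classPolys G).ncard ≤ 5324 * {f | f ∈ classPolys G ∧ HasFrame 1 f}.ncard := by
  classical
  refine ncard_classPolys_le_of_fibers fun δ hδ => ?_
  have hδ0 := constants_ne_zero hδ
  have h1 := pow_le_card_frameData hq d δ
  have h2 := card_le_mul_card_image (f := framePoly δ) (frameData d δ) (11 ^ 3)
    fun f _ => card_filter_framePoly_le f
  have h3 : ((frameData d δ).image (framePoly δ)).card ≤
      ((monC (d + 2 + 1) δ).filter (HasFrame 1)).card := by
    refine card_le_card fun f hf => ?_
    obtain ⟨s, hs, rfl⟩ := mem_image.1 hf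
    exact mem_filter.2 (framePoly_mem hδ0 hs)
  omega

theorem hasFrame_zero {a b : F} (ha : a ≠ 0) (hb : b ≠ 0) (hab : a ≠ b) :
    HasFrame 0 ((X - C a) * ((X - C b) * 1)) := by
  refine ⟨![a, b], 1, ?_, ?_, ?_, ?_, ?_, ?_⟩
  · intro i j hij
    fin_cases i <;> fin_cases j <;> simp at hij ⊢
    · exact hab hij
    · exact hab hij.symm
  · intro i
    fin_cases i
    exacts [ha, hb]
  · rw [Fin.prod_univ_two]
    simp
  · simp
  · simpa using isCoprime_one_right
  · have h1 := ncard_badParams_X_sub_C_mul_le b (1 : F[X])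
    have h2 := ncard_badParams_X_sub_C_mul_le a ((X - C b) * 1)
    have h3 : (badParams (1 : F[X])).ncard = 0 := by
      rw [Set.ncard_eq_zero]
      ext δ
      simp [badParams, isCoprime_one_right]
    omega

theorem ncard_classPolys_le_hasFrame_zero {G : Subgroup (GL (Fin (1 + 1)) F)}
    (hq : 80 ≤ Fintype.card F) :
    (classPolys G).ncard ≤ 5324 * {f | f ∈ classPolys G ∧ HasFrame 0 f}.ncard := by
  classical
  refine ncard_classPolys_le_of_fibers fun δ hδ => ?_
  have hδ0 := constants_ne_zero hδ
  set A : Finset F := univ \ ({0} ∪ (nthRoots 2 δ).toFinset) with hA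
  have hAm : ∀ a ∈ A, a ≠ 0 ∧ a ^ 2 ≠ δ := by
    intro a ha
    simpa [hA, mem_nthRoots (show 0 < 2 by norm_num)] using ha
  have h1 : Fintype.card F ≤ A.card + 3 := by
    have h3 := (Multiset.toFinset_card_le (nthRoots 2 δ)).trans (card_nthRoots 2 δ)
    have h4 := card_union_le {0} (nthRoots 2 δ).toFinset
    rw [card_singleton] at h4
    rw [hA, card_univ_sdiff]
    omega
  set Φ : F → F[X] := fun a => (X - C a) * ((X - C (δ / a)) * 1) with hΦ
  have h2 : A.card ≤ 2 * (A.image Φ).card := by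
    refine card_le_mul_card_image _ _ fun f hf => ?_
    obtain ⟨b, hb, rfl⟩ := mem_image.1 hf
    have hm : Φ b ∈ monics F (1 + (1 + 0)) := monic_mul_mem (X_sub_C_mem _)
      (monic_mul_mem (X_sub_C_mem _) ⟨monic_one, natDegree_one⟩)
    refine (card_le_degree_of_subset_roots fun a ha => ?_).trans_eq hm.2
    rw [mem_roots hm.1.ne_zero, ← (mem_filter.1 ha).2]
    simp [hΦ]
  have h3 : (A.image Φ).card ≤ ((monC (1 + 1) δ).filter (HasFrame 0)).card := by
    refine card_le_card fun f hf => ?_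
    obtain ⟨a, ha, rfl⟩ := mem_image.1 hf
    obtain ⟨ha0, ha2⟩ := hAm a ha
    refine mem_filter.2 ⟨mem_monC.2 ⟨monic_mul_mem (X_sub_C_mem _)
      (monic_mul_mem (n := 0) (X_sub_C_mem _) ⟨monic_one, natDegree_one⟩), ?_⟩,
      hasFrame_zero ha0 (div_ne_zero hδ0 ha0) fun h => ha2 ?_⟩
    · simp [hΦ, mul_coeff_zero]
      field_simp
    · rw [pow_two]
      nth_rewrite 2 [h]
      field_simp
  rw [pow_one]
  omega

end BostonShalev

namespace BostonShalev

open Polynomial Matrix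

section

variable {F : Type*} [Field F] [Fintype F] {n : ℕ}

theorem ncard_classPolys_le (G : Subgroup (GL (Fin (n + 1)) F)) :
    (classPolys G).ncard ≤ Fintype.card F ^ (n + 1) := by
  rw [ncard_classPolys, pow_succ']
  refine Nat.mul_le_mul_right _ ?_
  rw [← Nat.card_eq_fintype_card]
  exact Set.ncard_le_card _

theorem one_le_missed {G H : Subgroup (GL (Fin n) F)} (hHG : H < G) : 1 ≤ missed G H := by
  classical
  refine le_trans ?_ ncard_charpoly_derangements_le
  obtain ⟨g, hg⟩ := derangements_nonempty hHG
  refine (Set.ncard_pos ?_).2 ⟨g.1.charpoly, g, hg, rfl⟩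
  exact (Set.toFinite (derangements G H)).image fun g => g.1.charpoly

theorem ncard_classPolys_le_of_card_lt {Q W D : ℕ} (hQ : Fintype.card F < Q)
    (hW : W = 12 * Q * (Q ^ 12 * (8 * Q)) ^ 24) (hD : D = W + 13)
    {G H : Subgroup (GL (Fin (n + 1)) F)} (hG : ContainsSL G) (hHG : H ≤ G)
    (hH : ¬ ContainsSL H) :
    ((classPolys G).ncard : ℝ) ≤ (1024 + 2 * W * Q ^ (D + 1) + Q ^ D) * missed G H := by
  set q := Fintype.card F with hq
  have hq2 : 2 ≤ q := Fintype.one_lt_card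
  have hlt : H < G := lt_of_le_of_ne hHG fun h => hH (h ▸ hG)
  have h1 := one_le_missed hlt
  have hN := ncard_classPolys_le G
  rw [← hq] at hN
  by_cases hn : n + 1 < D
  · have : (classPolys G).ncard ≤ Q ^ D * missed G H := calc
      _ ≤ q ^ (n + 1) := hN
      _ ≤ Q ^ D := (Nat.pow_le_pow_left hQ.le _).trans (Nat.pow_le_pow_right (by omega) hn.le)
      _ ≤ _ := Nat.le_mul_of_pos_right _ h1
    rify at this
    nlinarith [show (0 : ℝ) ≤ (1024 + 2 * W * Q ^ (D + 1)) * missed G H by positivity]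
  · rw [not_lt] at hn
    by_cases hm : 2 * W * Q ^ (D + 1) * missed G H < q ^ (n + 1)
    · have hWq : 12 * q * (q ^ 12 * (8 * q)) ^ (2 * 12) ≤ W := by
        rw [hW]; gcongr
      have hWD : 2 * W ≤ q ^ D := calc
        2 * W ≤ 2 * 2 ^ W := Nat.mul_le_mul_left _ Nat.lt_two_pow_self.le
        _ = 2 ^ (W + 1) := (pow_succ' _ _).symm
        _ ≤ 2 ^ D := Nat.pow_le_pow_right (by norm_num) (by omega)
        _ ≤ q ^ D := Nat.pow_le_pow_left hq2 _
      have hA : 2 * W * q ^ (n + 1 - D) ≤ q ^ (n + 1) := calc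
        _ ≤ q ^ D * q ^ (n + 1 - D) := Nat.mul_le_mul_right _ hWD
        _ = _ := by rw [← pow_add, Nat.add_sub_cancel' hn]
      have hB : 2 * W * (missed G H * q ^ (D + 1)) < q ^ (n + 1) := by
        refine lt_of_le_of_lt ?_ hm
        rw [mul_comm (missed G H), ← mul_assoc]
        gcongr
      obtain ⟨B, C, h⟩ := exists_tPair_of_missed_lt (K := 12) hG hHG (by omega) D (by
        rw [← hq]
        refine (Nat.mul_le_mul_right _ hWq).trans_lt ?_
        rw [mul_add]
        rw [mul_assoc] at hA hB
        omega)
      refine (ncard_classPolys_le_of_tPair hG hH (by norm_num) ?_ h).trans ?_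
      · exact (Nat.pow_le_pow_left hq2 10 : 2 ^ 10 ≤ q ^ 10)
      · nlinarith [show (0 : ℝ) ≤ (2 * W * Q ^ (D + 1) + Q ^ D) * missed G H by positivity]
    · have : (classPolys G).ncard ≤ 2 * W * Q ^ (D + 1) * missed G H := by omega
      rify at this
      nlinarith [show (0 : ℝ) ≤ (1024 + Q ^ D) * missed G H by positivity]

theorem containsSL_of_blockGL_mem {H : Subgroup (GL (Fin n) F)}
    {B C : Matrix (Fin n) (Fin n) F} (h : C * B = 1)
    (hH : ∀ x : GL (Fin n) F, x.1.det = 1 → blockGL h x ∈ H) : ContainsSL H := by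
  have h' : B * C = 1 := mul_eq_one_comm.1 h
  intro s hs
  let b : GL (Fin n) F := ⟨B, C, h', h⟩
  have hdet : (b⁻¹ * s * b).1.det = 1 := by
    have hd := det_eq_one_iff_mem_range.1 hs
    rw [Units.val_mul, Units.val_mul, Matrix.det_mul, Matrix.det_mul, hd, mul_one,
      ← Matrix.det_mul, ← Units.val_mul, inv_mul_cancel, Units.val_one, Matrix.det_one]
  convert hH _ hdet
  ext1
  rw [coe_blockGL]
  change s.1 = 1 + B * (C * s.1 * B - 1) * C
  have : B * (C * s.1 * B - 1) * C = (B * C) * s.1 * (B * C) - B * C := by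
    noncomm_ring
  rw [this, h']
  simp

theorem ncard_classPolys_le_of_le_card [DecidableEq F] (hq : 10 ^ 6 ≤ Fintype.card F)
    {G H : Subgroup (GL (Fin (n + 2)) F)} (hG : ContainsSL G) (hHG : H ≤ G)
    (hH : ¬ ContainsSL H) :
    ((classPolys G).ncard : ℝ) ≤ 10 ^ 6 * missed G H := by
  have key : ∀ S ≤ (classPolys G).ncard, (classPolys G).ncard ≤ 5324 * S →
      (S : ℝ) * (Fintype.card F - 1) ≤
        51 * ((classPolys G).ncard + Fintype.card F * missed G H) →
      ((classPolys G).ncard : ℝ) ≤ 10 ^ 6 * missed G H := by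
    intro S _ h1 h2
    rify at h1 hq
    generalize (Fintype.card F : ℝ) = q at *
    have hN : (0 : ℝ) ≤ (classPolys G).ncard := by positivity
    have hM : (0 : ℝ) ≤ missed G H := by positivity
    generalize ((classPolys G).ncard : ℝ) = N at *
    generalize (missed G H : ℝ) = M at *
    have h3 : N * (q - 1) ≤ 271524 * (N + q * M) := by nlinarith
    by_contra! h4
    nlinarith
  have hS : ∀ r, {f | f ∈ classPolys G ∧ HasFrame r f} ⊆ classPolys G := fun r f hf => hf.1
  have hle := fun r => Set.ncard_le_ncard (hS r) (finite_classPolys G)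
  match n with
  | 0 =>
    rcases exists_block_or_ncard_le hG hHG (by omega) (hS 0) fun f hf => hf.2 with
      ⟨B, C, h, hx⟩ | h
    · exact absurd (containsSL_of_blockGL_mem h hx) hH
    · exact key _ (hle 0) (ncard_classPolys_le_hasFrame_zero (by omega)) h
  | d + 1 =>
    rcases exists_block_or_ncard_le hG hHG (by omega) (hS 1) fun f hf => hf.2 with
      ⟨B, C, h, hx⟩ | h
    · refine (ncard_classPolys_le_of_tPair hG hH le_rfl ?_ (tPair_of_blockGL_mem h hx)).trans ?_
      · rw [show 3 - 2 = 1 from rfl, pow_one]; omega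
      · gcongr; norm_num
    · exact key _ (hle 1) (ncard_classPolys_le_hasFrame_one (by omega)) h

end

theorem exists_ncard_classPolys_le : ∃ c : ℝ, 0 < c ∧ ∀ (F : Type) [Field F] [Fintype F]
    [DecidableEq F] (n : ℕ) (G H : Subgroup (GL (Fin (n + 2)) F)), ContainsSL G → H ≤ G →
      ¬ ContainsSL H → ((classPolys G).ncard : ℝ) ≤ c * missed G H := by
  obtain ⟨Q, hQ⟩ : ∃ Q : ℕ, Q = 10 ^ 6 := ⟨_, rfl⟩
  obtain ⟨W, hW⟩ : ∃ W : ℕ, W = 12 * Q * (Q ^ 12 * (8 * Q)) ^ 24 := ⟨_, rfl⟩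
  obtain ⟨D, hD⟩ : ∃ D : ℕ, D = W + 13 := ⟨_, rfl⟩
  refine ⟨10 ^ 6 + (1024 + 2 * W * Q ^ (D + 1) + Q ^ D), by positivity, ?_⟩
  intro F _ _ _ n G H hG hHG hH
  rw [add_mul]
  rcases lt_or_ge (Fintype.card F) Q with h | h
  · exact (ncard_classPolys_le_of_card_lt h hW hD hG hHG hH).trans
      (le_add_of_nonneg_left (by positivity))
  · exact (ncard_classPolys_le_of_le_card (hQ ▸ h) hG hHG hH).trans
      (le_add_of_nonneg_right (by positivity))

end BostonShalev

/-- **Boston–Shalev for conjugacy classes, linear case.**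
There is an absolute constant `ε > 0` such that for every finite field `F`, every `n ≥ 2`,
every group `G` with `SL_n(F) ≤ G ≤ GL_n(F)`, and every maximal proper subgroup `M` of `G`
not containing `SL_n(F)`, the number of conjugacy classes of `G` disjoint from `M` (i.e.
consisting of derangements in the primitive action of `G` on `G/M`) is at least `ε` times the
total number of conjugacy classes of `G`. -/
theorem stmt19 : ∃ ε : ℝ, 0 < ε ∧
    ∀ (F : Type) [Field F] [Fintype F] [DecidableEq F], ∀ n : ℕ, 2 ≤ n →
      ∀ G : Subgroup (GL (Fin n) F),
        (Matrix.SpecialLinearGroup.toGL (n := Fin n) (R := F)).range ≤ G →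
        ∀ M : Subgroup G, IsCoatom M →
          ¬(Subgroup.comap G.subtype
              (Matrix.SpecialLinearGroup.toGL (n := Fin n) (R := F)).range ≤ M) →
          ε * (Nat.card (ConjClasses G) : ℝ) ≤
            (Nat.card {c : ConjClasses G |
                ∀ g ∈ ConjClasses.carrier c, g ∉ M} : ℝ) := by
  obtain ⟨c, hc, hmain⟩ := BostonShalev.exists_ncard_classPolys_le
  refine ⟨(41 * Real.exp 6 * c)⁻¹, by positivity, ?_⟩
  intro F _ _ _ n hn G hG M _ hM
  obtain ⟨N, rfl⟩ := Nat.exists_eq_add_of_le' hn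
  have hmem : ∀ g : G, (g : GL (Fin (N + 2)) F) ∈ M.map G.subtype ↔ g ∈ M := fun g =>
    Subgroup.mem_map_iff_mem G.subtype_injective
  have hH : ¬ BostonShalev.ContainsSL (M.map G.subtype) := fun h =>
    hM fun g hg => (hmem g).1 (h hg)
  have h1 := hmain F N G (M.map G.subtype) hG (Subgroup.map_subtype_le M) hH
  have h2 := BostonShalev.card_conjClasses_le hG
  have h3 : BostonShalev.missed G (M.map G.subtype) =
      Nat.card {c : ConjClasses G | ∀ g ∈ ConjClasses.carrier c, g ∉ M} := by
    simp only [BostonShalev.missed, hmem, Nat.card_coe_set_eq]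
  rw [h3] at h1
  rw [inv_mul_le_iff₀ (by positivity), mul_assoc]
  exact h2.trans (mul_le_mul_of_nonneg_left h1 (by positivity))
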